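/- Let k ≥ 1 be an integer and let a be a real algebraic number with 0 < a < 1. Then the real number (4/(1+a^k)^{(k−1)/k}) · ∫₀^{π/2} (1 − (4a^k/(1+a^k)²)·sin²φ)^{−(k−1)/(2k)} dφ, which equals the total length of the regular lemniscate C_{a,k} = {z ∈ ℂ : |z^k − a^k| = 1}, is transcendental over ℚ. -/

import Mathlib

namespace Lemniscate

open Metric Set Filter Topology

section WordDeriv

variable {V : Type*} [NormedAddCommGroup V] [NormedSpace ℂ V]

/-- Iterated directional derivatives along a list of vectors; the head of the list acts first. -/
noncomputable def wordDeriv : List V → (V → ℂ) → V → ℂ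
  | [], h => h
  | v :: ws, h => wordDeriv ws (fun z => fderiv ℂ h z v)

theorem analyticOnNhd_fderiv_apply {h : V → ℂ} {U : Set V} (hh : AnalyticOnNhd ℂ h U) (v : V) :
    AnalyticOnNhd ℂ (fun z => fderiv ℂ h z v) U := fun z hz =>
  ((ContinuousLinearMap.apply ℂ ℂ v).analyticAt _).comp (hh.fderiv z hz)

theorem wordDeriv_analyticOnNhd {U : Set V} (ws : List V) :
    ∀ {h : V → ℂ}, AnalyticOnNhd ℂ h U → AnalyticOnNhd ℂ (wordDeriv ws h) U := by
  induction ws with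
  | nil => exact fun h => h
  | cons v ws ih => exact fun hh => ih (analyticOnNhd_fderiv_apply hh v)

theorem wordDeriv_append (l₁ l₂ : List V) (h : V → ℂ) :
    wordDeriv (l₁ ++ l₂) h = wordDeriv l₂ (wordDeriv l₁ h) := by
  induction l₁ generalizing h with
  | nil => rfl
  | cons v ws ih => exact ih _

theorem wordDeriv_congr {U : Set V} (hU : IsOpen U) (ws : List V) :
    ∀ {h g : V → ℂ}, EqOn h g U → EqOn (wordDeriv ws h) (wordDeriv ws g) U := by
  induction ws with
  | nil => exact fun h => h
  | cons v ws ih =>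
    refine fun {h g} hg => ih fun z hz => ?_
    have : h =ᶠ[𝓝 z] g := hg.eventuallyEq_of_mem (hU.mem_nhds hz)
    simp only [this.fderiv_eq]

theorem wordDeriv_perm {U : Set V} (hU : IsOpen U) {l₁ l₂ : List V} (hl : l₁.Perm l₂) :
    ∀ {h : V → ℂ}, AnalyticOnNhd ℂ h U → EqOn (wordDeriv l₁ h) (wordDeriv l₂ h) U := by
  induction hl with
  | nil => exact fun _ _ _ => rfl
  | cons v _ ih => exact fun hh => ih (analyticOnNhd_fderiv_apply hh v)
  | swap v w l =>
    refine fun {h} hh => wordDeriv_congr hU l fun z hz => ?_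
    have hd : DifferentiableAt ℂ (fderiv ℂ h) z := (hh.fderiv z hz).differentiableAt
    have hs : IsSymmSndFDerivAt ℂ h z :=
      (hh z hz).contDiffAt.isSymmSndFDerivAt (n := ⊤) (by simp)
    simp only [fderiv_clm_apply hd (differentiableAt_const _), fderiv_fun_const]
    simpa using hs v w
  | trans _ _ ih₁ ih₂ => exact fun hh => (ih₁ hh).trans (ih₂ hh)

theorem wordDeriv_sum {U : Set V} (hU : IsOpen U) {ι : Type*} (s : Finset ι) (c : ι → ℂ)
    (ws : List V) : ∀ {h : ι → V → ℂ}, (∀ i ∈ s, AnalyticOnNhd ℂ (h i) U) →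
      EqOn (wordDeriv ws (fun z => ∑ i ∈ s, c i * h i z))
        (fun z => ∑ i ∈ s, c i * wordDeriv ws (h i) z) U := by
  induction ws with
  | nil => exact fun _ _ _ => rfl
  | cons v ws ih =>
    refine fun {h} hh => ?_
    refine EqOn.trans (wordDeriv_congr hU ws fun z hz => ?_)
      (ih fun i hi => analyticOnNhd_fderiv_apply (hh i hi) v)
    have hd : ∀ i ∈ s, DifferentiableAt ℂ (h i) z := fun i hi => (hh i hi z hz).differentiableAt
    rw [fderiv_fun_sum fun i hi => (hd i hi).const_mul (c i)]
    simp only [sum_apply]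
    refine Finset.sum_congr rfl fun i hi => ?_
    rw [fderiv_const_mul (hd i hi)]
    rfl

/-- If all words of length less than `|ws|` vanish on `F` at `p`, then differentiating `g * F`
along `ws` at `p` only differentiates `F`. -/
theorem wordDeriv_mul_of_vanishing {U : Set V} (hU : IsOpen U) {p : V} (hp : p ∈ U) (W : Set V)
    (ws : List V) : (∀ v ∈ ws, v ∈ W) → ∀ {g F : V → ℂ}, AnalyticOnNhd ℂ g U →
      AnalyticOnNhd ℂ F U →
      (∀ l : List V, (∀ v ∈ l, v ∈ W) → l.length < ws.length → wordDeriv l F p = 0) →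
      wordDeriv ws (fun z => g z * F z) p = g p * wordDeriv ws F p := by
  induction ws with
  | nil => exact fun _ _ _ _ _ _ => rfl
  | cons v ws ih =>
    intro hW g F hg hF hz
    have hW' : ∀ v ∈ ws, v ∈ W := fun w hw => hW w (List.mem_cons_of_mem _ hw)
    have hg' := analyticOnNhd_fderiv_apply hg v
    have hF' := analyticOnNhd_fderiv_apply hF v
    have h1 : EqOn (fun z => fderiv ℂ (fun z => g z * F z) z v)
        (fun z => ∑ i : Fin 2, (1 : ℂ) * (![fun z => fderiv ℂ g z v * F z,
          fun z => g z * fderiv ℂ F z v] i) z) U := by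
      intro z hz
      simp only [Fin.sum_univ_two]
      rw [fderiv_fun_mul (hg z hz).differentiableAt (hF z hz).differentiableAt]
      simp
      ring
    have h2 := (wordDeriv_congr hU ws h1).trans (wordDeriv_sum hU _ (fun _ => 1) ws (by
      intro i _
      fin_cases i
      · exact hg'.mul hF
      · exact hg.mul hF'))
    have h3 := h2 hp
    simp only [Fin.sum_univ_two, one_mul, Matrix.cons_val_zero, Matrix.cons_val_one] at h3
    change wordDeriv ws (fun z => fderiv ℂ (fun z => g z * F z) z v) p = _
    rw [h3, ih hW' hg' hF fun l hl hl' => hz l hl (by simp; omega),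
      ih hW' hg hF' fun l hl hl' => hz (v :: l) (by
        intro w hw
        rcases List.mem_cons.1 hw with rfl | hw
        · exact hW _ (by simp)
        · exact hl w hw) (by simpa using hl'),
      hz ws hW' (by simp)]
    simp [wordDeriv]

/-- Bounding word derivatives through words in a spanning family. -/
theorem norm_wordDeriv_le_of_basis {U : Set V} (hU : IsOpen U) {p : V} (hp : p ∈ U)
    {ι : Type*} [Fintype ι] (e : ι → V) {W : Set V} {A B : ℝ} (hA : 0 ≤ A) (hB0 : 0 ≤ B)
    (hW : ∀ v ∈ W, ∃ c : ι → ℂ, v = ∑ i, c i • e i ∧ ∑ i, ‖c i‖ ≤ A)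
    {h : V → ℂ} (hh : AnalyticOnNhd ℂ h U) {T : ℕ}
    (hB : ∀ l : List ι, l.length = T → ‖wordDeriv (l.map e) h p‖ ≤ B) :
    ∀ ws : List V, (∀ v ∈ ws, v ∈ W) → ws.length = T → ‖wordDeriv ws h p‖ ≤ A ^ T * B := by
  suffices H : ∀ ws : List V, (∀ v ∈ ws, v ∈ W) → ∀ l : List ι, ws.length + l.length = T →
      ‖wordDeriv (ws ++ l.map e) h p‖ ≤ A ^ ws.length * B by
    intro ws hws hT
    simpa [hT] using H ws hws [] (by simpa using hT)
  intro ws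
  induction ws with
  | nil => exact fun _ l hl => by simpa using hB l (by simpa using hl)
  | cons v ws ih =>
    intro hws l hl
    obtain ⟨c, rfl, hc⟩ := hW v (hws v (by simp))
    have hws' : ∀ v ∈ ws, v ∈ W := fun w hw => hws w (List.mem_cons_of_mem _ hw)
    have h1 : EqOn (fun z => fderiv ℂ h z (∑ i, c i • e i))
        (fun z => ∑ i, c i * fderiv ℂ h z (e i)) U := fun z _ => by simp
    have h2 := ((wordDeriv_congr hU (ws ++ l.map e) h1).trans (wordDeriv_sum hU _ c _
      fun i _ => analyticOnNhd_fderiv_apply hh (e i))) hp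
    rw [List.cons_append, wordDeriv, h2]
    have h3 : ∀ i, ‖wordDeriv (ws ++ l.map e) (fun z => fderiv ℂ h z (e i)) p‖ ≤
        A ^ ws.length * B := by
      intro i
      have h4 := ih hws' (i :: l) (by simp at hl ⊢; omega)
      have h5 := wordDeriv_perm hU
        (List.perm_middle (a := e i) (l₁ := ws) (l₂ := l.map e)) hh hp
      rw [List.map_cons, h5] at h4
      exact h4
    refine (norm_sum_le _ _).trans ?_
    calc ∑ i, ‖c i * wordDeriv (ws ++ l.map e) (fun z => fderiv ℂ h z (e i)) p‖
        ≤ ∑ i, ‖c i‖ * (A ^ ws.length * B) := Finset.sum_le_sum fun i _ => by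
          rw [norm_mul]; exact mul_le_mul_of_nonneg_left (h3 i) (norm_nonneg _)
      _ = (∑ i, ‖c i‖) * (A ^ ws.length * B) := by rw [Finset.sum_mul]
      _ ≤ A * (A ^ ws.length * B) := by
          gcongr
      _ = _ := by rw [List.length_cons, pow_succ]; ring

/-- Cauchy estimates for word derivatives. -/
theorem norm_wordDeriv_le_of_ball {p : V} {c ε : ℝ} (hε : 0 < ε) (ws : List V) :
    (∀ v ∈ ws, ‖v‖ ≤ c) → ∀ {ρ : ℝ} {h : V → ℂ} {B : ℝ}, AnalyticOnNhd ℂ h (ball p ρ) →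
      (∀ z ∈ ball p ρ, ‖h z‖ ≤ B) →
      ∀ z ∈ ball p (ρ - ws.length * (c * ε)), ‖wordDeriv ws h z‖ ≤ B / ε ^ ws.length := by
  induction ws with
  | nil => exact fun _ ρ h B _ hB z hz => by simpa [wordDeriv] using hB z (by simpa using hz)
  | cons v ws ih =>
    intro hws ρ h B hh hB z hz
    have h1 : ∀ z ∈ ball p (ρ - c * ε), ‖fderiv ℂ h z v‖ ≤ B / ε := by
      intro z hz
      have hmem : ∀ s : ℂ, ‖s‖ ≤ ε → z + s • v ∈ ball p ρ := by
        intro s hs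
        have hv := hws v (by simp)
        rw [mem_ball, dist_eq_norm] at hz ⊢
        calc ‖z + s • v - p‖ = ‖(z - p) + s • v‖ := by congr 1; abel
          _ ≤ ‖z - p‖ + ‖s • v‖ := norm_add_le _ _
          _ ≤ ‖z - p‖ + ε * c := by rw [norm_smul]; gcongr
          _ < ρ := by linarith
      have hda : ∀ s : ℂ, ‖s‖ ≤ ε →
          HasDerivAt (fun s : ℂ => h (z + s • v)) (fderiv ℂ h (z + s • v) v) s := by
        intro s hs
        have h2 := (hh _ (hmem s hs)).differentiableAt.hasFDerivAt
        have h3 : HasDerivAt (fun s : ℂ => z + s • v) ((1 : ℂ) • v) s :=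
          ((hasDerivAt_id s).smul_const v).const_add z
        rw [one_smul] at h3
        exact h2.comp_hasDerivAt s h3
      have h4 := Complex.norm_deriv_le_of_forall_mem_sphere_norm_le (c := 0) (R := ε) (C := B)
        (f := fun s : ℂ => h (z + s • v)) hε
        (DifferentiableOn.diffContOnCl (fun s hs => (hda s (by
          rw [closure_ball _ hε.ne'] at hs
          simpa using hs)).differentiableAt.differentiableWithinAt))
        (fun s hs => hB _ (hmem s (by simpa using (mem_sphere_zero_iff_norm.1 hs).le)))
      rw [(hda 0 (by simpa using hε.le)).deriv] at h4
      simpa using h4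
    have h5 := ih (fun w hw => hws w (List.mem_cons_of_mem _ hw))
      (ρ := ρ - c * ε) (h := fun z => fderiv ℂ h z v) (B := B / ε)
      ((analyticOnNhd_fderiv_apply hh v).mono (ball_subset_ball (by
        have := (norm_nonneg v).trans (hws v (by simp))
        nlinarith))) h1 z (by
        convert hz using 2; push_cast [List.length_cons]; ring)
    rw [List.length_cons, pow_succ', ← div_div]
    exact h5

/-- Derivatives of the restriction to a line. -/
theorem iteratedDeriv_line {U : Set V} (hU : IsOpen U) {h : V → ℂ} (hh : AnalyticOnNhd ℂ h U)
    (p v : V) (n : ℕ) : ∀ s : ℂ, p + s • v ∈ U →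
      iteratedDeriv n (fun s : ℂ => h (p + s • v)) s =
        wordDeriv (List.replicate n v) h (p + s • v) := by
  induction n with
  | zero => intro s _; simp [wordDeriv]
  | succ n ih =>
    intro s hs
    have hc : Continuous fun s : ℂ => p + s • v := by fun_prop
    have hev : iteratedDeriv n (fun s : ℂ => h (p + s • v)) =ᶠ[𝓝 s]
        fun s => wordDeriv (List.replicate n v) h (p + s • v) := by
      filter_upwards [(hU.preimage hc).mem_nhds hs] with t ht using ih t ht
    rw [iteratedDeriv_succ, hev.deriv_eq]
    have h2 := (wordDeriv_analyticOnNhd (List.replicate n v) hh _ hs).differentiableAt.hasFDerivAt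
    have h3 : HasDerivAt (fun s : ℂ => p + s • v) ((1 : ℂ) • v) s :=
      ((hasDerivAt_id s).smul_const v).const_add p
    have h4 := (h2.comp_hasDerivAt s h3).deriv
    simp only [one_smul] at h4
    rw [show List.replicate (n + 1) v = List.replicate n v ++ [v] by
      rw [List.replicate_succ'], wordDeriv_append]
    exact h4

end WordDeriv

end Lemniscate

namespace Lemniscate

open Metric Set Filter Topology

section OneVariable

theorem exists_eq_mul_of_isRoot {U : Set ℂ} (hU : IsOpen U) {f : ℂ → ℂ}
    (hf : DifferentiableOn ℂ f U) {a : ℂ} (ha : a ∈ U) (h0 : f a = 0) :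
    ∃ g : ℂ → ℂ, DifferentiableOn ℂ g U ∧ ∀ z, f z = (z - a) * g z :=
  ⟨dslope f a, (Complex.differentiableOn_dslope (hU.mem_nhds ha)).2 hf, fun z => by
    have := sub_smul_dslope f a z
    rw [h0, sub_zero, smul_eq_mul] at this
    exact this.symm⟩

theorem analyticOrderAt_sub_const (a b : ℂ) :
    analyticOrderAt (fun z : ℂ => z - a) b = if b = a then 1 else 0 := by
  have han : AnalyticAt ℂ (fun z : ℂ => z - a) b := by fun_prop
  split_ifs with h
  · subst h
    have : analyticOrderAt (fun z : ℂ => z - b) b = ((1 : ℕ) : ℕ∞) := by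
      rw [han.analyticOrderAt_eq_natCast]
      exact ⟨fun _ => 1, analyticAt_const, one_ne_zero, by simp⟩
    simp [this]
  · rw [han.analyticOrderAt_eq_zero]
    exact sub_ne_zero.2 h

/-- Dividing out prescribed zeros, counted with multiplicity. -/
theorem exists_eq_prod_mul {U : Set ℂ} (hU : IsOpen U) (l : List ℂ) (hl : ∀ a ∈ l, a ∈ U) :
    ∀ {f : ℂ → ℂ}, DifferentiableOn ℂ f U →
      (∀ a ∈ U, (l.count a : ℕ∞) ≤ analyticOrderAt f a) →
      ∃ g : ℂ → ℂ, DifferentiableOn ℂ g U ∧ ∀ z, f z = (l.map fun a => z - a).prod * g z := by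
  induction l with
  | nil => exact fun {f} hf _ => ⟨f, hf, by simp⟩
  | cons a l ih =>
    intro f hf hord
    have haU : a ∈ U := hl a (by simp)
    have hfa : AnalyticAt ℂ f a := hf.analyticAt (hU.mem_nhds haU)
    have h0 : f a = 0 := by
      by_contra h
      have h1 := hord a haU
      rw [hfa.analyticOrderAt_eq_zero.2 h] at h1
      simp at h1
    obtain ⟨g, hg, hfg⟩ := exists_eq_mul_of_isRoot hU hf haU h0
    have hfg' : f = (fun z => z - a) * g := funext hfg
    obtain ⟨k, hk, hgk⟩ := ih (fun b hb => hl b (List.mem_cons_of_mem _ hb)) hg (by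
      intro b hb
      have h1 := hord b hb
      rw [hfg', analyticOrderAt_mul (by fun_prop) (hg.analyticAt (hU.mem_nhds hb)),
        analyticOrderAt_sub_const, List.count_cons] at h1
      by_cases hab : b = a
      · subst hab
        simp only [BEq.rfl, if_true, Nat.cast_add, Nat.cast_one] at h1
        rw [add_comm] at h1
        exact (ENat.add_le_add_iff_left (by simp)).1 h1
      · have : ¬ a = b := fun h => hab h.symm
        simpa [hab, this] using h1)
    exact ⟨k, hk, fun z => by rw [hfg, hgk]; simp [mul_assoc]⟩

/-- A Schwarz lemma: a bounded function with many zeros has a small derivative. -/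
theorem norm_iteratedDeriv_le_of_zeros {φ : ℂ → ℂ} {R B r : ℝ} {b : ℕ} (hr : 1 ≤ r)
    (hR : 4 * r ≤ R) (hφ : DifferentiableOn ℂ φ (ball 0 R)) (hB : ∀ z ∈ ball (0 : ℂ) R, ‖φ z‖ ≤ B)
    (S : Finset ℂ) (hS : ∀ a ∈ S, ‖a‖ ≤ r)
    (hz : ∀ a ∈ S, ∀ j < b, iteratedDeriv j φ a = 0) :
    ‖iteratedDeriv b φ 0‖ ≤ b.factorial * ((8 * r / R) ^ (b * S.card) * B) := by
  classical
  have hR0 : 0 < R := by linarith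
  have hB0 : 0 ≤ B := (norm_nonneg _).trans (hB 0 (by simpa using hR0))
  set l : List ℂ := (b • S.val).toList with hl
  have hlmem : ∀ a ∈ l, a ∈ S := by
    intro a ha
    rw [hl, Multiset.mem_toList] at ha
    exact Multiset.mem_of_mem_nsmul ha
  have hcount : ∀ a, l.count a = if a ∈ S then b else 0 := by
    intro a
    rw [hl, ← Multiset.coe_count, Multiset.coe_toList, Multiset.count_nsmul]
    split_ifs with h
    · rw [Multiset.count_eq_one_of_mem S.nodup h, mul_one]
    · rw [Multiset.count_eq_zero_of_notMem h, mul_zero]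
  have hlen : l.length = b * S.card := by
    rw [hl, Multiset.length_toList, Multiset.card_nsmul]; simp
  obtain ⟨g, hg, hφg⟩ := exists_eq_prod_mul isOpen_ball l (fun a ha => by
      have := hS a (hlmem a ha)
      rw [mem_ball_zero_iff]; linarith) hφ (by
    intro a ha
    rw [hcount]
    split_ifs with h
    · rw [natCast_le_analyticOrderAt_iff_iteratedDeriv_eq_zero
        (hφ.analyticAt (isOpen_ball.mem_nhds ha))]
      exact hz a h
    · simp)
  have hprod_ge : ∀ z : ℂ, ‖z‖ = R / 2 → (R / 4) ^ l.length ≤ ‖(l.map fun a => z - a).prod‖ := by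
    intro z hz
    have : ∀ l' : List ℂ, (∀ a ∈ l', a ∈ S) →
        (R / 4) ^ l'.length ≤ ‖(l'.map fun a => z - a).prod‖ := by
      intro l'
      induction l' with
      | nil => simp
      | cons a l' ih =>
        intro h
        rw [List.map_cons, List.prod_cons, norm_mul, List.length_cons, pow_succ']
        refine mul_le_mul ?_ (ih fun b hb => h b (List.mem_cons_of_mem _ hb)) (by positivity)
          (norm_nonneg _)
        have h1 := hS a (h a (by simp))
        have h2 := norm_sub_norm_le z a
        linarith
    exact this l hlmem
  have hprod_le : ∀ z : ℂ, ‖z‖ ≤ r → ‖(l.map fun a => z - a).prod‖ ≤ (2 * r) ^ l.length := by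
    intro z hz
    have : ∀ l' : List ℂ, (∀ a ∈ l', a ∈ S) →
        ‖(l'.map fun a => z - a).prod‖ ≤ (2 * r) ^ l'.length := by
      intro l'
      induction l' with
      | nil => simp
      | cons a l' ih =>
        intro h
        rw [List.map_cons, List.prod_cons, norm_mul, List.length_cons, pow_succ']
        refine mul_le_mul ?_ (ih fun b hb => h b (List.mem_cons_of_mem _ hb)) (norm_nonneg _)
          (by linarith)
        have h1 := hS a (h a (by simp))
        have h2 := norm_sub_le z a
        linarith
    exact this l hlmem
  have hg_le : ∀ z : ℂ, ‖z‖ ≤ R / 2 → ‖g z‖ ≤ B / (R / 4) ^ l.length := by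
    intro z hz
    have hcl : closure (ball (0 : ℂ) (R / 2)) = closedBall 0 (R / 2) :=
      closure_ball _ (by positivity)
    refine Complex.norm_le_of_forall_mem_frontier_norm_le (U := ball (0 : ℂ) (R / 2))
      isBounded_ball (DifferentiableOn.diffContOnCl ?_) ?_ (by rw [hcl]; simpa using hz)
    · rw [hcl]; exact hg.mono (closedBall_subset_ball (by linarith))
    · intro w hw
      rw [frontier_ball _ (by positivity), mem_sphere_zero_iff_norm] at hw
      rw [le_div_iff₀ (by positivity), mul_comm]
      calc (R / 4) ^ l.length * ‖g w‖ ≤ ‖(l.map fun a => w - a).prod‖ * ‖g w‖ :=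
            mul_le_mul_of_nonneg_right (hprod_ge w hw) (norm_nonneg _)
        _ = ‖φ w‖ := by rw [hφg w, norm_mul]
        _ ≤ B := hB w (by rw [mem_ball_zero_iff, hw]; linarith)
  have hφ_le : ∀ z ∈ sphere (0 : ℂ) 1, ‖φ z‖ ≤ (8 * r / R) ^ (b * S.card) * B := by
    intro z hz
    rw [mem_sphere_zero_iff_norm] at hz
    rw [hφg z, norm_mul]
    calc ‖(l.map fun a => z - a).prod‖ * ‖g z‖ ≤ (2 * r) ^ l.length * (B / (R / 4) ^ l.length) :=
          mul_le_mul (hprod_le z (by linarith)) (hg_le z (by linarith)) (norm_nonneg _)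
            (by positivity)
      _ = (2 * r / (R / 4)) ^ l.length * B := by
          rw [div_pow (2 * r), mul_div_assoc', div_mul_eq_mul_div]
      _ = (8 * r / R) ^ (b * S.card) * B := by
          rw [hlen, show 2 * r / (R / 4) = 8 * r / R by field_simp; norm_num]
  have := Complex.norm_iteratedDeriv_le_of_forall_mem_sphere_norm_le (c := 0) (R := 1) b one_pos
    (DifferentiableOn.diffContOnCl (by
      rw [closure_ball _ one_ne_zero]
      exact hφ.mono (closedBall_subset_ball (by linarith)))) hφ_le
  simpa using this

end OneVariable

section Grid

variable {V : Type*} [NormedAddCommGroup V] [NormedSpace ℂ V]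

theorem eqOn_zero_of_wordDeriv_eq_zero {ι : Type*} [Fintype ι] {e : ι → V}
    (he : ∀ v : V, ∃ c : ι → ℂ, v = ∑ i, c i • e i) {h : V → ℂ} {p : V} {ρ : ℝ}
    (hh : AnalyticOnNhd ℂ h (ball p ρ)) (h0 : ∀ l : List ι, wordDeriv (l.map e) h p = 0) :
    EqOn h 0 (ball p ρ) := by
  intro z hz
  have hρ : 0 < ρ := dist_nonneg.trans_lt (mem_ball.1 hz)
  set v := z - p with hv
  obtain ⟨c, hc⟩ := he v
  have hmem : p ∈ ball p ρ := mem_ball_self hρ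
  have hcont : Continuous fun s : ℂ => p + s • v := by fun_prop
  set U := (fun s : ℂ => p + s • v) ⁻¹' ball p ρ with hU
  have hφ : AnalyticOnNhd ℂ (fun s : ℂ => h (p + s • v)) U := fun s hs =>
    (hh _ hs).comp_of_eq (f := fun s : ℂ => p + s • v) (by fun_prop) rfl
  have hw : ∀ n, wordDeriv (List.replicate n v) h p = 0 := by
    intro n
    have := norm_wordDeriv_le_of_basis isOpen_ball hmem e (W := {v}) (A := ∑ i, ‖c i‖) (B := 0)
      (Finset.sum_nonneg fun i _ => norm_nonneg _) le_rfl
      (by rintro w rfl; exact ⟨c, hc, le_rfl⟩) hh (T := n) (fun l _ => by simp [h0 l])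
      (List.replicate n v) (by intro w hw; exact List.eq_of_mem_replicate hw) (by simp)
    simpa using this
  have hpre : IsPreconnected U := by
    refine Convex.isPreconnected ?_
    have := (convex_ball p ρ).is_linear_preimage (f := fun s : ℂ => s • v) (𝕜 := ℝ)
    have h2 : U = (fun s : ℂ => s • v) ⁻¹' ((fun x => p + x) ⁻¹' ball p ρ) := rfl
    rw [h2]
    refine ((convex_ball p ρ).translate_preimage_right p).is_linear_preimage ?_
    exact ⟨fun x y => add_smul x y v, fun c x => by simp [mul_smul]⟩
  have h0U : (0 : ℂ) ∈ U := by simp [hU, hρ]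
  have hev : (fun s : ℂ => h (p + s • v)) =ᶠ[𝓝 0] 0 := by
    have := (analyticOrderAt_eq_top (f := fun s : ℂ => h (p + s • v)) (z₀ := 0)).1 (by
      refine ENat.eq_top_iff_forall_ge.2 fun n => ?_
      rw [natCast_le_analyticOrderAt_iff_iteratedDeriv_eq_zero (hφ 0 h0U)]
      intro i _
      rw [iteratedDeriv_line isOpen_ball hh p v i 0 (by simpa using hρ)]
      simpa using hw i)
    exact this
  have := hφ.eqOn_zero_of_preconnected_of_eventuallyEq_zero hpre h0U hev
    (show (1 : ℂ) ∈ U by simpa [hU, hv] using hz)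
  simpa [hv] using this

theorem exists_card_le_mul_count {d : ℕ} (l : List (Fin d)) (hl : l ≠ []) :
    ∃ i, l.length ≤ d * l.count i := by
  classical
  by_contra! h
  have h1 : ∑ i, l.count i = l.length := by
    simpa using Multiset.sum_count_eq_card (s := Finset.univ) (m := (l : Multiset (Fin d)))
      (by simp)
  rcases Nat.eq_zero_or_pos d with rfl | hd
  · cases l with
    | nil => exact hl rfl
    | cons a _ => exact a.elim0
  · have h2 : ∑ i : Fin d, d * l.count i < ∑ _i : Fin d, l.length :=
      Finset.sum_lt_sum_of_nonempty ⟨⟨0, hd⟩, by simp⟩ fun i _ => h i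
    rw [← Finset.mul_sum, h1] at h2
    simp at h2

/-- The grid point `∑ m_j e_j`. -/
def gridPoint {d : ℕ} (e : Fin d → V) (m : Fin d → ℕ) : V := ∑ j, (m j : ℂ) • e j

theorem norm_gridPoint_le {d : ℕ} {e : Fin d → V} {c : ℝ} (hc : ∀ j, ‖e j‖ ≤ c) {M : ℕ}
    {m : Fin d → ℕ} (hm : ∀ j, m j < M) : ‖gridPoint e m‖ ≤ d * (M * c) := by
  refine (norm_sum_le _ _).trans ?_
  calc ∑ j, ‖(m j : ℂ) • e j‖ ≤ ∑ _j : Fin d, (M * c : ℝ) := by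
        refine Finset.sum_le_sum fun j _ => ?_
        rw [norm_smul]
        simp only [Complex.norm_natCast]
        exact mul_le_mul (by exact_mod_cast (hm j).le) (hc j) (norm_nonneg _) (by positivity)
    _ = _ := by simp

theorem norm_wordDeriv_gridPoint_le {d M T : ℕ} {e : Fin d → V} {c R B : ℝ} (hc1 : 1 ≤ c)
    (hc : ∀ j, ‖e j‖ ≤ c) (hM : 0 < M) (hR : 2 * (d * (M * c) + 1) ≤ R) (hR' : 8 * c * M ≤ R)
    {H : V → ℂ} (hH : AnalyticOnNhd ℂ H (ball 0 R)) (hB : ∀ z ∈ ball (0 : V) R, ‖H z‖ ≤ B)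
    (hv : ∀ m : Fin d → ℕ, (∀ j, m j < M) → ∀ l : List (Fin d), l.length < T →
      wordDeriv (l.map e) H (gridPoint e m) = 0)
    {m : Fin d → ℕ} (hm : ∀ j, m j < M) {l : List (Fin d)} (hl : l.length = T) (hT : 0 < T) :
    ∃ b : ℕ, T ≤ d * b ∧
      ‖wordDeriv (l.map e) H (gridPoint e m)‖ ≤ (c * T) ^ T * ((16 * c * M / R) ^ (b * M) * B) := by
  classical
  have hR0 : 0 < R := by
    have : (0 : ℝ) ≤ d * (M * c) := by positivity
    linarith
  have hB0 : 0 ≤ B := (norm_nonneg _).trans (hB 0 (by simpa using hR0))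
  obtain ⟨i, hi⟩ := exists_card_le_mul_count l (by rintro rfl; simp at hl; omega)
  set b := l.count i with hb
  set rest := l.filter (fun x => ¬ x = i) with hrest
  have hperm : l.Perm (rest ++ List.replicate b i) := by
    have h1 := (List.filter_append_perm (fun x => decide (¬ x = i)) l).symm
    have h2 : l.filter (fun x => !decide (¬ x = i)) = List.replicate b i := by
      rw [hb, ← List.filter_eq]
      congr 1
      ext x
      simp [eq_comm]
    rw [h2] at h1
    exact h1
  have hlen : rest.length + b = T := by
    have := hperm.length_eq
    simp at this
    omega
  have hmem : ∀ m : Fin d → ℕ, (∀ j, m j < M) → gridPoint e m ∈ ball (0 : V) R := by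
    intro m hm
    rw [mem_ball_zero_iff]
    refine (norm_gridPoint_le hc hm).trans_lt ?_
    have : (0 : ℝ) ≤ d * (M * c) := by positivity
    linarith
  set p := gridPoint e m with hp
  set g := wordDeriv (rest.map e) H with hg
  have hgan : AnalyticOnNhd ℂ g (ball 0 R) := wordDeriv_analyticOnNhd _ hH
  have hT0 : (0 : ℝ) < T := by exact_mod_cast hT
  have hT1 : (1 : ℝ) ≤ T := by exact_mod_cast hT
  have hgB : ∀ z ∈ ball (0 : V) (R - 1), ‖g z‖ ≤ B * (c * T) ^ rest.length := by
    intro z hz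
    have := norm_wordDeriv_le_of_ball (p := (0 : V)) (c := c) (ε := 1 / (c * T)) (by positivity)
      (rest.map e) (by
        intro v hv
        obtain ⟨j, _, rfl⟩ := List.mem_map.1 hv
        exact hc j) hH hB z (ball_subset_ball (by
          rw [List.length_map]
          have h1 : c * (1 / (c * (T : ℝ))) = 1 / T := by field_simp
          rw [h1]
          have h2 : (rest.length : ℝ) * (1 / T) ≤ 1 := by
            rw [mul_one_div, div_le_one hT0]
            exact_mod_cast (by omega : rest.length ≤ T)
          linarith) hz)
    rw [List.length_map, one_div, inv_pow, div_inv_eq_mul] at this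
    exact this
  have hline : ∀ s : ℂ, ‖s‖ < R / (2 * c) → p + s • e i ∈ ball (0 : V) (R - 1) := by
    intro s hs
    rw [mem_ball_zero_iff]
    have h1 : ‖s‖ * ‖e i‖ ≤ ‖s‖ * c := mul_le_mul_of_nonneg_left (hc i) (norm_nonneg _)
    have h2 : ‖s‖ * c < R / 2 := by
      rw [lt_div_iff₀ (by positivity)] at hs
      linarith
    have h3 := norm_gridPoint_le hc hm
    calc ‖p + s • e i‖ ≤ ‖p‖ + ‖s • e i‖ := norm_add_le _ _
      _ = ‖p‖ + ‖s‖ * ‖e i‖ := by rw [norm_smul]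
      _ < R - 1 := by linarith
  have hline' : ∀ s : ℂ, ‖s‖ < R / (2 * c) → p + s • e i ∈ ball (0 : V) R := fun s hs =>
    ball_subset_ball (by linarith) (hline s hs)
  set φ : ℂ → ℂ := fun s => g (p + s • e i) with hφ
  have hφd : DifferentiableOn ℂ φ (ball 0 (R / (2 * c))) := fun s hs =>
    ((hgan _ (hline' s (by simpa using hs))).differentiableAt.comp s (by fun_prop))
      |>.differentiableWithinAt
  have hder : ∀ n (s : ℂ), ‖s‖ < R / (2 * c) → iteratedDeriv n φ s =
      wordDeriv ((rest ++ List.replicate n i).map e) H (p + s • e i) := by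
    intro n s hs
    rw [hφ, iteratedDeriv_line isOpen_ball hgan p (e i) n s (hline' s hs), hg, List.map_append,
      wordDeriv_append, List.map_replicate]
  set S : Finset ℂ := (Finset.range M).image fun r : ℕ => (r : ℂ) - m i with hS
  have hScard : S.card = M := by
    rw [hS, Finset.card_image_of_injective _ (by
      intro x y hxy
      simpa using hxy), Finset.card_range]
  have hSle : ∀ a ∈ S, ‖a‖ ≤ (M : ℝ) := by
    intro a ha
    obtain ⟨r, hr, rfl⟩ := Finset.mem_image.1 ha
    rw [Finset.mem_range] at hr
    have : ((r : ℂ) - m i) = (((r : ℝ) - m i : ℝ) : ℂ) := by push_cast; rfl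
    rw [this, Complex.norm_real, Real.norm_eq_abs, abs_le]
    have h1 : (r : ℝ) ≤ M := by exact_mod_cast hr.le
    have h2 : (m i : ℝ) ≤ M := by exact_mod_cast (hm i).le
    have h3 : (0 : ℝ) ≤ r := by positivity
    have h4 : (0 : ℝ) ≤ m i := by positivity
    constructor <;> linarith
  have hM1 : (1 : ℝ) ≤ M := by exact_mod_cast hM
  have hRM : 4 * (M : ℝ) ≤ R / (2 * c) := by
    rw [le_div_iff₀ (by positivity)]; linarith
  have hSz : ∀ a ∈ S, ∀ j < b, iteratedDeriv j φ a = 0 := by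
    intro a ha j hj
    rw [hder j a (by have := hSle a ha; linarith)]
    obtain ⟨r, hr, rfl⟩ := Finset.mem_image.1 ha
    rw [Finset.mem_range] at hr
    have hpt : p + ((r : ℂ) - m i) • e i = gridPoint e (Function.update m i r) := by
      rw [hp, gridPoint, gridPoint, ← Finset.add_sum_erase _ _ (Finset.mem_univ i),
        ← Finset.add_sum_erase (a := i) _ (fun j => ((Function.update m i r j : ℕ) : ℂ) • e j)
          (Finset.mem_univ i)]
      have : ∑ x ∈ Finset.univ.erase i, ((Function.update m i r x : ℕ) : ℂ) • e x =
          ∑ x ∈ Finset.univ.erase i, (m x : ℂ) • e x :=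
        Finset.sum_congr rfl fun x hx => by
          rw [Function.update_of_ne (Finset.ne_of_mem_erase hx)]
      rw [this, Function.update_self, sub_smul]
      abel
    rw [hpt]
    refine hv _ (fun x => ?_) _ (by simp; omega)
    by_cases hx : x = i
    · subst hx; simpa using hr
    · rw [Function.update_of_ne hx]; exact hm x
  have key := norm_iteratedDeriv_le_of_zeros (b := b) hM1 hRM hφd
    (fun z hz => hgB _ (hline z (by simpa using hz))) S hSle hSz
  rw [hder b 0 (by rw [norm_zero]; positivity), zero_smul, add_zero, hScard] at key
  rw [wordDeriv_perm isOpen_ball (hperm.map e) hH (hmem m hm)]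
  refine ⟨b, hl ▸ hi, key.trans ?_⟩
  have hx : 8 * (M : ℝ) / (R / (2 * c)) = 16 * c * M / R := by field_simp; norm_num
  rw [hx]
  have hfac : (b.factorial : ℝ) ≤ (c * T) ^ b := by
    calc (b.factorial : ℝ) ≤ (b : ℝ) ^ b := by exact_mod_cast Nat.factorial_le_pow b
      _ ≤ (c * T) ^ b := by
        gcongr
        have : (b : ℝ) ≤ T := by exact_mod_cast (by omega : b ≤ T)
        nlinarith
  have hpos : 0 ≤ (16 * c * M / R) ^ (b * M) := by positivity
  calc (b.factorial : ℝ) * ((16 * c * M / R) ^ (b * M) * (B * (c * T) ^ rest.length))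
      ≤ (c * T) ^ b * ((16 * c * M / R) ^ (b * M) * (B * (c * T) ^ rest.length)) := by
        gcongr
    _ = (c * T) ^ T * ((16 * c * M / R) ^ (b * M) * B) := by
        rw [← hlen, pow_add]; ring

end Grid

end Lemniscate

namespace Lemniscate

open Metric Set Filter Topology MvPolynomial

section WordPoly

variable {κ : Type*} {d : ℕ} (D : Fin d → κ → MvPolynomial κ ℤ)

/-- The polynomial derivations attached to `D`, iterated along a word. -/
noncomputable def wordPoly : List (Fin d) → MvPolynomial κ ℤ → MvPolynomial κ ℤ
  | [], P => P
  | i :: ws, P => wordPoly ws (mkDerivation ℤ (D i) P)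

theorem fderiv_aeval {Y : κ → (Fin d → ℂ) → ℂ} {z : Fin d → ℂ} {l : Fin d}
    (hY : ∀ i, DifferentiableAt ℂ (Y i) z)
    (hD : ∀ i, fderiv ℂ (Y i) z (Pi.single l 1) = aeval (fun i => Y i z) (D l i))
    (P : MvPolynomial κ ℤ) :
    DifferentiableAt ℂ (fun z => aeval (fun i => Y i z) P) z ∧
      fderiv ℂ (fun z => aeval (fun i => Y i z) P) z (Pi.single l 1) =
        aeval (fun i => Y i z) (mkDerivation ℤ (D l) P) := by
  induction P using MvPolynomial.induction_on with
  | C a => simp [fderiv_fun_const]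
  | add p q hp hq =>
    simp only [map_add]
    exact ⟨hp.1.add hq.1, by rw [fderiv_fun_add hp.1 hq.1, add_apply, hp.2, hq.2]⟩
  | mul_X p i hp =>
    simp only [map_mul, aeval_X, Derivation.leibniz, mkDerivation_X, map_add, smul_eq_mul]
    refine ⟨hp.1.mul (hY i), ?_⟩
    rw [fderiv_fun_mul hp.1 (hY i)]
    simp [hp.2, hD]

theorem wordDeriv_aeval {Y : κ → (Fin d → ℂ) → ℂ} {U : Set (Fin d → ℂ)} (hU : IsOpen U)
    (hY : ∀ i, AnalyticOnNhd ℂ (Y i) U)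
    (hD : ∀ z ∈ U, ∀ l i, fderiv ℂ (Y i) z (Pi.single l 1) = aeval (fun i => Y i z) (D l i))
    (w : List (Fin d)) : ∀ P : MvPolynomial κ ℤ,
      EqOn (wordDeriv (w.map fun l => (Pi.single l 1 : Fin d → ℂ))
        (fun z => aeval (fun i => Y i z) P)) (fun z => aeval (fun i => Y i z) (wordPoly D w P)) U := by
  induction w with
  | nil => exact fun _ _ _ => rfl
  | cons l w ih =>
    intro P
    refine EqOn.trans (wordDeriv_congr hU (w.map fun l => (Pi.single l 1 : Fin d → ℂ))
      fun z hz => ?_) (ih _)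
    exact (fderiv_aeval D (fun i => (hY i z hz).differentiableAt) (fun i => hD z hz l i) P).2

theorem analyticOnNhd_aeval {V : Type*} [NormedAddCommGroup V] [NormedSpace ℂ V] {Y : κ → V → ℂ}
    {U : Set V} (hY : ∀ i, AnalyticOnNhd ℂ (Y i) U) (P : MvPolynomial κ ℤ) :
    AnalyticOnNhd ℂ (fun z => aeval (fun i => Y i z) P) U := by
  induction P using MvPolynomial.induction_on with
  | C a => simpa using analyticOnNhd_const
  | add p q hp hq => simp only [map_add]; exact hp.add hq
  | mul_X p i hp => simp only [map_mul, aeval_X]; exact hp.mul (hY i)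

/-- The sum of the absolute values of the coefficients. -/
def norm1 (P : MvPolynomial κ ℤ) : ℕ := ∑ m ∈ P.support, (P.coeff m).natAbs

theorem norm1_eq_sum {P : MvPolynomial κ ℤ} {s : Finset (κ →₀ ℕ)} (hs : P.support ⊆ s) :
    norm1 P = ∑ m ∈ s, (P.coeff m).natAbs :=
  Finset.sum_subset hs fun m _ hm => by simpa using hm

theorem norm1_add_le (P Q : MvPolynomial κ ℤ) : norm1 (P + Q) ≤ norm1 P + norm1 Q := by
  classical
  rw [norm1_eq_sum (P := P + Q) support_add,
    norm1_eq_sum (P := P) (s := P.support ∪ Q.support) Finset.subset_union_left,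
    norm1_eq_sum (P := Q) (s := P.support ∪ Q.support) Finset.subset_union_right,
    ← Finset.sum_add_distrib]
  refine Finset.sum_le_sum fun m _ => ?_
  rw [coeff_add]
  exact Int.natAbs_add_le _ _

theorem norm1_zero : norm1 (0 : MvPolynomial κ ℤ) = 0 := by simp [norm1]

theorem norm1_sum_le {ι : Type*} (s : Finset ι) (f : ι → MvPolynomial κ ℤ) :
    norm1 (∑ i ∈ s, f i) ≤ ∑ i ∈ s, norm1 (f i) :=
  Finset.le_sum_of_subadditive norm1 norm1_zero.le norm1_add_le _ _

theorem norm1_monomial_mul_le (m : κ →₀ ℕ) (c : ℤ) (Q : MvPolynomial κ ℤ) :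
    norm1 (monomial m c * Q) ≤ c.natAbs * norm1 Q := by
  classical
  have h : monomial m c * Q = ∑ n ∈ Q.support, monomial (m + n) (c * Q.coeff n) := by
    conv_lhs => rw [Q.as_sum, Finset.mul_sum]
    exact Finset.sum_congr rfl fun n _ => by rw [monomial_mul]
  have hm : ∀ (n : κ →₀ ℕ) (a : ℤ), norm1 (monomial n a) ≤ a.natAbs := by
    intro n a
    rw [norm1_eq_sum (s := {n}) support_monomial_subset]
    simp
  rw [h]
  refine (norm1_sum_le _ _).trans ?_
  rw [norm1, Finset.mul_sum]
  refine Finset.sum_le_sum fun n _ => (hm _ _).trans ?_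
  rw [Int.natAbs_mul]

theorem mkDerivation_eq_sum (f : κ → MvPolynomial κ ℤ) (P : MvPolynomial κ ℤ) :
    mkDerivation ℤ f P = ∑ m ∈ P.support, ∑ i ∈ m.support,
      monomial (m - Finsupp.single i 1) (P.coeff m * m i) * f i := by
  conv_lhs => rw [P.as_sum, map_sum]
  refine Finset.sum_congr rfl fun m _ => ?_
  rw [mkDerivation_monomial, Finsupp.sum, Finset.smul_sum]
  refine Finset.sum_congr rfl fun i _ => ?_
  rw [smul_eq_mul, ← smul_mul_assoc, smul_monomial, smul_eq_mul]

theorem norm1_mkDerivation_le {f : κ → MvPolynomial κ ℤ} {h : ℕ} (hf : ∀ i, norm1 (f i) ≤ h)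
    (P : MvPolynomial κ ℤ) : norm1 (mkDerivation ℤ f P) ≤ h * P.totalDegree * norm1 P := by
  rw [mkDerivation_eq_sum]
  refine (norm1_sum_le _ _).trans ?_
  rw [norm1, Finset.mul_sum]
  refine Finset.sum_le_sum fun m hm => (norm1_sum_le _ _).trans ?_
  calc ∑ i ∈ m.support, norm1 (monomial (m - Finsupp.single i 1) (P.coeff m * m i) * f i)
      ≤ ∑ i ∈ m.support, (P.coeff m).natAbs * m i * h := by
        refine Finset.sum_le_sum fun i _ => (norm1_monomial_mul_le _ _ _).trans ?_
        rw [Int.natAbs_mul, Int.natAbs_natCast]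
        exact Nat.mul_le_mul_left _ (hf i)
    _ = (P.coeff m).natAbs * (m.sum fun _ e => e) * h := by
        rw [Finsupp.sum, Finset.mul_sum, Finset.sum_mul]
    _ ≤ (P.coeff m).natAbs * P.totalDegree * h := by
        gcongr
        exact le_totalDegree hm
    _ = _ := by ring

theorem totalDegree_mkDerivation_le {f : κ → MvPolynomial κ ℤ} {h : ℕ}
    (hf : ∀ i, (f i).totalDegree ≤ h) (P : MvPolynomial κ ℤ) :
    (mkDerivation ℤ f P).totalDegree ≤ P.totalDegree + h := by
  classical
  rw [mkDerivation_eq_sum]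
  refine totalDegree_finsetSum_le fun m hm => totalDegree_finsetSum_le fun i _ => ?_
  refine (totalDegree_mul _ _).trans (add_le_add ?_ (hf i))
  refine (totalDegree_monomial_le _ _).trans ((?_ : _ ≤ m.sum fun _ e => e).trans (le_totalDegree hm))
  exact Finsupp.sum_le_sum_index (tsub_le_self) (fun _ _ => monotone_id) (by simp)

theorem totalDegree_wordPoly_le {h : ℕ} (hD : ∀ l i, (D l i).totalDegree ≤ h)
    (w : List (Fin d)) : ∀ P : MvPolynomial κ ℤ,
      (wordPoly D w P).totalDegree ≤ P.totalDegree + w.length * h := by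
  induction w with
  | nil => simp [wordPoly]
  | cons l w ih =>
    intro P
    refine (ih _).trans ?_
    have := totalDegree_mkDerivation_le (hD l) P
    rw [List.length_cons, add_mul]
    omega

theorem norm1_wordPoly_le {h : ℕ} (hD : ∀ l i, (D l i).totalDegree ≤ h)
    (hD' : ∀ l i, norm1 (D l i) ≤ h) (w : List (Fin d)) : ∀ (P : MvPolynomial κ ℤ) (n : ℕ),
      P.totalDegree + w.length * h ≤ n → norm1 (wordPoly D w P) ≤ (h * n) ^ w.length * norm1 P := by
  induction w with
  | nil => simp [wordPoly]
  | cons l w ih =>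
    intro P n hn
    rw [List.length_cons, add_mul] at hn
    refine (ih _ n ?_).trans ?_
    · have := totalDegree_mkDerivation_le (hD l) P
      omega
    · rw [List.length_cons, pow_succ, mul_assoc]
      gcongr
      refine (norm1_mkDerivation_le (hD' l) P).trans ?_
      gcongr
      omega

end WordPoly

section House

open NumberField

variable {K : Type*} [Field K] [NumberField K] {κ : Type*}

theorem house_sum_le {ι : Type*} (s : Finset ι) (f : ι → K) :
    house (∑ i ∈ s, f i) ≤ ∑ i ∈ s, house (f i) := house_sum_le_sum_house s f

theorem house_nonneg' (x : K) : 0 ≤ house x := norm_nonneg _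

theorem house_one' : house (1 : K) = 1 := by
  have := house_intCast (K := K) 1
  simpa using this

theorem house_prod_le {ι : Type*} (s : Finset ι) (f : ι → K) :
    house (∏ i ∈ s, f i) ≤ ∏ i ∈ s, house (f i) := by
  classical
  induction s using Finset.induction_on with
  | empty => simp [house_one']
  | insert a s ha ih =>
    rw [Finset.prod_insert ha, Finset.prod_insert ha]
    exact (house_mul_le _ _).trans (mul_le_mul_of_nonneg_left ih (house_nonneg' _))

theorem house_aeval_le {y : κ → K} {A : ℝ} (hA : 1 ≤ A) (hy : ∀ i, house (y i) ≤ A)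
    {P : MvPolynomial κ ℤ} {n : ℕ} (hn : P.totalDegree ≤ n) :
    house (aeval y P) ≤ norm1 P * A ^ n := by
  have h1 : aeval y P = ∑ m ∈ P.support, ((P.coeff m : ℤ) : K) * ∏ i ∈ m.support, y i ^ m i := by
    rw [aeval_def, eval₂_eq]; rfl
  rw [h1, norm1, Nat.cast_sum, Finset.sum_mul]
  refine (house_sum_le _ _).trans (Finset.sum_le_sum fun m hm => (house_mul_le _ _).trans ?_)
  have h2 : house ((P.coeff m : ℤ) : K) = ((P.coeff m).natAbs : ℝ) := by
    rw [house_intCast, Nat.cast_natAbs]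
  rw [h2]
  refine mul_le_mul_of_nonneg_left ?_ (by positivity)
  calc house (∏ i ∈ m.support, y i ^ m i) ≤ ∏ i ∈ m.support, house (y i ^ m i) := house_prod_le _ _
    _ ≤ ∏ i ∈ m.support, A ^ m i := Finset.prod_le_prod (fun _ _ => house_nonneg' _) fun i _ =>
        (house_pow_le _ _).trans (pow_le_pow_left₀ (house_nonneg' _) (hy i) _)
    _ = A ^ (m.sum fun _ e => e) := by rw [Finset.prod_pow_eq_pow_sum]; rfl
    _ ≤ A ^ n := pow_le_pow_right₀ hA ((le_totalDegree hm).trans hn)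

theorem isIntegral_pow_mul_aeval {F : Type*} [Field F] {y : κ → F} {δ : ℕ} (hy : ∀ i, IsIntegral ℤ ((δ : F) * y i))
    {P : MvPolynomial κ ℤ} {n : ℕ} (hn : P.totalDegree ≤ n) :
    IsIntegral ℤ ((δ : F) ^ n * aeval y P) := by
  have h1 : aeval y P = ∑ m ∈ P.support, ((P.coeff m : ℤ) : F) * ∏ i ∈ m.support, y i ^ m i := by
    rw [aeval_def, eval₂_eq]; rfl
  rw [h1, Finset.mul_sum]
  refine IsIntegral.sum _ fun m hm => ?_
  have hmn : (m.sum fun _ e => e) ≤ n := (le_totalDegree hm).trans hn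
  have h2 : (δ : F) ^ n * (((P.coeff m : ℤ) : F) * ∏ i ∈ m.support, y i ^ m i) =
      (δ : F) ^ (n - m.sum fun _ e => e) * (((P.coeff m : ℤ) : F) *
        ∏ i ∈ m.support, ((δ : F) * y i) ^ m i) := by
    have h3 : ∏ i ∈ m.support, ((δ : F) * y i) ^ m i =
        (δ : F) ^ (m.sum fun _ e => e) * ∏ i ∈ m.support, y i ^ m i := by
      simp only [mul_pow, Finset.prod_mul_distrib]
      rw [Finset.prod_pow_eq_pow_sum]; rfl
    rw [h3]
    calc _ = (δ : F) ^ ((n - m.sum fun _ e => e) + m.sum fun _ e => e) *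
          (((P.coeff m : ℤ) : F) * ∏ i ∈ m.support, y i ^ m i) := by rw [Nat.sub_add_cancel hmn]
      _ = _ := by rw [pow_add]; ring
  rw [h2]
  have hInt : ∀ a : ℤ, IsIntegral ℤ (a : F) := fun a => isIntegral_algebraMap
  have hnat : IsIntegral ℤ (δ : F) := by exact_mod_cast hInt δ
  exact (hnat.pow _).mul ((hInt _).mul (IsIntegral.prod _ fun i _ => (hy i).pow _))

/-- A Liouville type lower bound. -/
theorem one_le_norm_mul_house_pow (σ : K →+* ℂ) {γ : K} (hγ : γ ≠ 0) (hi : IsIntegral ℤ γ) :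
    1 ≤ ‖σ γ‖ * house γ ^ (Module.finrank ℚ K - 1) := by
  refine le_trans ?_ (norm_norm_le_norm_mul_house_pow γ σ)
  obtain ⟨n, hn⟩ := IsIntegrallyClosed.isIntegral_iff.1 (Algebra.isIntegral_norm ℚ hi)
  rw [← hn]
  have : n ≠ 0 := by
    rintro rfl
    rw [map_zero] at hn
    exact hγ (Algebra.norm_eq_zero_iff.1 hn.symm)
  rw [show (algebraMap ℤ ℚ n) = (n : ℚ) from rfl]
  have h1 : (1 : ℤ) ≤ |n| := Int.one_le_abs this
  have h2 : ‖(n : ℚ)‖ = |(n : ℝ)| := by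
    rw [← Rat.norm_cast_real, Real.norm_eq_abs]; push_cast; rfl
  rw [h2]
  exact_mod_cast h1

end House

end Lemniscate

namespace Lemniscate

open Metric Set Filter Topology MvPolynomial NumberField

/-- The growth function `(C T B) ^ (C T)`. -/
noncomputable def gbd (C : ℕ) (B : ℝ) (T : ℕ) : ℝ := (C * T * B) ^ (C * T)

section Gbd

variable {C C' T T' : ℕ} {B : ℝ}

theorem one_le_base (hB : 1 ≤ B) (hC : 1 ≤ C) (hT : 1 ≤ T) : 1 ≤ C * T * B := by
  have h1 : (1 : ℝ) ≤ C := by exact_mod_cast hC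
  have h2 : (1 : ℝ) ≤ T := by exact_mod_cast hT
  exact one_le_mul_of_one_le_of_one_le (one_le_mul_of_one_le_of_one_le h1 h2) hB

theorem one_le_gbd (hB : 1 ≤ B) (hC : 1 ≤ C) (hT : 1 ≤ T) : 1 ≤ gbd C B T :=
  one_le_pow₀ (one_le_base hB hC hT)

theorem gbd_nonneg (hB : 1 ≤ B) : 0 ≤ gbd C B T := by
  unfold gbd; positivity

theorem gbd_mono_right (hB : 1 ≤ B) (hC : 1 ≤ C) (hT : 1 ≤ T) (h : T ≤ T') :
    gbd C B T ≤ gbd C B T' := by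
  have hb := one_le_base hB hC (hT.trans h)
  calc gbd C B T ≤ (C * T' * B) ^ (C * T) := by unfold gbd; gcongr
    _ ≤ gbd C B T' := pow_le_pow_right₀ hb (by gcongr)

theorem gbd_mul_le (hB : 1 ≤ B) : gbd C B T * gbd C' B T ≤ gbd (C + C') B T := by
  unfold gbd
  rw [Nat.add_mul, pow_add]
  gcongr <;> simp

theorem gbd_pow_le (hB : 1 ≤ B) (hC : 1 ≤ C) (hT : 1 ≤ T) {n : ℕ} :
    gbd C B T ^ n ≤ gbd ((n + 1) * C) B T := by
  have hb := one_le_base hB (show 1 ≤ (n + 1) * C by nlinarith) hT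
  calc gbd C B T ^ n = (C * T * B) ^ (C * T * n) := by rw [gbd, ← pow_mul]
    _ ≤ (((n + 1) * C : ℕ) * T * B) ^ (C * T * n) := by
        gcongr
        nlinarith
    _ ≤ _ := pow_le_pow_right₀ hb (by nlinarith)

theorem gbd_mul_nat (d : ℕ) : gbd C B (d * T) = gbd (C * d) B T := by
  unfold gbd; push_cast; simp only [mul_assoc]

theorem pow_le_gbd (hB : 1 ≤ B) (hT : 1 ≤ T) {n : ℕ} (hC : 1 ≤ C) (hn : n ≤ C) {x : ℝ} (hx0 : 0 ≤ x)
    (hx : x ≤ C * T * B) : x ^ n ≤ gbd C B T := by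
  have hb := one_le_base hB hC hT
  calc x ^ n ≤ (C * T * B) ^ n := by gcongr
    _ ≤ gbd C B T := pow_le_pow_right₀ hb (by nlinarith)

end Gbd

section Siegel

variable {K : Type*} [Field K] [NumberField K] {κ ν : Type*} [Fintype ν] {d : ℕ}

/-- The monomial with exponents `l` in the variables `u`. -/
noncomputable def mono (u : ν → κ) {L : ℕ} (l : ν → Fin L) : MvPolynomial κ ℤ :=
  ∏ j, X (u j) ^ (l j : ℕ)

theorem totalDegree_mono_le (u : ν → κ) {L : ℕ} (l : ν → Fin L) :
    (mono u l).totalDegree ≤ Fintype.card ν * L := by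
  refine (totalDegree_finsetProd _ _).trans ?_
  calc ∑ j, (X (u j) ^ (l j : ℕ) : MvPolynomial κ ℤ).totalDegree ≤ ∑ _j : ν, L := by
        refine Finset.sum_le_sum fun j _ => ?_
        rw [totalDegree_X_pow]
        exact (l j).2.le
    _ = _ := by simp

theorem norm1_mono_le (u : ν → κ) {L : ℕ} (l : ν → Fin L) : norm1 (mono u l) ≤ 1 := by
  classical
  unfold mono
  induction (Finset.univ : Finset ν) using Finset.induction_on with
  | empty =>
    have := norm1_monomial_mul_le (κ := κ) 0 0 1
    rw [Finset.prod_empty, norm1_eq_sum (s := {0}) (by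
      rw [← C_1, C_apply]; exact support_monomial_subset)]
    simp
  | insert a s ha ih =>
    rw [Finset.prod_insert ha, X_pow_eq_monomial]
    exact (norm1_monomial_mul_le _ _ _).trans (by simpa using ih)

variable (D : Fin d → κ → MvPolynomial κ ℤ)

theorem totalDegree_wordPoly_mono_le {h : ℕ} (hD : ∀ l i, (D l i).totalDegree ≤ h) (u : ν → κ)
    {L T : ℕ} (hLT : L ≤ T) {w : List (Fin d)} (hw : w.length ≤ T) (l : ν → Fin L) :
    (wordPoly D w (mono u l)).totalDegree ≤ (Fintype.card ν + h) * T := by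
  refine (totalDegree_wordPoly_le D hD w _).trans ?_
  have := totalDegree_mono_le u l
  calc _ ≤ Fintype.card ν * L + w.length * h := by omega
    _ ≤ Fintype.card ν * T + T * h := by gcongr
    _ = _ := by ring

theorem house_wordPoly_mono_le {h : ℕ} (h1 : 1 ≤ h) (hD : ∀ l i, (D l i).totalDegree ≤ h)
    (hD' : ∀ l i, norm1 (D l i) ≤ h) (u : ν → κ) {L T : ℕ} (hT : 1 ≤ T)
    (hLT : L ≤ T) {w : List (Fin d)} (hw : w.length ≤ T) (l : ν → Fin L) {B : ℝ} (hB : 1 ≤ B)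
    {y : κ → K} (hy : ∀ i, house (y i) ≤ B) :
    house (aeval y (wordPoly D w (mono u l))) ≤ gbd (h * (Fintype.card ν + h)) B T := by
  set c := Fintype.card ν + h with hc
  have hc1 : 1 ≤ c := by omega
  have hcR : (1 : ℝ) ≤ c := by exact_mod_cast hc1
  have h1R : (1 : ℝ) ≤ h := by exact_mod_cast h1
  have hTR : (1 : ℝ) ≤ T := by exact_mod_cast hT
  refine (house_aeval_le hB hy (totalDegree_wordPoly_mono_le D hD u hLT hw l)).trans ?_
  have h2 : norm1 (wordPoly D w (mono u l)) ≤ (h * (c * T)) ^ w.length * 1 := by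
    refine (norm1_wordPoly_le D hD hD' w (mono u l) (c * T) ?_).trans
      (Nat.mul_le_mul_left _ (norm1_mono_le u l))
    have := totalDegree_mono_le u l
    calc _ ≤ Fintype.card ν * L + w.length * h := by omega
      _ ≤ Fintype.card ν * T + T * h := by gcongr
      _ = _ := by rw [hc]; ring
  have h3 : (norm1 (wordPoly D w (mono u l)) : ℝ) ≤ (h * (c * T)) ^ w.length := by
    exact_mod_cast (by simpa using h2)
  have h4 : (1 : ℝ) ≤ h * (c * T) := by
    exact one_le_mul_of_one_le_of_one_le h1R (one_le_mul_of_one_le_of_one_le hcR hTR)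
  calc (norm1 (wordPoly D w (mono u l)) : ℝ) * B ^ (c * T)
      ≤ (h * (c * T)) ^ (h * c * T) * B ^ (h * c * T) := by
        gcongr ?_ * ?_
        · refine h3.trans (pow_le_pow_right₀ h4 (hw.trans ?_))
          calc T = 1 * 1 * T := by simp
            _ ≤ h * c * T := by gcongr
        · refine pow_le_pow_right₀ hB ?_
          calc c * T = 1 * c * T := by simp
            _ ≤ h * c * T := by gcongr
    _ = gbd (h * c) B T := by
        rw [← mul_pow, gbd]; push_cast; congr 1; ring

theorem pow_denominator_le_gbd {B : ℝ} (hB : 1 ≤ B) {δ : ℕ} (hδ : (δ : ℝ) ≤ B) {c T : ℕ}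
    (hc : 1 ≤ c) (hT : 1 ≤ T) : (δ : ℝ) ^ (c * T) ≤ gbd c B T := by
  unfold gbd
  gcongr
  have hcR : (1 : ℝ) ≤ c := by exact_mod_cast hc
  have hTR : (1 : ℝ) ≤ T := by exact_mod_cast hT
  calc (δ : ℝ) ≤ 1 * B := by linarith
    _ ≤ c * T * B := by
      gcongr
      exact one_le_mul_of_one_le_of_one_le hcR hTR

/-- The word in which each letter `i` occurs `s i` times, in increasing order. -/
def sortedWord {d : ℕ} (s : Fin d → ℕ) : List (Fin d) :=
  (List.finRange d).flatMap fun i => List.replicate (s i) i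

theorem length_sortedWord {d : ℕ} (s : Fin d → ℕ) : (sortedWord s).length = ∑ i, s i := by
  rw [sortedWord, List.length_flatMap]
  simp [List.finRange_eq_pmap_range, Fin.sum_univ_def]

theorem perm_sortedWord {d : ℕ} (l : List (Fin d)) : l.Perm (sortedWord fun i => l.count i) := by
  classical
  rw [List.perm_iff_count]
  intro a
  rw [sortedWord, List.count_flatMap]
  have : (List.map (List.count a ∘ fun i => List.replicate (l.count i) i) (List.finRange d)) =
      (List.finRange d).map fun i => if i = a then l.count a else 0 := by
    refine List.map_congr_left fun i _ => ?_
    simp only [Function.comp_apply, List.count_replicate, beq_iff_eq]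
    split_ifs with h
    · rw [h]
    · rfl
  rw [this, ← Fin.sum_univ_def]
  simp

theorem rpow_le_max {x θ : ℝ} (h0 : 0 ≤ θ) (h1 : θ ≤ 1) : |x ^ θ| ≤ max 1 |x| := by
  refine (Real.abs_rpow_le_abs_rpow x θ).trans ?_
  rcases le_total 1 |x| with h | h
  · exact (Real.rpow_le_rpow_of_exponent_le h h1).trans (by simp)
  · exact (Real.rpow_le_one (abs_nonneg _) h h0).trans (by simp)

theorem exists_siegel_constant (K : Type*) [Field K] [NumberField K] :
    ∃ c : ℕ, 2 ≤ c ∧ ∀ {α β : Type} [Fintype α] [Fintype β] (a : Matrix α β (𝓞 K)), a ≠ 0 →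
      0 < Fintype.card α → 2 * Fintype.card α ≤ Fintype.card β →
      ∀ {A : ℝ}, 1 ≤ A → (∀ k l, house (algebraMap (𝓞 K) K (a k l)) ≤ A) →
      ∃ ξ : β → 𝓞 K, ξ ≠ 0 ∧ a.mulVec ξ = 0 ∧
        ∀ l, house (ξ l : K) ≤ c ^ 2 * Fintype.card β * A := by
  classical
  have key : ∃ c : ℝ, ∀ {α β : Type} [Fintype α] [Fintype β] (a : Matrix α β (𝓞 K)), a ≠ 0 →
      0 < Fintype.card α → Fintype.card α < Fintype.card β →
      ∀ {A : ℝ}, (∀ k l, house (algebraMap (𝓞 K) K (a k l)) ≤ A) →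
      ∃ ξ : β → 𝓞 K, ξ ≠ 0 ∧ a.mulVec ξ = 0 ∧
        ∀ l, house (ξ l : K) ≤ c * (c * Fintype.card β * A) ^
          ((Fintype.card α : ℝ) / (Fintype.card β - Fintype.card α)) := by
    exact ⟨_, fun a ha hp hpq A hA =>
      NumberField.house.exists_ne_zero_int_vec_house_le K a ha hp hpq rfl hA rfl⟩
  obtain ⟨c, hc⟩ := key
  refine ⟨⌈|c|⌉₊ + 2, by omega, fun {α β} _ _ a ha hp hpq A hA1 hA => ?_⟩
  obtain ⟨ξ, h1, h2, h3⟩ := hc a ha hp (by omega) hA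
  refine ⟨ξ, h1, h2, fun l => (h3 l).trans ?_⟩
  set q := Fintype.card β
  set p := Fintype.card α
  have hpR : (0 : ℝ) < p := by exact_mod_cast hp
  have hpqR : 2 * (p : ℝ) ≤ q := by exact_mod_cast hpq
  have hq1 : (1 : ℝ) ≤ q := by exact_mod_cast (by omega : 1 ≤ q)
  have hθ0 : 0 ≤ (p : ℝ) / (q - p) := div_nonneg hpR.le (by linarith)
  have hθ1 : (p : ℝ) / (q - p) ≤ 1 := (div_le_one (by linarith)).2 (by linarith)
  set n : ℝ := ((⌈|c|⌉₊ + 2 : ℕ) : ℝ) with hn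
  have hcn : |c| ≤ n := by
    have := Nat.le_ceil |c|
    rw [hn]; push_cast; linarith
  have hn1 : 1 ≤ n := by rw [hn]; push_cast; linarith [Nat.cast_nonneg (α := ℝ) ⌈|c|⌉₊]
  have hqA : 1 ≤ q * A := one_le_mul_of_one_le_of_one_le hq1 hA1
  calc c * (c * q * A) ^ ((p : ℝ) / (q - p)) ≤ |c * (c * q * A) ^ ((p : ℝ) / (q - p))| :=
        le_abs_self _
    _ ≤ n * (n * (q * A)) := by
        rw [abs_mul]
        refine mul_le_mul hcn ((rpow_le_max hθ0 hθ1).trans (max_le ?_ ?_)) (abs_nonneg _)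
          (by linarith)
        · exact one_le_mul_of_one_le_of_one_le hn1 hqA
        · rw [mul_assoc, abs_mul, abs_of_nonneg (by linarith : 0 ≤ q * A)]
          exact mul_le_mul_of_nonneg_right hcn (by linarith)
    _ = n ^ 2 * q * A := by ring

/-- Construction of the auxiliary polynomial. -/
theorem exists_auxiliary (K : Type*) [Field K] [NumberField K] {κ : Type*} {ν : Type} [Fintype ν] [DecidableEq ν]
    {d : ℕ} (hd : 1 ≤ d) (D : Fin d → κ → MvPolynomial κ ℤ) {h : ℕ} (h1 : 1 ≤ h)
    (hD : ∀ l i, (D l i).totalDegree ≤ h) (hD' : ∀ l i, norm1 (D l i) ≤ h) (u : ν → κ) :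
    ∃ C : ℕ, 1 ≤ C ∧ ∀ (M T L δ : ℕ) (B : ℝ) (y : (Fin d → ℕ) → κ → K), 0 < M → 0 < T → 0 < L →
      L ≤ T → 2 * (M ^ d * T ^ d) ≤ L ^ Fintype.card ν → δ ≠ 0 → 1 ≤ B → (δ : ℝ) ≤ B →
      (∀ m, (∀ j, m j < M) → ∀ i, house (y m i) ≤ B) →
      (∀ m i, IsIntegral ℤ ((δ : K) * y m i)) →
      ∃ ξ : (ν → Fin L) → 𝓞 K, ξ ≠ 0 ∧
        (∀ m, (∀ j, m j < M) → ∀ s : Fin d → Fin T,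
          ∑ l, (ξ l : K) * aeval (y m) (wordPoly D (sortedWord fun i => (s i : ℕ)) (mono u l)) = 0) ∧
        ∀ l, house (ξ l : K) ≤ gbd C B T := by
  classical
  obtain ⟨c, hc2, hc⟩ := exists_siegel_constant K
  set N := Fintype.card ν with hN
  set C₁ := h * (N + h) with hC₁
  have hC₁1 : 1 ≤ C₁ := by rw [hC₁]; nlinarith
  refine ⟨c + (N + 1) + ((N + h) + C₁) * d, by omega, ?_⟩
  intro M T L δ B y hM hT hL hLT hq hδ0 hB hδ hy hyi
  have hLd : L ≤ d * T := by nlinarith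
  have hdT : 1 ≤ d * T := by nlinarith
  have hword : ∀ s : Fin d → Fin T, (sortedWord fun i => (s i : ℕ)).length ≤ d * T := by
    intro s
    rw [length_sortedWord]
    calc ∑ i, (s i : ℕ) ≤ ∑ _i : Fin d, T := Finset.sum_le_sum fun i _ => (s i).2.le
      _ = d * T := by simp
  let α := (Fin d → Fin M) × (Fin d → Fin T)
  let P : (Fin d → Fin T) → (ν → Fin L) → MvPolynomial κ ℤ := fun s l =>
    wordPoly D (sortedWord fun i => (s i : ℕ)) (mono u l)
  let a : Matrix α (ν → Fin L) (𝓞 K) := fun k l =>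
    ⟨(δ : K) ^ ((N + h) * (d * T)) * aeval (y fun j => k.1 j) (P k.2 l),
      isIntegral_pow_mul_aeval (hyi _) (totalDegree_wordPoly_mono_le D hD u hLd (hword k.2) l)⟩
  have hδK : (δ : K) ≠ 0 := by exact_mod_cast hδ0
  have hNh : 1 ≤ N + h := by omega
  have ha0 : a ≠ 0 := by
    intro h0
    have h2 := congrFun (congrFun h0 (fun _ => ⟨0, hM⟩, fun _ => ⟨0, hT⟩)) (fun _ => ⟨0, hL⟩)
    have h3 : (δ : K) ^ ((N + h) * (d * T)) *
        aeval (y fun _ => 0) (P (fun _ => ⟨0, hT⟩) (fun _ => ⟨0, hL⟩)) = 0 :=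
      congrArg (algebraMap (𝓞 K) K) h2
    have h4 : P (fun _ => ⟨0, hT⟩) (fun _ => ⟨0, hL⟩) = 1 := by
      have : sortedWord (fun _ : Fin d => 0) = [] := by
        rw [← List.length_eq_zero_iff, length_sortedWord]; simp
      simp only [P, this, wordPoly]
      simp [mono]
    rw [h4, map_one, mul_one] at h3
    exact pow_ne_zero _ hδK h3
  have hαc : Fintype.card α = M ^ d * T ^ d := by simp [α]
  have hβc : Fintype.card (ν → Fin L) = L ^ N := by simp [hN]
  have hA1 : 1 ≤ gbd ((N + h) + C₁) B (d * T) := one_le_gbd hB (by omega) hdT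
  obtain ⟨ξ, hξ0, hξ, hξb⟩ := hc a ha0 (by rw [hαc]; positivity) (by rw [hαc, hβc]; exact hq) hA1
    (by
      intro k l
      change house ((δ : K) ^ ((N + h) * (d * T)) * aeval (y fun j => k.1 j) (P k.2 l)) ≤ _
      refine (house_mul_le _ _).trans (le_trans ?_ (gbd_mul_le hB))
      refine mul_le_mul ?_ (house_wordPoly_mono_le D h1 hD hD' u hdT hLd (hword k.2) l hB
        (hy _ fun j => (k.1 j).2)) (house_nonneg' _) (gbd_nonneg hB)
      refine le_trans ((house_pow_le _ _).trans_eq ?_) (pow_denominator_le_gbd hB hδ hNh hdT)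
      have := house_intCast (K := K) δ
      rw [show ((δ : ℤ) : K) = (δ : K) by simp] at this
      rw [this]; simp)
  refine ⟨ξ, hξ0, fun m hm s => ?_, fun l => (hξb l).trans ?_⟩
  · have h2 := congrFun hξ (fun j => ⟨m j, hm j⟩, s)
    have h3 : ∑ l, ((δ : K) ^ ((N + h) * (d * T)) * aeval (y m) (P s l)) * (ξ l : K) = 0 := by
      have := congrArg (algebraMap (𝓞 K) K) h2
      rw [Matrix.mulVec, dotProduct, map_sum, Pi.zero_apply, map_zero] at this
      rw [← this]
      exact Finset.sum_congr rfl fun l _ => (map_mul (algebraMap (𝓞 K) K)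
        (a (fun j => ⟨m j, hm j⟩, s) l) (ξ l)).symm
    have h4 : (δ : K) ^ ((N + h) * (d * T)) * ∑ l, (ξ l : K) * aeval (y m) (P s l) = 0 := by
      rw [← h3, Finset.mul_sum]
      exact Finset.sum_congr rfl fun l _ => by ring
    exact (mul_eq_zero.1 h4).resolve_left (pow_ne_zero _ hδK)
  · rw [hβc]
    have hTR : (1 : ℝ) ≤ T := by exact_mod_cast hT
    have hcR : (1 : ℝ) ≤ c := by exact_mod_cast (by omega : 1 ≤ c)
    have e1 : ((c : ℝ) ^ 2) ≤ gbd c B T := pow_le_gbd hB hT (by omega) hc2 (by positivity) (by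
      have : 1 ≤ T * B := one_le_mul_of_one_le_of_one_le hTR hB
      nlinarith)
    have e2 : ((L ^ N : ℕ) : ℝ) ≤ gbd (N + 1) B T := by
      push_cast
      refine pow_le_gbd hB hT (by omega) (by omega) (by positivity) ?_
      have hLR : (L : ℝ) ≤ T := by exact_mod_cast hLT
      have hNR : (0 : ℝ) ≤ N := by positivity
      calc (L : ℝ) ≤ 1 * T * 1 := by linarith
        _ ≤ ((N + 1 : ℕ) : ℝ) * T * B := by
          gcongr
          push_cast; linarith
    rw [gbd_mul_nat]
    calc (c : ℝ) ^ 2 * (L ^ N : ℕ) * gbd (((N + h) + C₁) * d) B T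
        ≤ gbd c B T * gbd (N + 1) B T * gbd (((N + h) + C₁) * d) B T := by
          gcongr
          · exact gbd_nonneg hB
          · exact gbd_nonneg hB
      _ ≤ gbd (c + (N + 1)) B T * gbd (((N + h) + C₁) * d) B T := by
          gcongr
          · exact gbd_nonneg hB
          · exact gbd_mul_le hB
      _ ≤ _ := gbd_mul_le hB

/-- Lower bound for a nonvanishing derivative of the auxiliary function. -/
theorem exists_lower_bound (K : Type*) [Field K] [NumberField K] (σ : K →+* ℂ) {κ : Type*}
    {ν : Type} [Fintype ν] [DecidableEq ν]
    {d : ℕ} (D : Fin d → κ → MvPolynomial κ ℤ) {h : ℕ} (h1 : 1 ≤ h)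
    (hD : ∀ l i, (D l i).totalDegree ≤ h) (hD' : ∀ l i, norm1 (D l i) ≤ h) (u : ν → κ)
    {C₀ : ℕ} (hC₀ : 1 ≤ C₀) :
    ∃ C : ℕ, 1 ≤ C ∧ ∀ (T L δ : ℕ) (B : ℝ) (y : κ → K), 0 < T →
      L ≤ T → δ ≠ 0 → 1 ≤ B → (δ : ℝ) ≤ B → (∀ i, house (y i) ≤ B) →
      (∀ i, IsIntegral ℤ ((δ : K) * y i)) → ∀ ξ : (ν → Fin L) → 𝓞 K,
      (∀ l, house (ξ l : K) ≤ gbd C₀ B T) → ∀ w : List (Fin d), w.length ≤ T →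
      ∑ l, (ξ l : K) * aeval y (wordPoly D w (mono u l)) ≠ 0 →
      1 ≤ ‖σ (∑ l, (ξ l : K) * aeval y (wordPoly D w (mono u l)))‖ * gbd C B T := by
  classical
  set N := Fintype.card ν with hN
  set C₁ := h * (N + h) with hC₁
  have hC₁1 : 1 ≤ C₁ := by rw [hC₁]; nlinarith
  set C₂ := (N + h) + ((N + 1) + (C₀ + C₁)) with hC₂
  set n := Module.finrank ℚ K with hn
  refine ⟨(N + h) + ((n - 1 + 1) * C₂), by omega, ?_⟩
  intro T L δ B y hT hLT hδ0 hB hδ hy hyi ξ hξ w hw hne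
  have hNh : 1 ≤ N + h := by omega
  have hδK : (δ : K) ≠ 0 := by exact_mod_cast hδ0
  set γ := ∑ l, (ξ l : K) * aeval y (wordPoly D w (mono u l)) with hγ
  have hInt : IsIntegral ℤ ((δ : K) ^ ((N + h) * T) * γ) := by
    rw [hγ, Finset.mul_sum]
    refine IsIntegral.sum _ fun l _ => ?_
    rw [mul_left_comm]
    exact (RingOfIntegers.isIntegral_coe _).mul
      (isIntegral_pow_mul_aeval hyi (totalDegree_wordPoly_mono_le D hD u hLT hw l))
  have hhδ : house ((δ : K) ^ ((N + h) * T)) ≤ gbd (N + h) B T := by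
    refine le_trans ((house_pow_le _ _).trans_eq ?_) (pow_denominator_le_gbd hB hδ hNh hT)
    have := house_intCast (K := K) δ
    rw [show ((δ : ℤ) : K) = (δ : K) by simp] at this
    rw [this]; simp
  have hTR : (1 : ℝ) ≤ T := by exact_mod_cast hT
  have hhγ : house γ ≤ gbd ((N + 1) + (C₀ + C₁)) B T := by
    refine (house_sum_le _ _).trans ?_
    calc ∑ l, house ((ξ l : K) * aeval y (wordPoly D w (mono u l)))
        ≤ ∑ _l : ν → Fin L, gbd C₀ B T * gbd C₁ B T := by
          refine Finset.sum_le_sum fun l _ => (house_mul_le _ _).trans ?_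
          exact mul_le_mul (hξ l) (house_wordPoly_mono_le D h1 hD hD' u hT hLT hw l hB hy)
            (house_nonneg' _) (gbd_nonneg hB)
      _ = ((L ^ N : ℕ) : ℝ) * (gbd C₀ B T * gbd C₁ B T) := by simp [hN]
      _ ≤ gbd (N + 1) B T * gbd (C₀ + C₁) B T := by
          refine mul_le_mul ?_ (gbd_mul_le hB) (mul_nonneg (gbd_nonneg hB) (gbd_nonneg hB))
            (gbd_nonneg hB)
          push_cast
          refine pow_le_gbd hB hT (by omega) (by omega) (by positivity) ?_
          have hLR : (L : ℝ) ≤ T := by exact_mod_cast hLT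
          have hNR : (0 : ℝ) ≤ N := by positivity
          calc (L : ℝ) ≤ 1 * T * 1 := by linarith
            _ ≤ ((N + 1 : ℕ) : ℝ) * T * B := by
              gcongr
              push_cast; linarith
      _ ≤ _ := gbd_mul_le hB
  have hh : house ((δ : K) ^ ((N + h) * T) * γ) ≤ gbd C₂ B T :=
    (house_mul_le _ _).trans ((mul_le_mul hhδ hhγ (house_nonneg' _) (gbd_nonneg hB)).trans
      (gbd_mul_le hB))
  have key := one_le_norm_mul_house_pow σ (mul_ne_zero (pow_ne_zero _ hδK) hne) hInt
  refine key.trans ?_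
  have e1 : ‖σ ((δ : K) ^ ((N + h) * T) * γ)‖ ≤ gbd (N + h) B T * ‖σ γ‖ := by
    rw [map_mul, norm_mul, map_pow, map_natCast, norm_pow, Complex.norm_natCast]
    exact mul_le_mul_of_nonneg_right (pow_denominator_le_gbd hB hδ hNh hT) (norm_nonneg _)
  have e2 : house ((δ : K) ^ ((N + h) * T) * γ) ^ (n - 1) ≤ gbd ((n - 1 + 1) * C₂) B T :=
    (pow_le_pow_left₀ (house_nonneg' _) hh _).trans (gbd_pow_le hB (by omega) hT)
  calc _ ≤ (gbd (N + h) B T * ‖σ γ‖) * gbd ((n - 1 + 1) * C₂) B T :=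
        mul_le_mul e1 e2 (pow_nonneg (house_nonneg' _) _)
          (mul_nonneg (gbd_nonneg hB) (norm_nonneg _))
    _ = ‖σ γ‖ * (gbd (N + h) B T * gbd ((n - 1 + 1) * C₂) B T) := by ring
    _ ≤ _ := mul_le_mul_of_nonneg_left (gbd_mul_le hB) (norm_nonneg _)

end Siegel

end Lemniscate

namespace Lemniscate

open Metric Set Filter Topology MvPolynomial NumberField

/-- A pair of holomorphic functions `Θ`, `X` on a ball whose quotients solve the differential system
`D` and take the value `a₀` at the grid points. -/
structure Uniformization {d : ℕ} {ι : Type} (D : Fin d → ι → MvPolynomial ι ℤ) (a₀ : ι → ℂ)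
    (e : Fin d → Fin d → ℂ) (M : ℕ) (C R : ℝ) (Θ : (Fin d → ℂ) → ℂ) (X : ι → (Fin d → ℂ) → ℂ) :
    Prop where
  analytic_den : AnalyticOnNhd ℂ Θ (ball 0 R)
  analytic_num : ∀ i, AnalyticOnNhd ℂ (X i) (ball 0 R)
  norm_den_le : ∀ z ∈ ball (0 : Fin d → ℂ) R, ‖Θ z‖ ≤ Real.exp (C * R ^ 2)
  norm_num_le : ∀ i, ∀ z ∈ ball (0 : Fin d → ℂ) R, ‖X i z‖ ≤ Real.exp (C * R ^ 2)
  le_norm_den : ∀ m : Fin d → ℕ, (∀ j, m j < M) →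
    Real.exp (-(C * R ^ 2)) ≤ ‖Θ (gridPoint e m)‖
  num_eq : ∀ m : Fin d → ℕ, (∀ j, m j < M) → ∀ i,
    X i (gridPoint e m) = Θ (gridPoint e m) * a₀ i
  ode : ∀ m : Fin d → ℕ, (∀ j, m j < M) → ∀ᶠ z in 𝓝 (gridPoint e m), ∀ l i,
    fderiv ℂ (fun z => X i z / Θ z) z (Pi.single l 1) = aeval (fun i => X i z / Θ z) (D l i)

section Extend

variable {d : ℕ} {ι : Type}

/-- The system `D` with the coordinate function `z ↦ z i₀` adjoined. -/
noncomputable def extendSystem (D : Fin d → ι → MvPolynomial ι ℤ) (i₀ : Fin d) :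
    Fin d → Option ι → MvPolynomial (Option ι) ℤ
  | l, none => if l = i₀ then 1 else 0
  | l, some i => rename some (D l i)

/-- A solution of `D` with the coordinate `z ↦ s + z i₀` adjoined. -/
def extendSol (i₀ : Fin d) (s : ℂ) (Y : ι → (Fin d → ℂ) → ℂ) : Option ι → (Fin d → ℂ) → ℂ
  | none, z => s + z i₀
  | some i, z => Y i z

theorem extendSol_analyticOnNhd {i₀ : Fin d} {s : ℂ} {Y : ι → (Fin d → ℂ) → ℂ}
    {U : Set (Fin d → ℂ)} (hY : ∀ i, AnalyticOnNhd ℂ (Y i) U) (i : Option ι) :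
    AnalyticOnNhd ℂ (extendSol i₀ s Y i) U := by
  cases i with
  | none =>
    intro z _
    exact analyticAt_const.add ((ContinuousLinearMap.proj (R := ℂ) (φ := fun _ : Fin d => ℂ)
      i₀).analyticAt z)
  | some i => exact hY i

theorem extendSol_fderiv {D : Fin d → ι → MvPolynomial ι ℤ} {i₀ : Fin d} {s : ℂ}
    {Y : ι → (Fin d → ℂ) → ℂ} {z : Fin d → ℂ}
    (hD : ∀ l i, fderiv ℂ (Y i) z (Pi.single l 1) = aeval (fun i => Y i z) (D l i))
    (l : Fin d) (i : Option ι) :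
    fderiv ℂ (extendSol i₀ s Y i) z (Pi.single l 1) =
      aeval (fun i => extendSol i₀ s Y i z) (extendSystem D i₀ l i) := by
  cases i with
  | none =>
    have h1 : fderiv ℂ (extendSol i₀ s Y none) z =
        ContinuousLinearMap.proj (R := ℂ) (φ := fun _ : Fin d => ℂ) i₀ :=
      ((ContinuousLinearMap.proj (R := ℂ) (φ := fun _ : Fin d => ℂ) i₀).hasFDerivAt.const_add
        s).fderiv
    rw [h1]
    simp only [extendSystem, ContinuousLinearMap.proj_apply, Pi.single_apply, eq_comm (a := i₀)]
    split_ifs <;> simp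
  | some i =>
    change fderiv ℂ (Y i) z (Pi.single l 1) = aeval _ (rename some (D l i))
    rw [hD, aeval_rename]
    rfl

end Extend

section Auxiliary

variable {d : ℕ} {κ ν : Type} [Fintype ν] [DecidableEq ν]

/-- The values of the derivatives of an auxiliary polynomial. -/
noncomputable def auxVal {F : Type*} [Field F] (D : Fin d → κ → MvPolynomial κ ℤ) (u : ν → κ)
    {L : ℕ} (ξ : (ν → Fin L) → F) (y : κ → F) (w : List (Fin d)) : F :=
  ∑ l, ξ l * aeval y (wordPoly D w (mono u l))

theorem map_auxVal {F F' : Type*} [Field F] [Field F'] (σ : F →+* F')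
    (D : Fin d → κ → MvPolynomial κ ℤ) (u : ν → κ)
    {L : ℕ} (ξ : (ν → Fin L) → F) (y : κ → F) (w : List (Fin d)) :
    σ (auxVal D u ξ y w) = auxVal D u (fun l => σ (ξ l)) (fun i => σ (y i)) w := by
  rw [auxVal, auxVal, map_sum]
  refine Finset.sum_congr rfl fun l _ => ?_
  rw [map_mul]
  congr 1
  rw [aeval_def, aeval_def, hom_eval₂]
  congr 1
  exact RingHom.ext_int _ _

/-- The word in the coordinate directions. -/
noncomputable def stdWord (w : List (Fin d)) : List (Fin d → ℂ) :=
  w.map fun l => (Pi.single l 1 : Fin d → ℂ)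

theorem wordDeriv_auxVal {D : Fin d → κ → MvPolynomial κ ℤ} {u : ν → κ} {L : ℕ}
    (ξ : (ν → Fin L) → ℂ) {Y : κ → (Fin d → ℂ) → ℂ} {U : Set (Fin d → ℂ)} (hU : IsOpen U)
    (hY : ∀ i, AnalyticOnNhd ℂ (Y i) U)
    (hD : ∀ z ∈ U, ∀ l i, fderiv ℂ (Y i) z (Pi.single l 1) = aeval (fun i => Y i z) (D l i))
    (w : List (Fin d)) :
    EqOn (wordDeriv (stdWord w) (fun z => auxVal D u ξ (fun i => Y i z) []))
      (fun z => auxVal D u ξ (fun i => Y i z) w) U := by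
  refine (wordDeriv_sum hU Finset.univ ξ _ (h := fun l z => aeval (fun i => Y i z) (mono u l))
    fun l _ => analyticOnNhd_aeval hY _).trans fun z hz => ?_
  refine Finset.sum_congr rfl fun l _ => ?_
  rw [stdWord, wordDeriv_aeval D hU hY hD w _ hz]

theorem analyticOnNhd_auxVal {D : Fin d → κ → MvPolynomial κ ℤ} {u : ν → κ} {L : ℕ}
    (ξ : (ν → Fin L) → ℂ) {Y : κ → (Fin d → ℂ) → ℂ} {U : Set (Fin d → ℂ)}
    (hY : ∀ i, AnalyticOnNhd ℂ (Y i) U) (w : List (Fin d)) :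
    AnalyticOnNhd ℂ (fun z => auxVal D u ξ (fun i => Y i z) w) U := by
  have : (fun z => auxVal D u ξ (fun i => Y i z) w) =
      ∑ l, fun z => ξ l * aeval (fun i => Y i z) (wordPoly D w (mono u l)) := by
    ext z; simp [auxVal]
  rw [this]
  exact Finset.analyticOnNhd_sum _ fun l _ => analyticOnNhd_const.mul (analyticOnNhd_aeval hY _)

end Auxiliary

section Words

variable {d : ℕ}

theorem exists_std_coeff (v : Fin d → ℂ) :
    v = ∑ i, v i • (Pi.single i 1 : Fin d → ℂ) := by
  ext j
  simp [Finset.sum_apply, Pi.single_apply]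

theorem wordDeriv_eq_zero_of_std {U : Set (Fin d → ℂ)} (hU : IsOpen U) {p : Fin d → ℂ} (hp : p ∈ U)
    {F : (Fin d → ℂ) → ℂ} (hF : AnalyticOnNhd ℂ F U) {n : ℕ}
    (h0 : ∀ w : List (Fin d), w.length = n → wordDeriv (stdWord w) F p = 0)
    (e : Fin d → Fin d → ℂ) {l : List (Fin d → ℂ)} (hl : ∀ v ∈ l, v ∈ range e)
    (hln : l.length = n) : wordDeriv l F p = 0 := by
  have := norm_wordDeriv_le_of_basis hU hp (fun i => (Pi.single i 1 : Fin d → ℂ)) (W := range e)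
    (A := ∑ j, ∑ i, ‖e j i‖) (B := 0) (by positivity) le_rfl (by
      rintro _ ⟨j, rfl⟩
      exact ⟨e j, exists_std_coeff _, Finset.single_le_sum
        (f := fun j => ∑ i, ‖e j i‖) (fun _ _ => by positivity) (Finset.mem_univ j)⟩) hF (T := n)
    (fun w hw => by rw [← stdWord, h0 w hw, norm_zero]) l hl hln
  simpa using this

end Words

section Numeric

/-- The final comparison of growth rates. -/
theorem log_le_of_estimates {d t b M L C₀ C₁ : ℕ} (hd : 1 ≤ d) (ht : 1 ≤ t) (hC₀ : 1 ≤ C₀)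
    (hC₁ : 1 ≤ C₁) {A c x r B q E c₂ : ℝ} (hA : 1 ≤ A) (hc : 1 ≤ c) (hx : 1 ≤ x) (hxr : x ≤ r)
    (hB : 1 ≤ B) (hr : r ^ (2 * (d + 1)) = t) (hrt : r ≤ t) (hLt : L ≤ t) (hb : t ≤ d * b)
    (hq0 : 0 < q) (hq : q ≤ (t : ℝ) ^ (d + 1)) (hE0 : 0 < E) (hE : E ≤ Real.exp (c₂ * t))
    (hM : M = 2 * d * (d + 1) * (C₀ + C₁ + d + 4))
    (h : 1 ≤ A ^ t * ((c * t) ^ t * ((x / r) ^ (b * M) * (q * gbd C₀ B t * r ^ L * E))) *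
      gbd C₁ B t) :
    Real.log t ≤ Real.log A + Real.log c + C₀ * Real.log (C₀ * B) + c₂ + C₁ * Real.log (C₁ * B) +
      2 * (d + 1) * (C₀ + C₁ + d + 4) * Real.log x := by
  have htR : (1 : ℝ) ≤ t := by exact_mod_cast ht
  have ht0 : (0 : ℝ) < t := by linarith
  have hr0 : 0 < r := by linarith
  have hx0 : 0 < x := by linarith
  have hc0 : 0 < c := by linarith
  have hA0 : 0 < A := by linarith
  have hB0 : 0 < B := by linarith
  have hC₀R : (0 : ℝ) < C₀ := by exact_mod_cast hC₀
  have hC₁R : (0 : ℝ) < C₁ := by exact_mod_cast hC₁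
  have hdR : (1 : ℝ) ≤ d := by exact_mod_cast hd
  have hg : ∀ C : ℕ, (0 : ℝ) < C → 0 < gbd C B t ∧
      Real.log (gbd C B t) = C * t * (Real.log (C * B) + Real.log t) := by
    intro C hC
    refine ⟨by unfold gbd; positivity, ?_⟩
    rw [gbd, Real.log_pow, ← Real.log_mul (by positivity) (by positivity)]
    push_cast
    congr 2; ring
  obtain ⟨hg0, hgl0⟩ := hg C₀ hC₀R
  obtain ⟨hg1, hgl1⟩ := hg C₁ hC₁R
  have hlog := Real.log_nonneg h
  rw [Real.log_mul (by positivity) (by positivity), Real.log_mul (by positivity) (by positivity),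
    Real.log_mul (by positivity) (by positivity), Real.log_mul (by positivity) (by positivity),
    Real.log_mul (by positivity) (by positivity), Real.log_mul (by positivity) (by positivity),
    Real.log_mul (by positivity) (by positivity), hgl0, hgl1, Real.log_pow, Real.log_pow,
    Real.log_pow, Real.log_pow, Real.log_mul (by positivity) (by positivity),
    Real.log_div (by positivity) (by positivity)] at hlog
  have hlt : 0 ≤ Real.log t := Real.log_nonneg htR
  have hlr : (2 * (d + 1) : ℝ) * Real.log r = Real.log t := by
    rw [← hr, Real.log_pow]; push_cast; ring
  have hlrx : 0 ≤ Real.log r - Real.log x := sub_nonneg.2 (Real.log_le_log hx0 hxr)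
  have hlq : Real.log q ≤ (d + 1) * Real.log t := by
    refine (Real.log_le_log hq0 hq).trans_eq ?_
    rw [Real.log_pow]; push_cast; ring
  have hlE : Real.log E ≤ c₂ * t := (Real.log_le_log hE0 hE).trans_eq (Real.log_exp _)
  have hlL : (L : ℝ) * Real.log r ≤ t * Real.log t := by
    refine mul_le_mul (by exact_mod_cast hLt) (Real.log_le_log hr0 hrt)
      (Real.log_nonneg (hx.trans hxr)) ht0.le
  set S : ℝ := C₀ + C₁ + d + 4 with hS
  have hS0 : 0 ≤ S := by positivity
  have hbM : (t : ℝ) * (2 * (d + 1) * S) * (Real.log r - Real.log x) ≤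
      ((b * M : ℕ) : ℝ) * (Real.log r - Real.log x) := by
    refine mul_le_mul_of_nonneg_right ?_ hlrx
    have h1 : (t : ℝ) ≤ d * b := by exact_mod_cast hb
    rw [hM]
    push_cast
    calc (t : ℝ) * (2 * (d + 1) * S) ≤ (d * b) * (2 * (d + 1) * S) := by gcongr
      _ = _ := by rw [hS]; ring
  have hdt : (d + 1) * Real.log t ≤ (d + 1) * (t * Real.log t) := by
    refine mul_le_mul_of_nonneg_left ?_ (by positivity)
    nlinarith
  have hfin : (t : ℝ) * Real.log t ≤ t * (Real.log A + Real.log c + C₀ * Real.log (C₀ * B) + c₂ +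
      C₁ * Real.log (C₁ * B) + 2 * (d + 1) * S * Real.log x) := by
    have h2 : (t : ℝ) * (2 * (d + 1) * S) * (Real.log r - Real.log x) =
        S * (t * Real.log t) - t * (2 * (d + 1) * S * Real.log x) := by
      rw [← hlr]; ring
    rw [h2] at hbM
    have hS' : S * (t * Real.log t) = (C₀ + C₁ + d + 4) * (t * Real.log t) := by rw [hS]
    push_cast at hlog hbM
    linarith
  exact le_of_mul_le_mul_left hfin ht0

end Numeric

end Lemniscate

namespace Lemniscate

open Metric Set Filter Topology MvPolynomial NumberField

section Local

variable {d : ℕ} {ι : Type} {D : Fin d → ι → MvPolynomial ι ℤ} {a₀ : ι → ℂ}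
  {e : Fin d → Fin d → ℂ} {M : ℕ} {C R : ℝ} {Θ : (Fin d → ℂ) → ℂ} {X : ι → (Fin d → ℂ) → ℂ}

theorem Uniformization.exists_ball [Finite ι] (hu : Uniformization D a₀ e M C R Θ X)
    {m : Fin d → ℕ} (hm : ∀ j, m j < M) (hR : gridPoint e m ∈ ball (0 : Fin d → ℂ) R) :
    ∃ ρ > 0, ball (gridPoint e m) ρ ⊆ ball 0 R ∧ (∀ z ∈ ball (gridPoint e m) ρ, Θ z ≠ 0) ∧
      (∀ i, AnalyticOnNhd ℂ (fun z => X i z / Θ z) (ball (gridPoint e m) ρ)) ∧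
      (∀ z ∈ ball (gridPoint e m) ρ, ∀ l i, fderiv ℂ (fun z => X i z / Θ z) z (Pi.single l 1) =
        aeval (fun i => X i z / Θ z) (D l i)) ∧
      ∀ i, X i (gridPoint e m) / Θ (gridPoint e m) = a₀ i := by
  have h0 : Θ (gridPoint e m) ≠ 0 := by
    have := hu.le_norm_den m hm
    exact norm_pos_iff.1 ((Real.exp_pos _).trans_le this)
  have h1 : ∀ᶠ z in 𝓝 (gridPoint e m), Θ z ≠ 0 :=
    (hu.analytic_den _ hR).continuousAt.eventually_ne h0
  obtain ⟨ρ, hρ, hball⟩ := Metric.eventually_nhds_iff_ball.1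
    ((h1.and (hu.ode m hm)).and (isOpen_ball.mem_nhds hR))
  refine ⟨ρ, hρ, fun z hz => (hball z hz).2, fun z hz => (hball z hz).1.1, fun i z hz => ?_,
    fun z hz => (hball z hz).1.2, fun i => ?_⟩
  · exact (hu.analytic_num i z (hball z hz).2).div (hu.analytic_den z (hball z hz).2)
      (hball z hz).1.1
  · rw [hu.num_eq m hm, mul_div_cancel_left₀ _ h0]

end Local

section Cleared

variable {d : ℕ} {ι : Type}

/-- The variables of the auxiliary polynomial: the adjoined coordinate and `d` of the functions. -/
def auxVar (v : Fin d → ι) : Option (Fin d) → Option ι := Option.map v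

/-- The auxiliary function, multiplied by a power of the denominator. -/
noncomputable def clearedAux (i₀ : Fin d) (v : Fin d → ι) {L : ℕ}
    (ξ : (Option (Fin d) → Fin L) → ℂ) (Θ : (Fin d → ℂ) → ℂ) (X : ι → (Fin d → ℂ) → ℂ)
    (z : Fin d → ℂ) : ℂ :=
  ∑ l, ξ l * (z i₀ ^ (l none : ℕ) *
    ∏ j, (Θ z ^ (L - (l (some j) : ℕ)) * X (v j) z ^ (l (some j) : ℕ)))

theorem aeval_mono_extendSol (i₀ : Fin d) (v : Fin d → ι) {L : ℕ} (l : Option (Fin d) → Fin L)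
    (s : ℂ) (Y : ι → (Fin d → ℂ) → ℂ) (z : Fin d → ℂ) :
    aeval (fun i => extendSol i₀ s Y i z) (mono (auxVar v) l) =
      (s + z i₀) ^ (l none : ℕ) * ∏ j, Y (v j) z ^ (l (some j) : ℕ) := by
  simp [mono, auxVar, Fintype.prod_option, extendSol]

theorem clearedAux_eq (D : Fin d → Option ι → MvPolynomial (Option ι) ℤ)
    (i₀ : Fin d) (v : Fin d → ι) {L : ℕ}
    (ξ : (Option (Fin d) → Fin L) → ℂ) {Θ : (Fin d → ℂ) → ℂ} (X : ι → (Fin d → ℂ) → ℂ)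
    {z : Fin d → ℂ} (hz : Θ z ≠ 0) :
    clearedAux i₀ v ξ Θ X z = Θ z ^ (d * L) *
      auxVal D (auxVar v) ξ (fun i => extendSol i₀ 0 (fun i z => X i z / Θ z) i z) [] := by
  rw [clearedAux, auxVal, Finset.mul_sum]
  refine Finset.sum_congr rfl fun l _ => ?_
  rw [wordPoly, aeval_mono_extendSol, zero_add, mul_left_comm (Θ z ^ (d * L)),
    mul_left_comm (Θ z ^ (d * L))]
  congr 2
  have : Θ z ^ (d * L) = ∏ _j : Fin d, Θ z ^ L := by simp [← pow_mul, mul_comm]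
  rw [this, ← Finset.prod_mul_distrib]
  refine Finset.prod_congr rfl fun j _ => ?_
  have hL : Θ z ^ L = Θ z ^ (L - (l (some j) : ℕ)) * Θ z ^ (l (some j) : ℕ) := by
    rw [← pow_add, Nat.sub_add_cancel (l (some j)).2.le]
  rw [div_pow, mul_div_assoc', eq_div_iff (pow_ne_zero _ hz)]
  rw [hL]
  ring

theorem analyticOnNhd_clearedAux (i₀ : Fin d) (v : Fin d → ι) {L : ℕ}
    (ξ : (Option (Fin d) → Fin L) → ℂ) {Θ : (Fin d → ℂ) → ℂ} {X : ι → (Fin d → ℂ) → ℂ}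
    {U : Set (Fin d → ℂ)} (hΘ : AnalyticOnNhd ℂ Θ U) (hX : ∀ i, AnalyticOnNhd ℂ (X i) U) :
    AnalyticOnNhd ℂ (clearedAux i₀ v ξ Θ X) U := by
  intro z hz
  have h1 : AnalyticAt ℂ (fun z : Fin d → ℂ => z i₀) z :=
    (ContinuousLinearMap.proj (R := ℂ) (φ := fun _ : Fin d => ℂ) i₀).analyticAt z
  unfold clearedAux
  refine Finset.analyticAt_fun_sum _ fun l _ => analyticAt_const.mul ((h1.pow _).mul
    (Finset.analyticAt_fun_prod _ fun j _ => ((hΘ z hz).pow _).mul ((hX _ z hz).pow _)))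

theorem norm_clearedAux_le (i₀ : Fin d) (v : Fin d → ι) {L : ℕ}
    {ξ : (Option (Fin d) → Fin L) → ℂ} {Θ : (Fin d → ℂ) → ℂ} {X : ι → (Fin d → ℂ) → ℂ}
    {z : Fin d → ℂ} {r G B : ℝ} (hr : 1 ≤ r) (hz : ‖z‖ ≤ r) (hG : 0 ≤ G) (hξ : ∀ l, ‖ξ l‖ ≤ G)
    (hB : 1 ≤ B) (hΘ : ‖Θ z‖ ≤ B) (hX : ∀ i, ‖X i z‖ ≤ B) :
    ‖clearedAux i₀ v ξ Θ X z‖ ≤ (L : ℝ) ^ (d + 1) * G * r ^ L * B ^ (d * L) := by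
  have hterm : ∀ l : Option (Fin d) → Fin L, ‖ξ l * (z i₀ ^ (l none : ℕ) *
      ∏ j, (Θ z ^ (L - (l (some j) : ℕ)) * X (v j) z ^ (l (some j) : ℕ)))‖ ≤
      G * (r ^ L * B ^ (d * L)) := by
    intro l
    rw [norm_mul, norm_mul, norm_pow, norm_prod]
    have h1 : ‖z i₀‖ ^ (l none : ℕ) ≤ r ^ L :=
      (pow_le_pow_left₀ (norm_nonneg _) ((norm_le_pi_norm z i₀).trans hz) _).trans
        (pow_le_pow_right₀ hr (l none).2.le)
    have h2 : ∏ j, ‖Θ z ^ (L - (l (some j) : ℕ)) * X (v j) z ^ (l (some j) : ℕ)‖ ≤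
        ∏ _j : Fin d, B ^ L := by
      refine Finset.prod_le_prod (fun _ _ => norm_nonneg _) fun j _ => ?_
      rw [norm_mul, norm_pow, norm_pow]
      calc _ ≤ B ^ (L - (l (some j) : ℕ)) * B ^ (l (some j) : ℕ) := by
            gcongr
            exact hX _
        _ = B ^ L := by rw [← pow_add, Nat.sub_add_cancel (l (some j)).2.le]
    have h3 : ∏ _j : Fin d, B ^ L = B ^ (d * L) := by simp [← pow_mul, mul_comm]
    rw [h3] at h2
    have h4 := hξ l
    have h5 : 0 ≤ ∏ j, ‖Θ z ^ (L - (l (some j) : ℕ)) * X (v j) z ^ (l (some j) : ℕ)‖ :=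
      Finset.prod_nonneg fun _ _ => norm_nonneg _
    gcongr
  refine (norm_sum_le _ _).trans ((Finset.sum_le_sum fun l _ => hterm l).trans_eq ?_)
  simp
  ring

end Cleared

section Comparison

variable {d : ℕ} {ι : Type} [Finite ι] {D : Fin d → ι → MvPolynomial ι ℤ} {a₀ : ι → ℂ}
  {e : Fin d → Fin d → ℂ} {M : ℕ} {C R : ℝ} {Θ : (Fin d → ℂ) → ℂ} {X : ι → (Fin d → ℂ) → ℂ}

/-- The algebraic values taken at a grid point. -/
def gridVal {F : Type*} (s : F) (a : ι → F) (i : Option ι) : F := i.elim s a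

theorem Uniformization.wordDeriv_auxVal (hu : Uniformization D a₀ e M C R Θ X) (i₀ : Fin d)
    (v : Fin d → ι) {L : ℕ} (ξ : (Option (Fin d) → Fin L) → ℂ) (s : ℂ)
    {m : Fin d → ℕ} (hm : ∀ j, m j < M) (hR : gridPoint e m ∈ ball (0 : Fin d → ℂ) R) :
    ∃ ρ > 0, ball (gridPoint e m) ρ ⊆ ball 0 R ∧ (∀ z ∈ ball (gridPoint e m) ρ, Θ z ≠ 0) ∧
      AnalyticOnNhd ℂ (fun z => auxVal (extendSystem D i₀) (auxVar v) ξ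
        (fun i => extendSol i₀ s (fun i z => X i z / Θ z) i z) []) (ball (gridPoint e m) ρ) ∧
      ∀ w, wordDeriv (stdWord w) (fun z => auxVal (extendSystem D i₀) (auxVar v) ξ
        (fun i => extendSol i₀ s (fun i z => X i z / Θ z) i z) []) (gridPoint e m) =
        auxVal (extendSystem D i₀) (auxVar v) ξ (gridVal (s + gridPoint e m i₀) a₀) w := by
  obtain ⟨ρ, hρ, hsub, hne, hY, hD, ha⟩ := hu.exists_ball hm hR
  refine ⟨ρ, hρ, hsub, hne, analyticOnNhd_auxVal ξ (extendSol_analyticOnNhd hY) [], fun w => ?_⟩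
  have h1 : (fun i => extendSol i₀ s (fun i z => X i z / Θ z) i (gridPoint e m)) =
      gridVal (s + gridPoint e m i₀) a₀ := by
    ext i
    cases i with
    | none => rfl
    | some i => exact ha i
  rw [← h1]
  exact Lemniscate.wordDeriv_auxVal ξ isOpen_ball (extendSol_analyticOnNhd hY)
    (fun z hz => extendSol_fderiv (hD z hz)) w (mem_ball_self hρ)

theorem Uniformization.auxVal_perm (hu : Uniformization D a₀ e M C R Θ X) (i₀ : Fin d)
    (v : Fin d → ι) {L : ℕ} (ξ : (Option (Fin d) → Fin L) → ℂ)
    {m : Fin d → ℕ} (hm : ∀ j, m j < M) (hR : gridPoint e m ∈ ball (0 : Fin d → ℂ) R)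
    {w w' : List (Fin d)} (hw : w.Perm w') :
    auxVal (extendSystem D i₀) (auxVar v) ξ (gridVal (gridPoint e m i₀) a₀) w =
      auxVal (extendSystem D i₀) (auxVar v) ξ (gridVal (gridPoint e m i₀) a₀) w' := by
  obtain ⟨ρ, hρ, -, -, han, h⟩ := hu.wordDeriv_auxVal i₀ v ξ 0 hm hR
  rw [zero_add] at h
  rw [← h, ← h]
  exact wordDeriv_perm isOpen_ball (hw.map _) han (mem_ball_self hρ)

theorem Uniformization.wordDeriv_clearedAux (hu : Uniformization D a₀ e M C R Θ X) (i₀ : Fin d)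
    (v : Fin d → ι) {L : ℕ} (ξ : (Option (Fin d) → Fin L) → ℂ)
    {m : Fin d → ℕ} (hm : ∀ j, m j < M) (hR : gridPoint e m ∈ ball (0 : Fin d → ℂ) R)
    {w : List (Fin d)} (hw : ∀ w' : List (Fin d), w'.length < w.length →
      auxVal (extendSystem D i₀) (auxVar v) ξ (gridVal (gridPoint e m i₀) a₀) w' = 0) :
    wordDeriv (stdWord w) (clearedAux i₀ v ξ Θ X) (gridPoint e m) =
      Θ (gridPoint e m) ^ (d * L) *
        auxVal (extendSystem D i₀) (auxVar v) ξ (gridVal (gridPoint e m i₀) a₀) w := by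
  obtain ⟨ρ, hρ, hsub, hne, han, h⟩ := hu.wordDeriv_auxVal i₀ v ξ 0 hm hR
  have hp := mem_ball_self (x := gridPoint e m) hρ
  have hEq : EqOn (clearedAux i₀ v ξ Θ X) (fun z => Θ z ^ (d * L) *
      auxVal (extendSystem D i₀) (auxVar v) ξ
        (fun i => extendSol i₀ 0 (fun i z => X i z / Θ z) i z) []) (ball (gridPoint e m) ρ) :=
    fun z hz => clearedAux_eq _ i₀ v ξ X (hne z hz)
  rw [zero_add] at h
  rw [wordDeriv_congr isOpen_ball _ hEq hp, ← h]
  refine wordDeriv_mul_of_vanishing (g := fun z => Θ z ^ (d * L)) isOpen_ball hp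
    (range fun i => (Pi.single i 1 : Fin d → ℂ)) _ (by simp [stdWord])
    ((hu.analytic_den.mono hsub).pow _) han fun l' hl' hlen => ?_
  obtain ⟨l'', rfl⟩ : ∃ l'', stdWord l'' = l' := by
    have : l' ∈ range (List.map fun i => (Pi.single i 1 : Fin d → ℂ)) := by
      rw [Set.range_list_map]; exact hl'
    exact this
  rw [h, hw _ (by simpa [stdWord] using hlen)]

end Comparison

section Nondegenerate

variable {d : ℕ} {ι : Type}

/-- The polynomial with the given coefficients. -/
noncomputable def coeffPoly {L : ℕ} (ξ : (Option (Fin d) → Fin L) → ℂ) :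
    MvPolynomial (Option (Fin d)) ℂ :=
  ∑ l, monomial (Finsupp.equivFunOnFinite.symm fun i => (l i : ℕ)) (ξ l)

theorem eval_coeffPoly {L : ℕ} (ξ : (Option (Fin d) → Fin L) → ℂ) (x : Option (Fin d) → ℂ) :
    eval x (coeffPoly ξ) = ∑ l, ξ l * (x none ^ (l none : ℕ) *
      ∏ j, x (some j) ^ (l (some j) : ℕ)) := by
  rw [coeffPoly, map_sum]
  refine Finset.sum_congr rfl fun l _ => ?_
  rw [eval_monomial, Finsupp.prod_fintype _ _ (fun i => pow_zero _), Fintype.prod_option]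
  simp

theorem coeffPoly_eq_zero {L : ℕ} {ξ : (Option (Fin d) → Fin L) → ℂ} (h : coeffPoly ξ = 0) :
    ξ = 0 := by
  classical
  ext l
  have h1 := congrArg (coeff (Finsupp.equivFunOnFinite.symm fun i => (l i : ℕ))) h
  rw [coeffPoly, coeff_sum, coeff_zero, Finset.sum_eq_single l, coeff_monomial, if_pos rfl] at h1
  · exact h1
  · intro l' _ hl'
    rw [coeff_monomial, if_neg]
    intro h2
    apply hl'
    ext i
    exact congrFun (Finsupp.equivFunOnFinite.symm.injective h2) i
  · simp

/-- A set of points whose last coordinates fill a neighbourhood detects polynomials. -/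
theorem coeffPoly_eq_zero_of_nhds {L : ℕ} {ξ : (Option (Fin d) → Fin L) → ℂ} {w : Fin d → ℂ}
    (h : ∀ᶠ x in 𝓝 w, ∀ t : ℂ, eval (fun i : Option (Fin d) => i.elim t x) (coeffPoly ξ) = 0) :
    ξ = 0 := by
  obtain ⟨ρ, hρ, hball⟩ := Metric.eventually_nhds_iff_ball.1 h
  apply coeffPoly_eq_zero
  refine MvPolynomial.funext_set (fun i : Option (Fin d) => i.elim univ fun j => ball (w j) ρ)
    (fun i => ?_) fun x hx => ?_
  · cases i with
    | none => exact Set.infinite_univ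
    | some j => exact infinite_of_mem_nhds (w j) (ball_mem_nhds _ hρ)
  · have h1 : (fun j => x (some j)) ∈ ball w ρ := by
      rw [mem_ball, dist_pi_lt_iff hρ]
      exact fun j => hx (some j) (mem_univ _)
    have h2 := hball _ h1 (x none)
    have h3 : (fun i : Option (Fin d) => i.elim (x none) fun j => x (some j)) = x :=
      funext fun i => by cases i <;> rfl
    rw [map_zero, ← h2, h3]

/-- If the Jacobian at `p` is invertible, then the image of a neighbourhood of `p` is a
neighbourhood. -/
theorem map_nhds_eq_of_jacobian {f : Fin d → (Fin d → ℂ) → ℂ} {p : Fin d → ℂ}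
    (hf : ∀ j, AnalyticAt ℂ (f j) p)
    (hdet : (Matrix.of fun l j => fderiv ℂ (f j) p (Pi.single l 1)).det ≠ 0) :
    map (fun z j => f j z) (𝓝 p) = 𝓝 (fun j => f j p) := by
  set f' : (Fin d → ℂ) →L[ℂ] (Fin d → ℂ) := ContinuousLinearMap.pi fun j => fderiv ℂ (f j) p
  have hf' : HasStrictFDerivAt (fun z j => f j z) f' p :=
    hasStrictFDerivAt_pi.2 fun j => (hf j).hasStrictFDerivAt
  have hmat : LinearMap.toMatrix' (f' : (Fin d → ℂ) →ₗ[ℂ] (Fin d → ℂ)) =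
      (Matrix.of fun l j => fderiv ℂ (f j) p (Pi.single l 1)).transpose := by
    ext j l
    rw [LinearMap.toMatrix'_apply]
    simp only [f', Matrix.transpose_apply, Matrix.of_apply]
    change fderiv ℂ (f j) p _ = _
    congr 1
  have hdet' : IsUnit (LinearMap.det (f' : (Fin d → ℂ) →ₗ[ℂ] (Fin d → ℂ))) := by
    rw [← LinearMap.det_toMatrix', hmat, Matrix.det_transpose]
    exact hdet.isUnit
  have hsurj : Function.Surjective f' := by
    have := (LinearMap.isUnit_iff_range_eq_top _).1 ((LinearMap.isUnit_iff_isUnit_det _).2 hdet')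
    exact LinearMap.range_eq_top.1 this
  exact hf'.map_nhds_eq_of_surj (LinearMap.range_eq_top.2 hsurj)

/-- An auxiliary polynomial all of whose derivatives vanish at the origin is zero. -/
theorem eq_zero_of_auxVal_eq_zero [Finite ι] {D : Fin d → ι → MvPolynomial ι ℤ}
    {a₀ : ι → ℂ} {e : Fin d → Fin d → ℂ} (he : ∀ v : Fin d → ℂ, ∃ c : Fin d → ℂ, v = ∑ i, c i • e i)
    (i₀ : Fin d) (v : Fin d → ι) (hdet : (Matrix.of fun l j => aeval a₀ (D l (v j))).det ≠ 0)
    (han : ∀ M : ℕ, ∃ C R₀ : ℝ, 0 ≤ C ∧ ∀ R, R₀ ≤ R → ∃ Θ X, Uniformization D a₀ e M C R Θ X)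
    {L : ℕ} {ξ : (Option (Fin d) → Fin L) → ℂ}
    (h0 : ∀ w, auxVal (extendSystem D i₀) (auxVar v) ξ (gridVal 0 a₀) w = 0) :
    ξ = 0 := by
  have hstd : ∀ v : Fin d → ℂ, ∃ c : Fin d → ℂ, v = ∑ i, c i • (Pi.single i 1 : Fin d → ℂ) :=
    fun v => ⟨v, exists_std_coeff v⟩
  have hz : gridPoint e (fun _ : Fin d => 0) = 0 := by simp [gridPoint]
  have hmain : ∀ m : Fin d → ℕ, ∀ w, auxVal (extendSystem D i₀) (auxVar v) ξ
      (gridVal (gridPoint e m i₀) a₀) w = 0 := by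
    intro m w
    obtain ⟨C, R₀, hC, hu⟩ := han (∑ j, m j + 1)
    have hm : ∀ j, m j < ∑ j, m j + 1 := fun j =>
      Nat.lt_succ_of_le (Finset.single_le_sum (fun _ _ => Nat.zero_le _) (Finset.mem_univ j))
    obtain ⟨Θ, X, hu⟩ := hu (max R₀ (‖gridPoint e m‖ + 1)) (le_max_left _ _)
    set R := max R₀ (‖gridPoint e m‖ + 1) with hR
    have hRp : ‖gridPoint e m‖ < R := (lt_add_one _).trans_le (le_max_right _ _)
    have hR0 : 0 < R := (norm_nonneg _).trans_lt hRp
    have hH0 : EqOn (clearedAux i₀ v ξ Θ X) 0 (ball 0 R) := by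
      refine eqOn_zero_of_wordDeriv_eq_zero (e := fun i => (Pi.single i 1 : Fin d → ℂ)) hstd
        (analyticOnNhd_clearedAux i₀ v ξ hu.analytic_den hu.analytic_num) fun l => ?_
      have h1 := hu.wordDeriv_clearedAux i₀ v ξ (m := fun _ => 0) (fun _ => Nat.succ_pos _)
        (by rw [hz]; exact mem_ball_self hR0) (w := l) (fun w' _ => by rw [hz]; exact h0 w')
      rw [hz] at h1
      exact h1.trans (mul_eq_zero_of_right _ (h0 l))
    obtain ⟨ρ, hρ, hsub, hne, -, h⟩ := hu.wordDeriv_auxVal i₀ v ξ 0 hm (by simpa using hRp)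
    have hF : EqOn (fun z => auxVal (extendSystem D i₀) (auxVar v) ξ
        (fun i => extendSol i₀ 0 (fun i z => X i z / Θ z) i z) []) (fun _ => 0)
        (ball (gridPoint e m) ρ) := by
      intro z hz
      have h1 := hH0 (hsub hz)
      rw [clearedAux_eq (extendSystem D i₀) i₀ v ξ X (hne z hz)] at h1
      exact (mul_eq_zero.1 h1).resolve_left (pow_ne_zero _ (hne z hz))
    have h1 := wordDeriv_congr isOpen_ball (stdWord w) hF (mem_ball_self hρ)
    have h2 := wordDeriv_sum (V := Fin d → ℂ) isOpen_univ (∅ : Finset ℕ) (fun _ => 0) (stdWord w)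
      (h := fun _ _ => 0) (by simp) (mem_univ (gridPoint e m))
    simp only [Finset.sum_empty] at h2
    rwa [h, h2, zero_add] at h1
  obtain ⟨C, R₀, hC, hu⟩ := han 1
  obtain ⟨Θ, X, hu⟩ := hu (max R₀ 1) (le_max_left _ _)
  have hR0 : 0 < max R₀ 1 := zero_lt_one.trans_le (le_max_right _ _)
  obtain ⟨ρ, hρ, hsub, hne, hY, hD, ha⟩ := hu.exists_ball (m := fun _ => 0)
    (fun _ => Nat.succ_pos _) (by rw [hz]; exact mem_ball_self hR0)
  rw [hz] at hsub hne hY hD ha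
  have hp := mem_ball_self (x := (0 : Fin d → ℂ)) hρ
  have hG : ∀ m : Fin d → ℕ, ∀ z ∈ ball (0 : Fin d → ℂ) ρ,
      auxVal (extendSystem D i₀) (auxVar v) ξ
        (fun i => extendSol i₀ (gridPoint e m i₀) (fun i z => X i z / Θ z) i z) [] = 0 := by
    intro m
    refine eqOn_zero_of_wordDeriv_eq_zero (e := fun i => (Pi.single i 1 : Fin d → ℂ)) hstd
      (analyticOnNhd_auxVal ξ (extendSol_analyticOnNhd hY) []) fun l => ?_
    rw [← stdWord, wordDeriv_auxVal ξ isOpen_ball (extendSol_analyticOnNhd hY)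
          (fun z hz => extendSol_fderiv (hD z hz)) l hp]
    convert hmain m l using 2
    ext i
    cases i with
    | none => simp [extendSol, gridVal]
    | some i => exact ha i
  obtain ⟨j₀, hj₀⟩ : ∃ j, e j i₀ ≠ 0 := by
    by_contra! hcon
    obtain ⟨c, hc⟩ := he (Pi.single i₀ 1)
    have := congrFun hc i₀
    simp [Finset.sum_apply, hcon] at this
  have hgrid : ∀ N : ℕ, gridPoint e (Pi.single j₀ N) i₀ = N * e j₀ i₀ := by
    intro N
    rw [gridPoint, Finset.sum_apply, Finset.sum_eq_single j₀] <;>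
      simp +contextual
  have hpoly : ∀ z ∈ ball (0 : Fin d → ℂ) ρ, ∀ t : ℂ,
      eval (fun i : Option (Fin d) => i.elim t fun j => X (v j) z / Θ z) (coeffPoly ξ) = 0 := by
    intro z hz t
    set q : Polynomial ℂ := ∑ l, Polynomial.C (ξ l * ∏ j, (X (v j) z / Θ z) ^ (l (some j) : ℕ)) *
      Polynomial.X ^ (l none : ℕ) with hq
    have hqe : ∀ t : ℂ, q.eval t = eval (fun i : Option (Fin d) =>
        i.elim t fun j => X (v j) z / Θ z) (coeffPoly ξ) := by
      intro t
      rw [eval_coeffPoly, hq, Polynomial.eval_finsetSum]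
      refine Finset.sum_congr rfl fun l _ => ?_
      rw [Polynomial.eval_mul, Polynomial.eval_C, Polynomial.eval_pow, Polynomial.eval_X]
      simp only [Option.elim]
      ring
    have hq0 : q = 0 := by
      refine Polynomial.eq_zero_of_infinite_isRoot q (Set.Infinite.mono (s := range fun N : ℕ =>
        (N * e j₀ i₀ + z i₀ : ℂ)) ?_ (Set.infinite_range_of_injective fun N N' h => ?_))
      · rintro _ ⟨N, rfl⟩
        have h1 := hG (Pi.single j₀ N) z hz
        rw [auxVal, hgrid] at h1
        change q.eval _ = 0
        rw [hqe, eval_coeffPoly, ← h1]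
        refine Finset.sum_congr rfl fun l _ => ?_
        rw [wordPoly, aeval_mono_extendSol]
        rfl
      · simpa [hj₀] using h
    rw [← hqe, hq0, Polynomial.eval_zero]
  have hjac : (Matrix.of fun l j =>
      fderiv ℂ (fun z => X (v j) z / Θ z) 0 (Pi.single l 1)).det ≠ 0 := by
    have h1 : (fun i => X i 0 / Θ 0) = a₀ := funext ha
    simpa only [hD 0 hp, h1] using hdet
  have hmap := map_nhds_eq_of_jacobian (f := fun j z => X (v j) z / Θ z)
    (fun j => hY (v j) 0 hp) hjac
  refine coeffPoly_eq_zero_of_nhds (w := fun j => X (v j) 0 / Θ 0) ?_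
  rw [← hmap, eventually_map]
  filter_upwards [ball_mem_nhds _ hρ] with z hz using hpoly z hz

end Nondegenerate

end Lemniscate

namespace Lemniscate

open Metric Set Filter Topology MvPolynomial NumberField

/-- Finitely many algebraic numbers lie in a number field. -/
theorem exists_numberField {ι : Type} [Finite ι] (a : ι → ℂ) (ha : ∀ i, IsAlgebraic ℚ (a i)) :
    ∃ (K : Type) (_ : Field K) (_ : NumberField K) (σ : K →+* ℂ) (b : ι → K), ∀ i, σ (b i) = a i := by
  let K := IntermediateField.adjoin ℚ (range a)
  have hK : FiniteDimensional ℚ K :=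
    IntermediateField.finiteDimensional_adjoin (by rintro _ ⟨i, rfl⟩; exact (ha i).isIntegral)
  refine ⟨K, inferInstance, ⟨⟩, algebraMap K ℂ, fun i =>
    ⟨a i, IntermediateField.subset_adjoin ℚ _ (mem_range_self i)⟩, fun i => rfl⟩

theorem exists_common_denominator {K ι : Type} [Field K] [NumberField K] [Finite ι] (b : ι → K) :
    ∃ δ : ℕ, δ ≠ 0 ∧ ∀ i, IsIntegral ℤ ((δ : K) * b i) := by
  have := Fintype.ofFinite ι
  have h : ∀ i, ∃ n : ℤ, n ≠ 0 ∧ IsIntegral ℤ (n • b i) := fun i => by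
    have h1 : IsAlgebraic ℤ (b i) :=
      (IsFractionRing.isAlgebraic_iff ℤ ℚ K).2 (Algebra.IsAlgebraic.isAlgebraic (R := ℚ) (b i))
    exact h1.exists_integral_multiple
  choose n hn0 hn using h
  refine ⟨∏ i, (n i).natAbs, Finset.prod_ne_zero_iff.2 fun i _ => Int.natAbs_ne_zero.2 (hn0 i),
    fun i => ?_⟩
  classical
  rw [← Finset.mul_prod_erase _ _ (Finset.mem_univ i)]
  have h1 : IsIntegral ℤ (((n i).natAbs : K) * b i) := by
    rcases Int.natAbs_eq (n i) with h | h
    · have := hn i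
      rw [h, zsmul_eq_mul] at this
      simpa using this
    · have := (hn i).neg
      rw [h, zsmul_eq_mul] at this
      simpa using this
  have h2 : IsIntegral ℤ ((∏ j ∈ Finset.univ.erase i, (n j).natAbs : ℕ) : K) :=
    isIntegral_natCast _
  rw [Nat.cast_mul, mul_right_comm]
  exact h1.mul h2

section Main

variable {d : ℕ} {ι K : Type} [Fintype ι] [Field K] [NumberField K]

/-- The contradiction between the analytic upper bound and the arithmetic lower bound. -/
theorem periodic_schneider_lang_aux (hd : 1 ≤ d) (σ : K →+* ℂ) (D : Fin d → ι → MvPolynomial ι ℤ)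
    (a : ι → K) (e : Fin d → Fin d → ℂ)
    (he : ∀ v : Fin d → ℂ, ∃ c : Fin d → ℂ, v = ∑ i, c i • e i)
    (i₀ : Fin d) (ε : Fin d → K) (hε : ∀ j, σ (ε j) = e j i₀)
    (v : Fin d → ι) (hdet : (Matrix.of fun l j => aeval (fun i => σ (a i)) (D l (v j))).det ≠ 0)
    (han : ∀ M : ℕ, ∃ C R₀ : ℝ, 0 ≤ C ∧ ∀ R, R₀ ≤ R →
      ∃ Θ X, Uniformization D (fun i => σ (a i)) e M C R Θ X) : False := by
  classical
  set a₀ : ι → ℂ := fun i => σ (a i) with ha₀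
  set D' := extendSystem D i₀ with hD'
  set u := auxVar v with hu
  obtain ⟨h, h1, hdeg, hnorm⟩ : ∃ h : ℕ, 1 ≤ h ∧ (∀ l i, (D' l i).totalDegree ≤ h) ∧
      ∀ l i, norm1 (D' l i) ≤ h := by
    refine ⟨1 + ∑ p : Fin d × Option ι, ((D' p.1 p.2).totalDegree + norm1 (D' p.1 p.2)),
      Nat.le_add_right _ _, fun l i => ?_, fun l i => ?_⟩ <;>
    · have := Finset.single_le_sum (f := fun p : Fin d × Option ι =>
        (D' p.1 p.2).totalDegree + norm1 (D' p.1 p.2)) (fun _ _ => Nat.zero_le _)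
        (Finset.mem_univ (l, i))
      simp only at this
      omega
  obtain ⟨C₀, hC₀, haux⟩ := exists_auxiliary K hd D' h1 hdeg hnorm u
  obtain ⟨C₁, hC₁, hlow⟩ := exists_lower_bound K σ D' h1 hdeg hnorm u hC₀
  obtain ⟨M, hM⟩ : ∃ M, M = 2 * d * (d + 1) * (C₀ + C₁ + d + 4) := ⟨_, rfl⟩
  have hM0 : 0 < M := by rw [hM]; positivity
  obtain ⟨C, R₀, hC, hunif⟩ := han M
  -- the algebraic data
  set y : (Fin d → ℕ) → Option ι → K := fun m => gridVal (∑ j, (m j : K) * ε j) a with hy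
  have hσy : ∀ m, (fun i => σ (y m i)) = gridVal (gridPoint e m i₀) a₀ := by
    intro m
    ext i
    cases i with
    | none => simp [hy, gridVal, gridPoint, Finset.sum_apply, hε]
    | some i => rfl
  obtain ⟨δ, hδ0, hδ⟩ := exists_common_denominator (Sum.elim a ε)
  have hInt : ∀ m i, IsIntegral ℤ ((δ : K) * y m i) := by
    intro m i
    cases i with
    | none =>
      simp only [hy, gridVal, Option.elim, Finset.mul_sum]
      refine IsIntegral.sum _ fun j _ => ?_
      rw [mul_left_comm]
      exact (isIntegral_natCast _).mul (hδ (Sum.inr j))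
    | some i => exact hδ (Sum.inl i)
  obtain ⟨B, hB1, hδB, hyB⟩ : ∃ B : ℝ, 1 ≤ B ∧ (δ : ℝ) ≤ B ∧
      ∀ m, (∀ j, m j < M) → ∀ i, house (y m i) ≤ B := by
    have h0 : 0 ≤ ∑ p : (Fin d → Fin M) × Option ι, house (y (fun j => p.1 j) p.2) :=
      Finset.sum_nonneg fun _ _ => house_nonneg' _
    refine ⟨1 + δ + ∑ p : (Fin d → Fin M) × Option ι, house (y (fun j => p.1 j) p.2), by
      linarith [Nat.cast_nonneg (α := ℝ) δ], by linarith, fun m hm i => ?_⟩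
    have := Finset.single_le_sum (f := fun p : (Fin d → Fin M) × Option ι =>
        house (y (fun j => p.1 j) p.2)) (fun _ _ => house_nonneg' _)
        (Finset.mem_univ ((fun j => ⟨m j, hm j⟩), i))
    simp only at this
    linarith [Nat.cast_nonneg (α := ℝ) δ]
  -- the analytic data
  obtain ⟨c, hc1, hc⟩ : ∃ c : ℝ, 1 ≤ c ∧ ∀ j, ‖e j‖ ≤ c := by
    have h0 : 0 ≤ ∑ j, ‖e j‖ := Finset.sum_nonneg fun _ _ => norm_nonneg _
    refine ⟨1 + ∑ j, ‖e j‖, by linarith, fun j => ?_⟩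
    have := Finset.single_le_sum (f := fun j => ‖e j‖) (fun _ _ => norm_nonneg _)
      (Finset.mem_univ j)
    linarith
  choose co hco using fun i : Fin d => he (Pi.single i 1)
  obtain ⟨A, hA1, hA⟩ : ∃ A : ℝ, 1 ≤ A ∧ ∀ i, ∑ j, ‖co i j‖ ≤ A := by
    have h0 : ∀ i, 0 ≤ ∑ j, ‖co i j‖ := fun i => Finset.sum_nonneg fun _ _ => norm_nonneg _
    have h2 : 0 ≤ ∑ i, ∑ j, ‖co i j‖ := Finset.sum_nonneg fun i _ => h0 i
    refine ⟨1 + ∑ i, ∑ j, ‖co i j‖, by linarith, fun i => ?_⟩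
    have := Finset.single_le_sum (f := fun i => ∑ j, ‖co i j‖) (fun i _ => h0 i)
      (Finset.mem_univ i)
    linarith
  set x : ℝ := 16 * c * M with hx
  have hMR : (1 : ℝ) ≤ M := by exact_mod_cast hM0
  have hx1 : 1 ≤ x := by rw [hx]; nlinarith
  set c₂ : ℝ := 4 * C * d * M ^ d with hc₂
  set κ : ℝ := Real.log A + Real.log c + C₀ * Real.log (C₀ * B) + c₂ + C₁ * Real.log (C₁ * B) +
      2 * (d + 1) * (C₀ + C₁ + d + 4) * Real.log x with hκ
  obtain ⟨Q, hQ⟩ := exists_nat_gt (max (max (2 * (M : ℝ) ^ d) (max R₀ (2 * (d * (M * c) + 1))))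
    (max x (Real.exp κ)))
  simp only [max_lt_iff] at hQ
  obtain ⟨⟨hQM, hQR₀, hQc⟩, hQx, hQκ⟩ := hQ
  have hQ1 : (1 : ℝ) ≤ Q := hx1.trans hQx.le
  have hQN : 1 ≤ Q := by exact_mod_cast hQ1
  have hQMN : 2 * M ^ d ≤ Q := by exact_mod_cast hQM.le
  set T := Q ^ (2 * (d + 1)) with hT
  set L := 2 * M ^ d * Q ^ (2 * d) with hL
  have hT0 : 0 < T := by positivity
  have hL0 : 0 < L := by positivity
  have hLT : L ≤ T := by
    calc L ≤ Q ^ 2 * Q ^ (2 * d) := Nat.mul_le_mul_right _ (hQMN.trans (Nat.le_self_pow two_ne_zero Q))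
      _ = T := by rw [hT, ← pow_add]; congr 1; ring
  obtain ⟨ξ, hξ0, hξ, hξB⟩ := haux M T L δ B y hM0 hT0 hL0 hLT (by
    simp only [Fintype.card_option, Fintype.card_fin]
    calc 2 * (M ^ d * T ^ d) ≤ (2 * M ^ d) ^ (d + 1) * T ^ d := by
          rw [← mul_assoc]
          exact Nat.mul_le_mul_right _ (Nat.le_self_pow (Nat.succ_ne_zero d) _)
      _ = L ^ (d + 1) := by rw [hT, hL, mul_pow _ (Q ^ (2 * d)), ← pow_mul, ← pow_mul]; ring_nf)
    hδ0 hB1 hδB hyB hInt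
  set ζ : (Option (Fin d) → Fin L) → ℂ := fun l => σ (ξ l) with hζ
  have hζ0 : ζ ≠ 0 := by
    intro h0
    apply hξ0
    ext l
    have : σ (ξ l) = 0 := congrFun h0 l
    simpa using this
  have hσ : ∀ m w, σ (auxVal D' u (fun l => (ξ l : K)) (y m) w) =
      auxVal D' u ζ (gridVal (gridPoint e m i₀) a₀) w := by
    intro m w
    rw [map_auxVal, hσy]
  have hgrid : ∀ R : ℝ, Q ≤ R → ∀ m : Fin d → ℕ, (∀ j, m j < M) →
      gridPoint e m ∈ ball (0 : Fin d → ℂ) R := by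
    intro R hR m hm
    rw [mem_ball_zero_iff]
    have h0 : 0 ≤ (d : ℝ) * (M * c) := by positivity
    linarith [norm_gridPoint_le hc hm]
  have hex : ∃ n, ∃ w : List (Fin d), w.length = n ∧ ∃ m : Fin d → ℕ, (∀ j, m j < M) ∧
      auxVal D' u (fun l => (ξ l : K)) (y m) w ≠ 0 := by
    by_contra! hcon
    refine hζ0 (eq_zero_of_auxVal_eq_zero he i₀ v hdet han fun w => ?_)
    have h2 := hσ (fun _ => 0) w
    rw [hcon _ w rfl (fun _ => 0) fun _ => hM0, map_zero] at h2
    have h3 : gridPoint e (fun _ : Fin d => 0) i₀ = 0 := by simp [gridPoint]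
    rw [h3] at h2
    exact h2.symm
  set t := Nat.find hex with ht
  obtain ⟨w, hwt, m, hm, hwm⟩ := Nat.find_spec hex
  rw [← ht] at hwt
  have hmin : ∀ w : List (Fin d), w.length < t → ∀ m : Fin d → ℕ, (∀ j, m j < M) →
      auxVal D' u ζ (gridVal (gridPoint e m i₀) a₀) w = 0 := by
    intro w hw m hm
    by_contra hne
    refine Nat.find_min hex hw ⟨w, rfl, m, hm, fun h0 => hne ?_⟩
    rw [← hσ, h0, map_zero]
  have hTt : T ≤ t := by
    by_contra! hlt
    apply hwm
    apply σ.injective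
    obtain ⟨Θ, X, hun⟩ := hunif Q hQR₀.le
    rw [hσ, hun.auxVal_perm i₀ v ζ hm (hgrid _ le_rfl m hm) (perm_sortedWord w), ← hσ]
    congr 1
    exact hξ m hm fun i => ⟨w.count i, (List.count_le_length.trans_eq hwt).trans_lt hlt⟩
  have ht1 : 1 ≤ t := hT0.trans_le hTt
  have htR : (1 : ℝ) ≤ t := by exact_mod_cast ht1
  -- the radius
  set n := 2 * (d + 1) with hn
  have hn0 : n ≠ 0 := by omega
  set r : ℝ := (t : ℝ) ^ ((n : ℝ)⁻¹) with hr
  have hrt : r ^ n = t := Real.rpow_inv_natCast_pow (by positivity) hn0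
  have hQr : (Q : ℝ) ≤ r := by
    refine le_of_pow_le_pow_left₀ hn0 (by positivity) ?_
    rw [hrt]
    exact_mod_cast hTt
  have hr1 : 1 ≤ r := hQ1.trans hQr
  have hr0 : 0 < r := by linarith
  have hrt' : r ≤ t := by
    rw [← hrt]
    exact le_self_pow₀ hr1 hn0
  obtain ⟨Θ, X, hun⟩ := hunif r (hQR₀.le.trans hQr)
  set G := gbd C₀ B t with hG
  have hG0 : 0 ≤ G := gbd_nonneg hB1
  have hζG : ∀ l, ‖ζ l‖ ≤ G := fun l =>
    (norm_embedding_le_house _ σ).trans ((hξB l).trans (gbd_mono_right hB1 hC₀ hT0 hTt))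
  set E₀ : ℝ := Real.exp (C * r ^ 2) with hE₀
  have hE₀1 : 1 ≤ E₀ := Real.one_le_exp (by positivity)
  set S : ℝ := (L : ℝ) ^ (d + 1) * G * r ^ L * E₀ ^ (d * L) with hS
  have hHS : ∀ z ∈ ball (0 : Fin d → ℂ) r, ‖clearedAux i₀ v ζ Θ X z‖ ≤ S := fun z hz =>
    norm_clearedAux_le i₀ v hr1 (mem_ball_zero_iff.1 hz).le hG0 hζG hE₀1 (hun.norm_den_le z hz)
      fun i => hun.norm_num_le i z hz
  have hH := analyticOnNhd_clearedAux i₀ v ζ hun.analytic_den hun.analytic_num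
  have hwordzero : ∀ m : Fin d → ℕ, (∀ j, m j < M) → ∀ l : List (Fin d), l.length < t →
      wordDeriv (l.map e) (clearedAux i₀ v ζ Θ X) (gridPoint e m) = 0 := by
    intro m hm l hl
    refine wordDeriv_eq_zero_of_std isOpen_ball (hgrid r hQr m hm) hH (n := l.length)
      (fun w hw => ?_) e (by simp) (by simp)
    rw [hun.wordDeriv_clearedAux i₀ v ζ hm (hgrid r hQr m hm)
      (fun w' hw' => hmin w' (by omega) m hm), hmin w (by omega) m hm, mul_zero]
  have hxr : x / r ≤ 1 := (div_le_one hr0).2 (hQx.le.trans hQr)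
  obtain ⟨b, hb⟩ : ∃ b, b = (t + (d - 1)) / d := ⟨_, rfl⟩
  have htb : t ≤ d * b := by
    have := Nat.div_add_mod (t + (d - 1)) d
    have := Nat.mod_lt (t + (d - 1)) (show 0 < d by omega)
    rw [hb]; omega
  have hup : ∀ l : List (Fin d), l.length = t →
      ‖wordDeriv (l.map e) (clearedAux i₀ v ζ Θ X) (gridPoint e m)‖ ≤
        (c * t) ^ t * ((x / r) ^ (b * M) * S) := by
    intro l hl
    obtain ⟨b', hb', hle⟩ := norm_wordDeriv_gridPoint_le hc1 hc hM0 (hQc.le.trans hQr)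
      (by rw [hx] at hQx; nlinarith) hH hHS hwordzero hm hl ht1
    refine hle.trans ?_
    have hbb : b ≤ b' := by
      rw [hb]
      exact (Nat.div_le_iff_le_mul_add_pred (by omega)).2 (by omega)
    have hS0 : 0 ≤ S := by positivity
    gcongr ?_ * (?_ * _)
    exact pow_le_pow_of_le_one (by positivity) hxr (Nat.mul_le_mul_right _ hbb)
  have hup2 := norm_wordDeriv_le_of_basis isOpen_ball (hgrid r hQr m hm) e
    (W := range fun i => (Pi.single i 1 : Fin d → ℂ)) (zero_le_one.trans hA1)
    (by positivity) (by rintro _ ⟨i, rfl⟩; exact ⟨co i, hco i, hA i⟩) hH hup (stdWord w)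
    (by simp [stdWord]) (by simp [stdWord, hwt])
  rw [hun.wordDeriv_clearedAux i₀ v ζ hm (hgrid r hQr m hm)
      (fun w' hw' => hmin w' (by omega) m hm), ← hσ, norm_mul, norm_pow] at hup2
  have hlow' := hlow t L δ B (y m) ht1 (hLT.trans hTt) hδ0 hB1 hδB (hyB m hm) (hInt m) ξ
    (fun l => (hξB l).trans (gbd_mono_right hB1 hC₀ hT0 hTt)) w hwt.le hwm
  change 1 ≤ ‖σ (auxVal D' u (fun l => (ξ l : K)) (y m) w)‖ * _ at hlow'
  set V := ‖σ (auxVal D' u (fun l => (ξ l : K)) (y m) w)‖ with hV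
  have hV0 : 0 ≤ V := norm_nonneg _
  have hΘ : 1 ≤ ‖Θ (gridPoint e m)‖ ^ (d * L) * E₀ ^ (d * L) := by
    rw [← mul_pow]
    refine one_le_pow₀ ?_
    have h2 := hun.le_norm_den m hm
    rw [Real.exp_neg] at h2
    rwa [inv_le_iff_one_le_mul₀ (Real.exp_pos _)] at h2
  have hkey : V ≤ A ^ t * ((c * t) ^ t * ((x / r) ^ (b * M) *
      ((L : ℝ) ^ (d + 1) * G * r ^ L * (E₀ ^ (d * L) * E₀ ^ (d * L))))) := by
    calc V ≤ V * (‖Θ (gridPoint e m)‖ ^ (d * L) * E₀ ^ (d * L)) := le_mul_of_one_le_right hV0 hΘ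
      _ = (‖Θ (gridPoint e m)‖ ^ (d * L) * V) * E₀ ^ (d * L) := by ring
      _ ≤ (A ^ t * ((c * t) ^ t * ((x / r) ^ (b * M) * S))) * E₀ ^ (d * L) := by gcongr
      _ = _ := by rw [hS]; ring
  have hLt : L ≤ t := hLT.trans hTt
  have hlog := log_le_of_estimates (A := A) (c := c) (x := x) (r := r) (B := B)
    (q := (L : ℝ) ^ (d + 1)) (E := E₀ ^ (d * L) * E₀ ^ (d * L)) (c₂ := c₂) hd ht1 hC₀ hC₁ hA1 hc1
    hx1 (hQx.le.trans hQr) hB1 hrt hrt' hLt htb (by positivity) (by gcongr) (by positivity) ?_ hM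
    (hlow'.trans (mul_le_mul_of_nonneg_right hkey (gbd_nonneg hB1)))
  · rw [← hκ] at hlog
    have h2 : Real.exp κ < t := hQκ.trans_le (hQr.trans hrt')
    rw [← Real.lt_log_iff_exp_lt (by linarith)] at h2
    linarith
  · rw [← pow_add, hE₀, ← Real.exp_nat_mul]
    refine Real.exp_le_exp.2 ?_
    have h2 : (L : ℝ) * r ^ 2 ≤ 2 * M ^ d * t := by
      rw [← hrt, hL, hn]
      push_cast
      calc 2 * (M : ℝ) ^ d * Q ^ (2 * d) * r ^ 2 ≤ 2 * (M : ℝ) ^ d * r ^ (2 * d) * r ^ 2 := by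
            gcongr
        _ = _ := by ring
    push_cast
    calc ((d : ℝ) * L + d * L) * (C * r ^ 2) = 2 * C * d * (L * r ^ 2) := by ring
      _ ≤ 2 * C * d * (2 * M ^ d * t) := by gcongr
      _ = c₂ * t := by rw [hc₂]; ring

end Main

/-- A several-variable Schneider--Lang theorem for functions that take algebraic values on a
lattice. -/
theorem periodic_schneider_lang {d : ℕ} {ι : Type} [Finite ι] (hd : 1 ≤ d)
    (D : Fin d → ι → MvPolynomial ι ℤ) (a₀ : ι → ℂ) (ha₀ : ∀ i, IsAlgebraic ℚ (a₀ i))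
    (e : Fin d → Fin d → ℂ) (he : ∀ v : Fin d → ℂ, ∃ c : Fin d → ℂ, v = ∑ i, c i • e i)
    (i₀ : Fin d) (hε : ∀ j, IsAlgebraic ℚ (e j i₀))
    (v : Fin d → ι) (hdet : (Matrix.of fun l j => aeval a₀ (D l (v j))).det ≠ 0)
    (han : ∀ M : ℕ, ∃ C R₀ : ℝ, 0 ≤ C ∧ ∀ R, R₀ ≤ R →
      ∃ Θ X, Uniformization D a₀ e M C R Θ X) : False := by
  have := Fintype.ofFinite ι
  obtain ⟨K, _, _, σ, b, hb⟩ := exists_numberField (Sum.elim a₀ fun j => e j i₀)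
    (by rintro (i | j); exacts [ha₀ i, hε j])
  have h1 : (fun i => σ (b (Sum.inl i))) = a₀ := funext fun i => hb (Sum.inl i)
  refine periodic_schneider_lang_aux hd σ D (fun i => b (Sum.inl i)) e he i₀
    (fun j => b (Sum.inr j)) (fun j => hb (Sum.inr j)) v ?_ ?_
  · rwa [h1]
  · rwa [h1]

end Lemniscate

namespace Lemniscate

set_option linter.unusedSectionVars false

open Matrix

section Det

variable {J : Type*} [Fintype J] [DecidableEq J]

theorem analyticAt_det {V : Type*} [NormedAddCommGroup V] [NormedSpace ℂ V]
    {A : V → Matrix J J ℂ} {z : V} (hA : ∀ i j, AnalyticAt ℂ (fun w => A w i j) z) :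
    AnalyticAt ℂ (fun w => (A w).det) z := by
  simp only [Matrix.det_apply]
  refine Finset.analyticAt_fun_sum _ fun σ _ => ?_
  have h : AnalyticAt ℂ (fun w => ∏ i, A w (σ i) i) z :=
    Finset.analyticAt_fun_prod _ fun i _ => hA _ _
  have h2 := h.const_smul (c := ((Equiv.Perm.sign σ : ℤ) : ℂ))
  refine h2.congr (Filter.Eventually.of_forall fun w => ?_)
  simp [Units.smul_def]

theorem analyticAt_adjugate {V : Type*} [NormedAddCommGroup V] [NormedSpace ℂ V]
    {A : V → Matrix J J ℂ} {z : V} (hA : ∀ i j, AnalyticAt ℂ (fun w => A w i j) z) (i j : J) :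
    AnalyticAt ℂ (fun w => (A w).adjugate i j) z := by
  simp only [Matrix.adjugate_apply]
  refine analyticAt_det fun k l => ?_
  by_cases h : k = j
  · subst h
    simpa [Matrix.updateRow_self] using analyticAt_const
  · simpa [Matrix.updateRow_ne h] using hA k l

theorem norm_det_le {A : Matrix J J ℂ} {x : ℝ} (hA : ∀ i j, ‖A i j‖ ≤ x) :
    ‖A.det‖ ≤ (Fintype.card J).factorial * x ^ Fintype.card J := by
  have := Matrix.det_le (abv := NormedField.toAbsoluteValue ℂ) (A := A) (x := x) hA
  rw [nsmul_eq_mul] at this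
  exact this

theorem norm_adjugate_le {A : Matrix J J ℂ} {x : ℝ} (hx : 1 ≤ x) (hA : ∀ i j, ‖A i j‖ ≤ x)
    (i j : J) : ‖A.adjugate i j‖ ≤ (Fintype.card J).factorial * x ^ Fintype.card J := by
  rw [Matrix.adjugate_apply]
  refine norm_det_le fun k l => ?_
  by_cases h : k = j
  · subst h
    rw [Matrix.updateRow_self]
    by_cases h' : l = i
    · subst h'; simpa using hx
    · simp [Pi.single_eq_of_ne h']; linarith
  · simpa [Matrix.updateRow_ne h] using hA k l

end Det

section Inverse

variable {A : Type*} [NormedRing A] [CompleteSpace A]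

theorem isUnit_one_sub {t : A} (ht : ‖t‖ ≤ 1 / 2) : IsUnit (1 - t) :=
  (Units.oneSub t (by linarith)).isUnit

theorem norm_inverse_one_sub_le [NormOneClass A] {t : A} (ht : ‖t‖ ≤ 1 / 2) :
    ‖Ring.inverse (1 - t)‖ ≤ 2 := by
  have ht' : ‖t‖ < 1 := by linarith
  rw [NormedRing.inverse_one_sub t ht']
  have := tsum_geometric_le_of_norm_lt_one t ht'
  rw [norm_one, sub_self, zero_add] at this
  refine this.trans ?_
  rw [inv_le_comm₀ (by linarith) (by norm_num)]
  linarith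

end Inverse

variable {E : Type*} [NormedAddCommGroup E] [NormedSpace ℂ E] [CompleteSpace E]
  {J : Type*} [Fintype J] [DecidableEq J]

/-- The finite-rank operator `x ↦ ∑ j, φ j x • δ j`. -/
noncomputable def finRank (φ : J → E →L[ℂ] ℂ) (δ : J → E) : E →L[ℂ] E :=
  ∑ j, (φ j).smulRight (δ j)

theorem finRank_apply (φ : J → E →L[ℂ] ℂ) (δ : J → E) (x : E) :
    finRank φ δ x = ∑ j, φ j x • δ j := by
  simp [finRank]

/-- The inverse of the part of `1 - K` outside the range of the truncation. -/
noncomputable def tailInv (φ : J → E →L[ℂ] ℂ) (δ : J → E) (K : E →L[ℂ] E) : E →L[ℂ] E :=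
  Ring.inverse (1 - (K - finRank φ δ * K))

/-- The finite matrix to which the equation `(1 - K) x = c` reduces. -/
noncomputable def redMatrix (φ : J → E →L[ℂ] ℂ) (δ : J → E) (K : E →L[ℂ] E) : Matrix J J ℂ :=
  1 - Matrix.of fun i j => φ i (K (tailInv φ δ K (δ j)))

/-- The truncated Fredholm determinant of `1 - K`. -/
noncomputable def fredholmDet (φ : J → E →L[ℂ] ℂ) (δ : J → E) (K : E →L[ℂ] E) : ℂ :=
  (redMatrix φ δ K).det

/-- The numerator of the solution of `(1 - K) x = c`, by Cramer's rule. -/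
noncomputable def fredholmNum (φ : J → E →L[ℂ] ℂ) (δ : J → E) (K : E →L[ℂ] E) (c : E) : E :=
  fredholmDet φ δ K • tailInv φ δ K c +
    ∑ j, ((redMatrix φ δ K).adjugate *ᵥ fun i => φ i (K (tailInv φ δ K c))) j •
      tailInv φ δ K (δ j)

variable {φ : J → E →L[ℂ] ℂ} {δ : J → E} {K : E →L[ℂ] E}

theorem tail_mul_tailInv (hK : ‖K - finRank φ δ * K‖ ≤ 1 / 2) :
    (1 - (K - finRank φ δ * K)) * tailInv φ δ K = 1 :=
  Ring.mul_inverse_cancel _ (isUnit_one_sub hK)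

theorem one_sub_mul_tailInv (hK : ‖K - finRank φ δ * K‖ ≤ 1 / 2) :
    (1 - K) * tailInv φ δ K = 1 - finRank φ δ * K * tailInv φ δ K := by
  have := tail_mul_tailInv hK
  calc (1 - K) * tailInv φ δ K
      = (1 - (K - finRank φ δ * K)) * tailInv φ δ K - finRank φ δ * K * tailInv φ δ K := by
        noncomm_ring
    _ = _ := by rw [this]

theorem one_sub_tailInv_apply (hK : ‖K - finRank φ δ * K‖ ≤ 1 / 2) (x : E) :
    (1 - K) (tailInv φ δ K x) = x - ∑ i, φ i (K (tailInv φ δ K x)) • δ i := by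
  have := DFunLike.congr_fun (one_sub_mul_tailInv hK) x
  simpa [finRank_apply] using this

theorem one_sub_fredholmNum (hK : ‖K - finRank φ δ * K‖ ≤ 1 / 2) (c : E) :
    (1 - K) (fredholmNum φ δ K c) = fredholmDet φ δ K • c := by
  set b : J → ℂ := fun i => φ i (K (tailInv φ δ K c)) with hb
  set w := (redMatrix φ δ K).adjugate *ᵥ b with hw
  have key : redMatrix φ δ K *ᵥ w = fredholmDet φ δ K • b := by
    rw [hw, Matrix.mulVec_mulVec, Matrix.mul_adjugate, Matrix.smul_mulVec, Matrix.one_mulVec]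
    rfl
  have hs : ∑ j, w j • (1 - K) (tailInv φ δ K (δ j)) = ∑ i, (redMatrix φ δ K *ᵥ w) i • δ i := by
    simp only [one_sub_tailInv_apply hK, redMatrix, Matrix.sub_mulVec, Matrix.one_mulVec,
      Pi.sub_apply, sub_smul, smul_sub, Finset.sum_sub_distrib]
    congr 1
    simp only [Matrix.mulVec, dotProduct, Matrix.of_apply, Finset.sum_smul, Finset.smul_sum,
      smul_smul]
    rw [Finset.sum_comm]
    simp only [mul_comm]
  rw [fredholmNum, map_add, map_smul, map_sum]
  simp only [map_smul]
  rw [hs, key, one_sub_tailInv_apply hK, smul_sub, Finset.smul_sum]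
  simp [hb, smul_smul]

theorem norm_fredholm_entry_le (hφ : ∀ i, ‖φ i‖ ≤ 1) {κ : ℝ}
    (hκ : ‖K‖ ≤ κ) (hK : ‖K - finRank φ δ * K‖ ≤ 1 / 2) [Nontrivial E] {c : E} (hc : ‖c‖ ≤ 1)
    (i : J) : ‖φ i (K (tailInv φ δ K c))‖ ≤ 2 * κ := by
  have hS : ‖tailInv φ δ K‖ ≤ 2 := norm_inverse_one_sub_le hK
  have hκ0 : 0 ≤ κ := (norm_nonneg _).trans hκ
  calc ‖φ i (K (tailInv φ δ K c))‖ ≤ ‖φ i‖ * (‖K‖ * (‖tailInv φ δ K‖ * ‖c‖)) :=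
        (ContinuousLinearMap.le_opNorm _ _).trans (by
          gcongr
          refine (ContinuousLinearMap.le_opNorm _ _).trans ?_
          gcongr
          exact ContinuousLinearMap.le_opNorm _ _)
    _ ≤ 1 * (κ * (2 * 1)) := by gcongr; exact hφ i
    _ = 2 * κ := by ring

theorem norm_redMatrix_le (hφ : ∀ i, ‖φ i‖ ≤ 1) (hδ : ∀ i, ‖δ i‖ ≤ 1) {κ : ℝ} (h1 : 1 ≤ κ)
    (hκ : ‖K‖ ≤ κ) (hK : ‖K - finRank φ δ * K‖ ≤ 1 / 2) [Nontrivial E] (i j : J) :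
    ‖redMatrix φ δ K i j‖ ≤ 3 * κ := by
  have h := norm_fredholm_entry_le hφ hκ hK (hδ j) i
  have h2 : ‖(1 : Matrix J J ℂ) i j‖ ≤ 1 := by
    rw [Matrix.one_apply]; split_ifs <;> simp
  calc ‖redMatrix φ δ K i j‖ ≤ ‖(1 : Matrix J J ℂ) i j‖ + ‖φ i (K (tailInv φ δ K (δ j)))‖ :=
        norm_sub_le _ _
    _ ≤ 3 * κ := by linarith

theorem norm_fredholmDet_le (hφ : ∀ i, ‖φ i‖ ≤ 1) (hδ : ∀ i, ‖δ i‖ ≤ 1) {κ : ℝ} (h1 : 1 ≤ κ)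
    (hκ : ‖K‖ ≤ κ) (hK : ‖K - finRank φ δ * K‖ ≤ 1 / 2) [Nontrivial E] :
    ‖fredholmDet φ δ K‖ ≤ (Fintype.card J).factorial * (3 * κ) ^ Fintype.card J :=
  norm_det_le (norm_redMatrix_le hφ hδ h1 hκ hK)

theorem norm_fredholmNum_le (hφ : ∀ i, ‖φ i‖ ≤ 1) (hδ : ∀ i, ‖δ i‖ ≤ 1) {κ : ℝ} (h1 : 1 ≤ κ)
    (hκ : ‖K‖ ≤ κ) (hK : ‖K - finRank φ δ * K‖ ≤ 1 / 2) [Nontrivial E] {c : E} (hc : ‖c‖ ≤ 1) :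
    ‖fredholmNum φ δ K c‖ ≤ 4 * κ * ((Fintype.card J) ^ 2 + 1) *
      ((Fintype.card J).factorial * (3 * κ) ^ Fintype.card J) := by
  set p := Fintype.card J
  set Δ : ℝ := p.factorial * (3 * κ) ^ p with hΔ
  have hΔ0 : 0 ≤ Δ := by positivity
  have hS : ‖tailInv φ δ K‖ ≤ 2 := norm_inverse_one_sub_le hK
  have hSx : ∀ {x : E}, ‖x‖ ≤ 1 → ‖tailInv φ δ K x‖ ≤ 2 := fun {x} hx => by
    refine (ContinuousLinearMap.le_opNorm _ _).trans ?_
    nlinarith [norm_nonneg x, norm_nonneg (tailInv φ δ K)]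
  have hd : ‖fredholmDet φ δ K‖ ≤ Δ := norm_fredholmDet_le hφ hδ h1 hκ hK
  have hw : ∀ j, ‖((redMatrix φ δ K).adjugate *ᵥ fun i => φ i (K (tailInv φ δ K c))) j‖ ≤
      p * (Δ * (2 * κ)) := fun j => by
    refine (norm_sum_le _ _).trans ((Finset.sum_le_card_nsmul _ _ (Δ * (2 * κ)) ?_).trans ?_)
    · intro i _
      rw [norm_mul]
      gcongr
      · exact norm_adjugate_le (by linarith) (norm_redMatrix_le hφ hδ h1 hκ hK) j i
      · exact norm_fredholm_entry_le hφ hκ hK hc i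
    · simp [p]
  have hsum : ‖∑ j, ((redMatrix φ δ K).adjugate *ᵥ fun i => φ i (K (tailInv φ δ K c))) j •
      tailInv φ δ K (δ j)‖ ≤ p * (p * (Δ * (2 * κ)) * 2) := by
    refine (norm_sum_le _ _).trans
      ((Finset.sum_le_card_nsmul _ _ (p * (Δ * (2 * κ)) * 2) ?_).trans ?_)
    · intro j _
      rw [norm_smul]
      gcongr
      · exact hw j
      · exact hSx (hδ j)
    · simp [p]
  have hfirst : ‖fredholmDet φ δ K • tailInv φ δ K c‖ ≤ Δ * 2 := by
    rw [norm_smul]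
    gcongr
    exact hSx hc
  refine (norm_add_le _ _).trans ((add_le_add hfirst hsum).trans ?_)
  nlinarith [mul_nonneg hΔ0 (by linarith : (0:ℝ) ≤ κ - 1)]

theorem one_le_of_leftInverse (hφ : ∀ i, ‖φ i‖ ≤ 1) (hδ : ∀ i, ‖δ i‖ ≤ 1)
    (hφδ : ∀ i j, φ i (δ j) = if i = j then 1 else 0)
    (hK : ‖K - finRank φ δ * K‖ ≤ 1 / 2) [Nontrivial E]
    {T : E →L[ℂ] E} (hT : T * (1 - K) = 1) {ℓ : ℝ} (hℓ : ‖T‖ ≤ ℓ) :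
    1 ≤ (Fintype.card J).factorial * (2 * ℓ) ^ Fintype.card J * ‖fredholmDet φ δ K‖ := by
  set W := (1 - (K - finRank φ δ * K)) * T with hW
  have hWn : ‖W‖ ≤ 2 * ℓ := by
    refine (norm_mul_le _ _).trans ?_
    have : ‖(1 : E →L[ℂ] E) - (K - finRank φ δ * K)‖ ≤ 2 := by
      refine (norm_sub_le _ _).trans ?_
      rw [norm_one]; linarith
    gcongr
  have hW1 : W * (1 - finRank φ δ * K * tailInv φ δ K) = 1 := by
    rw [← one_sub_mul_tailInv hK, hW, mul_assoc, ← mul_assoc T, hT, one_mul,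
      tail_mul_tailInv hK]
  let B : Matrix J J ℂ := Matrix.of fun k i => φ k (W (δ i))
  have hB : B * redMatrix φ δ K = 1 := by
    ext k j
    have h := congrArg (φ k) (DFunLike.congr_fun hW1 (δ j))
    have hj : (1 - finRank φ δ * K * tailInv φ δ K) (δ j) =
        ∑ i, redMatrix φ δ K i j • δ i := by
      simp [redMatrix, finRank_apply, sub_smul, Finset.sum_sub_distrib, Matrix.one_apply]
    have hj2 : W ((1 - finRank φ δ * K * tailInv φ δ K) (δ j)) = δ j :=
      DFunLike.congr_fun hW1 (δ j)
    rw [hj] at hj2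
    have := congrArg (φ k) hj2
    simp only [map_sum, map_smul, hφδ] at this
    rw [Matrix.mul_apply, Matrix.one_apply, ← this]
    exact Finset.sum_congr rfl fun i _ => by simp [B, mul_comm]
  have hdet : B.det * fredholmDet φ δ K = 1 := by
    rw [fredholmDet, ← Matrix.det_mul, hB, Matrix.det_one]
  have hBn : ‖B.det‖ ≤ (Fintype.card J).factorial * (2 * ℓ) ^ Fintype.card J := by
    refine norm_det_le fun k i => ?_
    calc ‖φ k (W (δ i))‖ ≤ ‖φ k‖ * (‖W‖ * ‖δ i‖) :=
          (ContinuousLinearMap.le_opNorm _ _).trans (by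
            gcongr; exact ContinuousLinearMap.le_opNorm _ _)
      _ ≤ 1 * ((2 * ℓ) * 1) := by
          have : 0 ≤ 2 * ℓ := (norm_nonneg _).trans hWn
          gcongr
          · exact hφ k
          · exact hδ i
      _ = 2 * ℓ := by ring
  calc (1 : ℝ) = ‖B.det * fredholmDet φ δ K‖ := by rw [hdet, norm_one]
    _ ≤ _ := by rw [norm_mul]; gcongr

section Analytic

variable {V : Type*} [NormedAddCommGroup V] [NormedSpace ℂ V]
  {K : V → E →L[ℂ] E} {z : V}

theorem analyticAt_clm_apply {F : Type*} [NormedAddCommGroup F] [NormedSpace ℂ F]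
    {T : V → E →L[ℂ] F} (hT : AnalyticAt ℂ T z) (x : E) :
    AnalyticAt ℂ (fun w => T w x) z :=
  ((ContinuousLinearMap.apply ℂ F x).analyticAt _).comp hT

theorem analyticAt_tailInv (hA : AnalyticAt ℂ K z)
    (hK : ‖K z - finRank φ δ * K z‖ ≤ 1 / 2) :
    AnalyticAt ℂ (fun w => tailInv φ δ (K w)) z := by
  have h1 : AnalyticAt ℂ (fun w => 1 - (K w - finRank φ δ * K w)) z :=
    analyticAt_const.sub (hA.sub (analyticAt_const.mul hA))
  exact (analyticOnNhd_inverse (𝕜 := ℂ) _ (isUnit_one_sub hK)).comp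
    (f := fun w => 1 - (K w - finRank φ δ * K w)) h1

theorem analyticAt_redMatrix (hA : AnalyticAt ℂ K z)
    (hK : ‖K z - finRank φ δ * K z‖ ≤ 1 / 2) (i j : J) :
    AnalyticAt ℂ (fun w => redMatrix φ δ (K w) i j) z := by
  have h := analyticAt_clm_apply (hA.mul (analyticAt_tailInv hA hK)) (δ j)
  exact analyticAt_const.sub (((φ i).analyticAt _).comp h)

theorem analyticAt_fredholmDet (hA : AnalyticAt ℂ K z)
    (hK : ‖K z - finRank φ δ * K z‖ ≤ 1 / 2) :
    AnalyticAt ℂ (fun w => fredholmDet φ δ (K w)) z :=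
  analyticAt_det (analyticAt_redMatrix hA hK)

theorem analyticAt_fredholmNum (hA : AnalyticAt ℂ K z)
    (hK : ‖K z - finRank φ δ * K z‖ ≤ 1 / 2) (c : E) :
    AnalyticAt ℂ (fun w => fredholmNum φ δ (K w) c) z := by
  have hS := analyticAt_tailInv hA hK
  refine ((analyticAt_fredholmDet hA hK).smul (analyticAt_clm_apply hS c)).add
    (Finset.analyticAt_fun_sum _ fun j _ => AnalyticAt.smul ?_ (analyticAt_clm_apply hS _))
  refine Finset.analyticAt_fun_sum _ fun i _ => AnalyticAt.mul ?_ ?_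
  · exact analyticAt_adjugate (analyticAt_redMatrix hA hK) j i
  · exact ((φ i).analyticAt _).comp (analyticAt_clm_apply (hA.mul hS) c)

end Analytic

end Lemniscate

namespace Lemniscate

open Matrix

/-- The space of absolutely summable two-component Fourier series. -/
abbrev LoopSpace : Type := lp (fun _ : ℤ × Fin 2 => ℂ) 1

/-- Bounded operators on the loop space. -/
abbrev LoopOp : Type := LoopSpace →L[ℂ] LoopSpace

namespace LoopSpace

theorem summable_norm (f : LoopSpace) : Summable fun i => ‖f i‖ := by
  have := (memℓp_gen_iff (p := 1) (by norm_num)).1 (lp.memℓp f)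
  simpa using this

theorem norm_eq (f : LoopSpace) : ‖f‖ = ∑' i, ‖f i‖ := by
  rw [lp.norm_eq_tsum_rpow (by norm_num)]
  simp

theorem add_apply (f g : LoopSpace) (i : ℤ × Fin 2) : (f + g) i = f i + g i := rfl

theorem sub_apply (f g : LoopSpace) (i : ℤ × Fin 2) : (f - g) i = f i - g i := rfl

theorem smul_apply (c : ℂ) (f : LoopSpace) (i : ℤ × Fin 2) : (c • f) i = c * f i := rfl

theorem sum_apply {ι : Type*} (I : Finset ι) (f : ι → LoopSpace) (i : ℤ × Fin 2) :
    (∑ k ∈ I, f k) i = ∑ k ∈ I, f k i := by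
  rw [lp.coeFn_sum, Finset.sum_apply]

end LoopSpace

theorem loop_summable_wop (w : ℤ × Fin 2 → ℂ) (hw : ∀ i, ‖w i‖ ≤ 1) (σ : Equiv.Perm (ℤ × Fin 2))
    (f : LoopSpace) : Summable fun i => ‖w i * f (σ i)‖ := by
  refine Summable.of_nonneg_of_le (fun _ => norm_nonneg _) (fun i => ?_)
    ((Equiv.summable_iff σ).2 f.summable_norm)
  rw [norm_mul]
  exact mul_le_of_le_one_left (norm_nonneg _) (hw i)

/-- The weighted permutation operator `f ↦ w · (f ∘ σ)`. -/
noncomputable def wop (w : ℤ × Fin 2 → ℂ) (hw : ∀ i, ‖w i‖ ≤ 1) (σ : Equiv.Perm (ℤ × Fin 2)) :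
    LoopOp :=
  LinearMap.mkContinuous
    { toFun := fun f => ⟨fun i => w i * f (σ i), memℓp_gen (by
        simpa using loop_summable_wop w hw σ f)⟩
      map_add' := fun f g => by
        ext i
        exact mul_add _ _ _
      map_smul' := fun c f => by
        ext i
        exact mul_left_comm _ _ _ } 1 fun f => by
    rw [one_mul, LoopSpace.norm_eq, LoopSpace.norm_eq, ← Equiv.tsum_eq σ fun i => ‖f i‖]
    refine Summable.tsum_le_tsum (fun i => ?_) (loop_summable_wop w hw σ f)
      ((Equiv.summable_iff σ).2 f.summable_norm)
    simp only [LinearMap.coe_mk, AddHom.coe_mk, norm_mul]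
    exact mul_le_of_le_one_left (norm_nonneg _) (hw i)

@[simp]
theorem wop_apply (w : ℤ × Fin 2 → ℂ) (hw : ∀ i, ‖w i‖ ≤ 1) (σ : Equiv.Perm (ℤ × Fin 2))
    (f : LoopSpace) (i : ℤ × Fin 2) : wop w hw σ f i = w i * f (σ i) := rfl

theorem norm_wop_le (w : ℤ × Fin 2 → ℂ) (hw : ∀ i, ‖w i‖ ≤ 1) (σ : Equiv.Perm (ℤ × Fin 2)) :
    ‖wop w hw σ‖ ≤ 1 :=
  LinearMap.mkContinuous_norm_le _ zero_le_one _

/-- The restriction operator to the indices satisfying `p`. -/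
noncomputable def cut (p : ℤ → Prop) [DecidablePred p] : LoopOp :=
  wop (fun i => if p i.1 then 1 else 0) (fun i => by split_ifs <;> simp) 1

@[simp]
theorem cut_apply (p : ℤ → Prop) [DecidablePred p] (f : LoopSpace) (i : ℤ × Fin 2) :
    cut p f i = if p i.1 then f i else 0 := by
  simp [cut]

theorem norm_cut_le (p : ℤ → Prop) [DecidablePred p] : ‖cut p‖ ≤ 1 := norm_wop_le _ _ _

/-- The projection onto nonnegative frequencies. -/
noncomputable def projPos : LoopOp := cut fun j => 0 ≤ j

/-- The projection onto negative frequencies. -/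
noncomputable def projNeg : LoopOp := cut fun j => j < 0

@[simp]
theorem projPos_apply (f : LoopSpace) (i : ℤ × Fin 2) :
    projPos f i = if 0 ≤ i.1 then f i else 0 := cut_apply _ _ _

@[simp]
theorem projNeg_apply (f : LoopSpace) (i : ℤ × Fin 2) :
    projNeg f i = if i.1 < 0 then f i else 0 := cut_apply _ _ _

theorem norm_projPos_le : ‖projPos‖ ≤ 1 := norm_cut_le _

theorem norm_projNeg_le : ‖projNeg‖ ≤ 1 := norm_cut_le _

theorem loopOp_ext {S T : LoopOp} (h : ∀ f i, S f i = T f i) : S = T := by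
  ext f i
  exact h f i

theorem projPos_add_projNeg : projPos + projNeg = 1 := by
  refine loopOp_ext fun f i => ?_
  by_cases h : 0 ≤ i.1
  · simp [h, not_lt.2 h]
  · simp [h, not_le.1 h]

theorem projPos_mul_self : projPos * projPos = projPos :=
  loopOp_ext fun f i => by simp +contextual

theorem projNeg_mul_self : projNeg * projNeg = projNeg :=
  loopOp_ext fun f i => by simp +contextual

theorem projPos_mul_projNeg : projPos * projNeg = 0 :=
  loopOp_ext fun f i => by
    simp only [mul_apply_eq_comp, projPos_apply, projNeg_apply]
    split_ifs <;> first | rfl | omega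

theorem projNeg_mul_projPos : projNeg * projPos = 0 :=
  loopOp_ext fun f i => by
    simp only [mul_apply_eq_comp, projPos_apply, projNeg_apply]
    split_ifs <;> first | rfl | omega

/-- The shift by `k`, i.e. multiplication by `u ^ k`. -/
noncomputable def shift (k : ℤ) : LoopOp :=
  wop 1 (by simp) ((Equiv.subRight k).prodCongr (Equiv.refl _))

@[simp]
theorem shift_apply (k : ℤ) (f : LoopSpace) (j : ℤ) (a : Fin 2) :
    shift k f (j, a) = f (j - k, a) := by
  simp [shift]

theorem norm_shift_le (k : ℤ) : ‖shift k‖ ≤ 1 := norm_wop_le _ _ _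

theorem shift_mul_shift (k l : ℤ) : shift k * shift l = shift (k + l) :=
  loopOp_ext fun f ⟨j, a⟩ => by simp [sub_sub]

theorem shift_zero : shift 0 = 1 :=
  loopOp_ext fun f ⟨j, a⟩ => by simp

theorem commute_shift_shift (k l : ℤ) : Commute (shift k) (shift l) := by
  rw [Commute, SemiconjBy, shift_mul_shift, shift_mul_shift, add_comm]

/-- The operator sending the `b`-th component to the `a`-th one. -/
noncomputable def elemOp (a b : Fin 2) : LoopOp :=
  wop (fun i => if i.2 = a then 1 else 0) (fun i => by split_ifs <;> simp)
    ((Equiv.refl _).prodCongr (Equiv.swap a b))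

/-- Pointwise multiplication by a constant matrix. -/
noncomputable def matOp (A : Matrix (Fin 2) (Fin 2) ℂ) : LoopOp := ∑ a, ∑ b, A a b • elemOp a b

@[simp]
theorem matOp_apply (A : Matrix (Fin 2) (Fin 2) ℂ) (f : LoopSpace) (j : ℤ) (a : Fin 2) :
    matOp A f (j, a) = ∑ b, A a b * f (j, b) := by
  fin_cases a <;> simp [matOp, elemOp, Fin.sum_univ_two, LoopSpace.add_apply, LoopSpace.smul_apply]

theorem commute_shift_matOp (k : ℤ) (A : Matrix (Fin 2) (Fin 2) ℂ) :
    Commute (shift k) (matOp A) :=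
  loopOp_ext fun f ⟨j, a⟩ => by simp

/-- The basis vector of frequency `j` and component `a`. -/
noncomputable def basisVec (j : ℤ) (a : Fin 2) : LoopSpace := lp.single 1 (j, a) 1

theorem basisVec_apply (j : ℤ) (a : Fin 2) (k : ℤ) (b : Fin 2) :
    basisVec j a (k, b) = if k = j ∧ b = a then 1 else 0 := by
  by_cases h : k = j ∧ b = a
  · obtain ⟨rfl, rfl⟩ := h
    simp [basisVec]
  · rw [if_neg h, basisVec, lp.single_apply, Pi.single_eq_of_ne]
    simpa [Prod.ext_iff] using h

theorem norm_basisVec (j : ℤ) (a : Fin 2) : ‖basisVec j a‖ = 1 := by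
  rw [basisVec, lp.norm_single (by norm_num), norm_one]

instance : Nontrivial LoopSpace :=
  ⟨basisVec 0 0, 0, fun h => by simpa [h] using norm_basisVec 0 0⟩

/-- The coordinate functional. -/
noncomputable def coordFn (i : ℤ × Fin 2) : LoopSpace →L[ℂ] ℂ :=
  lp.evalCLM ℂ (fun _ : ℤ × Fin 2 => ℂ) 1 i

@[simp]
theorem coordFn_apply (i : ℤ × Fin 2) (f : LoopSpace) : coordFn i f = f i := rfl

theorem norm_coordFn_le (i : ℤ × Fin 2) : ‖coordFn i‖ ≤ 1 :=
  ContinuousLinearMap.opNorm_le_bound _ zero_le_one fun f => by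
    simpa using lp.norm_apply_le_norm one_ne_zero f i

/-- `T` lowers the smallest frequency by at most `s`. -/
def LowersBy (s : ℤ) (T : LoopOp) : Prop :=
  ∀ (p : ℤ) (f : LoopSpace), (∀ j < p, ∀ a, f (j, a) = 0) → ∀ j < p - s, ∀ a, T f (j, a) = 0

/-- `T` raises the largest frequency by at most `s`. -/
def RaisesBy (s : ℤ) (T : LoopOp) : Prop :=
  ∀ (p : ℤ) (f : LoopSpace), (∀ j, p ≤ j → ∀ a, f (j, a) = 0) →
    ∀ j, p + s ≤ j → ∀ a, T f (j, a) = 0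

namespace LowersBy

variable {s t : ℤ} {S T : LoopOp}

theorem mono (h : LowersBy s T) (hst : s ≤ t) : LowersBy t T :=
  fun p f hf j hj a => h p f hf j (by omega) a

theorem zero : LowersBy s 0 := fun p f hf j hj a => by simp

theorem one : LowersBy 0 1 := fun p f hf j hj a => by simpa using hf j (by omega) a

theorem mul (hS : LowersBy s S) (hT : LowersBy t T) : LowersBy (s + t) (S * T) :=
  fun p f hf j hj a => hS (p - t) (T f) (hT p f hf) j (by omega) a

theorem add (hS : LowersBy s S) (hT : LowersBy s T) : LowersBy s (S + T) :=
  fun p f hf j hj a => by simp [hS p f hf j hj a, hT p f hf j hj a]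

theorem smul (c : ℂ) (hT : LowersBy s T) : LowersBy s (c • T) :=
  fun p f hf j hj a => by simp [hT p f hf j hj a]

theorem sum {ι : Type*} (I : Finset ι) {T : ι → LoopOp} (h : ∀ i ∈ I, LowersBy s (T i)) :
    LowersBy s (∑ i ∈ I, T i) := by
  classical
  induction I using Finset.induction_on with
  | empty => simpa using zero
  | insert i I hi ih =>
    rw [Finset.sum_insert hi]
    exact (h i (by simp)).add (ih fun k hk => h k (by simp [hk]))

theorem pow (h : LowersBy s T) (k : ℕ) : LowersBy (k * s) (T ^ k) := by
  induction k with
  | zero => simpa using one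
  | succ k ih =>
    rw [pow_succ]
    convert! ih.mul h using 1
    push_cast; ring

theorem shift (k : ℤ) : LowersBy (-k) (shift k) := fun p f hf j hj a => by
  simpa using hf _ (by omega) a

theorem matOp (A : Matrix (Fin 2) (Fin 2) ℂ) : LowersBy 0 (matOp A) := fun p f hf j hj a => by
  simp [hf j (by omega)]

theorem projNeg_mul_mul_projPos (h : LowersBy 0 T) : projNeg * T * projPos = 0 :=
  loopOp_ext fun f ⟨j, a⟩ => by
    simp only [mul_apply_eq_comp, projNeg_apply, _root_.zero_apply]
    split_ifs with hj
    · exact h 0 _ (fun j hj a => by simp [not_le.2 hj]) j (by simpa using hj) a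
    · rfl

end LowersBy

namespace RaisesBy

variable {s t : ℤ} {S T : LoopOp}

theorem mono (h : RaisesBy s T) (hst : s ≤ t) : RaisesBy t T :=
  fun p f hf j hj a => h p f hf j (by omega) a

theorem zero : RaisesBy s 0 := fun p f hf j hj a => by simp

theorem one : RaisesBy 0 1 := fun p f hf j hj a => by simpa using hf j (by omega) a

theorem mul (hS : RaisesBy s S) (hT : RaisesBy t T) : RaisesBy (s + t) (S * T) :=
  fun p f hf j hj a => hS (p + t) (T f) (hT p f hf) j (by omega) a

theorem add (hS : RaisesBy s S) (hT : RaisesBy s T) : RaisesBy s (S + T) :=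
  fun p f hf j hj a => by simp [hS p f hf j hj a, hT p f hf j hj a]

theorem smul (c : ℂ) (hT : RaisesBy s T) : RaisesBy s (c • T) :=
  fun p f hf j hj a => by simp [hT p f hf j hj a]

theorem pow (h : RaisesBy s T) (k : ℕ) : RaisesBy (k * s) (T ^ k) := by
  induction k with
  | zero => simpa using one
  | succ k ih =>
    rw [pow_succ]
    convert! ih.mul h using 1
    push_cast; ring

theorem hasSum {ι : Type*} {T : ι → LoopOp} {S : LoopOp} (hS : HasSum T S)
    (h : ∀ i, RaisesBy s (T i)) : RaisesBy s S := fun p f hf j hj a => by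
  have h1 : HasSum (fun i => T i f (j, a)) (S f (j, a)) :=
    hS.mapL ((coordFn (j, a)).comp (ContinuousLinearMap.apply ℂ LoopSpace f))
  refine h1.unique ?_
  simp only [fun i => h i p f hf j hj a]
  exact hasSum_zero

theorem shift (k : ℤ) : RaisesBy k (shift k) := fun p f hf j hj a => by
  simpa using hf _ (by omega) a

theorem matOp (A : Matrix (Fin 2) (Fin 2) ℂ) : RaisesBy 0 (matOp A) := fun p f hf j hj a => by
  simp [hf j (by omega)]

theorem exp_sub_one (h : RaisesBy (-1) T) : RaisesBy (-1) (NormedSpace.exp T - 1) := by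
  have h0 : HasSum (fun k : ℕ => if k = 0 then (1 : LoopOp) else 0) 1 := hasSum_ite_eq 0 1
  refine hasSum ((NormedSpace.exp_series_hasSum_exp' (𝕂 := ℂ) T).sub h0) fun k => ?_
  rcases k with _ | k
  · simpa using zero
  · simpa using smul _ ((h.pow (k + 1)).mono (by push_cast; omega))

theorem projPos_mul_mul_projNeg (h : RaisesBy 0 T) : projPos * T * projNeg = 0 :=
  loopOp_ext fun f ⟨j, a⟩ => by
    simp only [mul_apply_eq_comp, projPos_apply, _root_.zero_apply]
    split_ifs with hj
    · exact h 0 _ (fun j hj a => by simp [not_lt.2 hj]) j (by simpa using hj) a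
    · rfl

end RaisesBy

end Lemniscate

namespace Lemniscate

open Matrix

section ExpTail

variable {A : Type*} [NormedRing A] [NormedAlgebra ℂ A] [CompleteSpace A] [NormOneClass A]

theorem norm_exp_le (x : A) : ‖NormedSpace.exp x‖ ≤ Real.exp ‖x‖ := by
  have h := NormedSpace.exp_series_hasSum_exp' (𝕂 := ℂ) x
  have h2 : HasSum (fun n : ℕ => ‖x‖ ^ n / n.factorial) (Real.exp ‖x‖) := by
    have := NormedSpace.expSeries_div_hasSum_exp ‖x‖
    rwa [← Real.exp_eq_exp_ℝ] at this
  rw [← h.tsum_eq]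
  refine tsum_of_norm_bounded h2 fun n => ?_
  rw [norm_smul, norm_inv, div_eq_inv_mul, RCLike.norm_natCast]
  gcongr
  exact norm_pow_le x n

/-- If the first terms of the exponential series are killed by a compression, the compression of
the exponential is as small as the tail of the series. -/
theorem norm_mul_exp_mul_le {x S T : A} (hS : ‖S‖ ≤ 1) (hT : ‖T‖ ≤ 1) {ρ : ℝ} (hx : ‖x‖ ≤ ρ)
    {k₀ : ℕ} (h0 : ∀ k ≤ k₀, S * x ^ k * T = 0) :
    ‖S * NormedSpace.exp x * T‖ ≤ Real.exp (Real.exp 1 * ρ - k₀) := by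
  have hρ : 0 ≤ ρ := (norm_nonneg x).trans hx
  have h := ((NormedSpace.exp_series_hasSum_exp' (𝕂 := ℂ) x).mul_left S).mul_right T
  have h2 : HasSum (fun n : ℕ => Real.exp (-k₀) * ((Real.exp 1 * ρ) ^ n / n.factorial))
      (Real.exp (-k₀) * Real.exp (Real.exp 1 * ρ)) := by
    have := NormedSpace.expSeries_div_hasSum_exp (Real.exp 1 * ρ)
    rw [← Real.exp_eq_exp_ℝ] at this
    exact this.mul_left _
  rw [← h.tsum_eq, show Real.exp 1 * ρ - k₀ = -k₀ + Real.exp 1 * ρ by ring, Real.exp_add]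
  refine tsum_of_norm_bounded h2 fun n => ?_
  rcases le_or_gt n k₀ with hn | hn
  · rw [mul_smul_comm, smul_mul_assoc, h0 n hn, smul_zero, norm_zero]
    positivity
  · have h1 : ‖S * x ^ n * T‖ ≤ ρ ^ n := by
      calc ‖S * x ^ n * T‖ ≤ ‖S‖ * ‖x‖ ^ n * ‖T‖ := by
            refine (norm_mul_le _ _).trans ?_
            gcongr
            refine (norm_mul_le _ _).trans ?_
            gcongr
            exact norm_pow_le x n
        _ ≤ 1 * ρ ^ n * 1 := by gcongr
        _ = ρ ^ n := by ring
    rw [mul_smul_comm, smul_mul_assoc, norm_smul, norm_inv, RCLike.norm_natCast, mul_pow,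
      ← Real.exp_nat_mul, mul_one]
    have h3 : 1 ≤ Real.exp (-k₀) * Real.exp n := by
      rw [← Real.exp_add]
      apply Real.one_le_exp
      have : (k₀ : ℝ) ≤ n := by exact_mod_cast hn.le
      linarith
    calc (n.factorial : ℝ)⁻¹ * ‖S * x ^ n * T‖ ≤ (n.factorial : ℝ)⁻¹ * ρ ^ n := by gcongr
      _ ≤ (Real.exp (-k₀) * Real.exp n) * ((n.factorial : ℝ)⁻¹ * ρ ^ n) :=
          le_mul_of_one_le_left (by positivity) h3
      _ = _ := by ring

end ExpTail

variable (d : ℕ) (B C : Matrix (Fin 2) (Fin 2) ℂ)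

/-- Multiplication by the matrix polynomial `u ^ (d + 1) B + C`. -/
noncomputable def laxOp : LoopOp := shift (d + 1) * matOp B + matOp C

/-- The generators of the commuting flows. -/
noncomputable def flowGen (l : Fin d) : LoopOp := shift (-(l + 1)) * laxOp d B C

/-- The generator of the flow with times `z`. -/
noncomputable def flowSum (z : Fin d → ℂ) : LoopOp := ∑ l, z l • flowGen d B C l

/-- The flow with times `z`. -/
noncomputable def flow (z : Fin d → ℂ) : LoopOp := NormedSpace.exp (flowSum d B C z)

/-- The operator of the factorization problem attached to the flow. -/
noncomputable def hankelOp (z : Fin d → ℂ) : LoopOp :=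
  projNeg * flow d B C (-z) * projPos * flow d B C z

/-- Operators commuting with all shifts and with `laxOp`. -/
def IsLoopCommutant (T : LoopOp) : Prop := (∀ k, Commute (shift k) T) ∧ Commute (laxOp d B C) T

variable {d B C}

theorem IsLoopCommutant.commute_flowGen {T : LoopOp} (h : IsLoopCommutant d B C T) (l : Fin d) :
    Commute (flowGen d B C l) T := (h.1 _).mul_left h.2

theorem IsLoopCommutant.commute_flowSum {T : LoopOp} (h : IsLoopCommutant d B C T)
    (z : Fin d → ℂ) : Commute (flowSum d B C z) T :=
  Commute.sum_left _ _ _ fun l _ => (h.commute_flowGen l).smul_left _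

theorem IsLoopCommutant.commute_flow {T : LoopOp} (h : IsLoopCommutant d B C T)
    (z : Fin d → ℂ) : Commute (flow d B C z) T := (h.commute_flowSum z).exp_left

theorem IsLoopCommutant.exp {T : LoopOp} (h : IsLoopCommutant d B C T) :
    IsLoopCommutant d B C (NormedSpace.exp T) := ⟨fun k => (h.1 k).exp_right, h.2.exp_right⟩

theorem IsLoopCommutant.mul {S T : LoopOp} (hS : IsLoopCommutant d B C S)
    (hT : IsLoopCommutant d B C T) : IsLoopCommutant d B C (S * T) :=
  ⟨fun k => (hS.1 k).mul_right (hT.1 k), hS.2.mul_right hT.2⟩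

theorem IsLoopCommutant.smul {T : LoopOp} (h : IsLoopCommutant d B C T) (c : ℂ) :
    IsLoopCommutant d B C (c • T) := ⟨fun k => (h.1 k).smul_right c, h.2.smul_right c⟩

theorem commute_shift_laxOp (k : ℤ) : Commute (shift k) (laxOp d B C) :=
  ((commute_shift_shift _ _).mul_right (commute_shift_matOp _ _)).add_right
    (commute_shift_matOp _ _)

theorem isLoopCommutant_shift (k : ℤ) : IsLoopCommutant d B C (shift k) :=
  ⟨fun l => commute_shift_shift l k, (commute_shift_laxOp k).symm⟩

theorem isLoopCommutant_laxOp : IsLoopCommutant d B C (laxOp d B C) :=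
  ⟨commute_shift_laxOp, Commute.refl _⟩

theorem isLoopCommutant_flowSum (z : Fin d → ℂ) : IsLoopCommutant d B C (flowSum d B C z) :=
  ⟨fun k => ((isLoopCommutant_shift k).commute_flowSum z).symm,
    (isLoopCommutant_laxOp.commute_flowSum z).symm⟩

theorem flowSum_add (z w : Fin d → ℂ) :
    flowSum d B C (z + w) = flowSum d B C z + flowSum d B C w := by
  simp [flowSum, add_smul, Finset.sum_add_distrib]

theorem flowSum_neg (z : Fin d → ℂ) : flowSum d B C (-z) = -flowSum d B C z := by
  simp [flowSum]

theorem flow_add (z w : Fin d → ℂ) : flow d B C (z + w) = flow d B C z * flow d B C w := by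
  let _ : NormedAlgebra ℚ LoopOp := NormedAlgebra.restrictScalars ℚ ℂ LoopOp
  rw [flow, flowSum_add]
  exact NormedSpace.exp_add_of_commute ((isLoopCommutant_flowSum w).commute_flowSum z)

theorem flow_zero : flow d B C 0 = 1 := by simp [flow, flowSum]

theorem flow_mul_flow_neg (z : Fin d → ℂ) : flow d B C z * flow d B C (-z) = 1 := by
  rw [← flow_add, add_neg_cancel, flow_zero]

theorem flow_neg_mul_flow (z : Fin d → ℂ) : flow d B C (-z) * flow d B C z = 1 := by
  rw [← flow_add, neg_add_cancel, flow_zero]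

theorem analyticAt_flow (z : Fin d → ℂ) : AnalyticAt ℂ (flow d B C) z := by
  have h1 : AnalyticAt ℂ (flowSum d B C) z := by
    refine Finset.analyticAt_fun_sum _ fun l _ => AnalyticAt.fun_smul ?_ analyticAt_const
    exact (ContinuousLinearMap.proj (R := ℂ) (φ := fun _ : Fin d => ℂ) l).analyticAt z
  exact (NormedSpace.exp_analytic (𝕂 := ℂ) (flowSum d B C z)).comp h1

theorem analyticAt_hankelOp (z : Fin d → ℂ) : AnalyticAt ℂ (hankelOp d B C) z := by
  have h : AnalyticAt ℂ (fun w => flow d B C (-w)) z :=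
    (analyticAt_flow (-z)).comp (f := fun w : Fin d → ℂ => -w) analyticAt_id.neg
  exact ((analyticAt_const.mul h).mul analyticAt_const).mul (analyticAt_flow z)

variable (d B C) in
/-- A Lipschitz constant for the generator of the flows. -/
noncomputable def flowBound : ℝ := ∑ l, ‖flowGen d B C l‖

theorem flowBound_nonneg : 0 ≤ flowBound d B C := Finset.sum_nonneg fun _ _ => norm_nonneg _

theorem norm_flowSum_le {z : Fin d → ℂ} {R : ℝ} (hz : ‖z‖ ≤ R) :
    ‖flowSum d B C z‖ ≤ flowBound d B C * R := by
  rw [flowBound, Finset.sum_mul]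
  refine (norm_sum_le _ _).trans (Finset.sum_le_sum fun l _ => ?_)
  rw [norm_smul, mul_comm]
  gcongr
  exact (norm_le_pi_norm z l).trans hz

theorem norm_flow_le {z : Fin d → ℂ} {R : ℝ} (hz : ‖z‖ ≤ R) :
    ‖flow d B C z‖ ≤ Real.exp (flowBound d B C * R) :=
  (norm_exp_le _).trans (Real.exp_le_exp.2 (norm_flowSum_le hz))

theorem norm_hankelOp_le {z : Fin d → ℂ} {R : ℝ} (hz : ‖z‖ ≤ R) :
    ‖hankelOp d B C z‖ ≤ Real.exp (2 * (flowBound d B C * R)) := by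
  calc ‖hankelOp d B C z‖
      ≤ ‖projNeg‖ * ‖flow d B C (-z)‖ * ‖projPos‖ * ‖flow d B C z‖ := by
        refine (norm_mul_le _ _).trans ?_
        gcongr
        refine (norm_mul_le _ _).trans ?_
        gcongr
        exact norm_mul_le _ _
    _ ≤ 1 * Real.exp (flowBound d B C * R) * 1 * Real.exp (flowBound d B C * R) := by
        gcongr
        · exact norm_projNeg_le
        · exact norm_flow_le (by simpa using hz)
        · exact norm_projPos_le
        · exact norm_flow_le hz
    _ = _ := by rw [two_mul, Real.exp_add]; ring

theorem LowersBy.laxOp : LowersBy 0 (laxOp d B C) :=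
  (((LowersBy.shift _).mul (LowersBy.matOp B)).mono (by omega)).add (LowersBy.matOp C)

theorem LowersBy.flowSum (z : Fin d → ℂ) : LowersBy d (flowSum d B C z) :=
  LowersBy.sum _ fun l _ => LowersBy.smul _
    (((LowersBy.shift _).mul LowersBy.laxOp).mono (by have := l.2; omega))

/-- The coordinates retained by the truncation. -/
noncomputable def truncFn (N : ℕ) (i : Fin N × Fin 2) : LoopSpace →L[ℂ] ℂ :=
  coordFn (-1 - i.1, i.2)

/-- The basis vectors retained by the truncation. -/
noncomputable def truncVec (N : ℕ) (i : Fin N × Fin 2) : LoopSpace := basisVec (-1 - i.1) i.2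

theorem truncFn_truncVec (N : ℕ) (i j : Fin N × Fin 2) :
    truncFn N i (truncVec N j) = if i = j then 1 else 0 := by
  rw [truncFn, truncVec, coordFn_apply, basisVec_apply]
  simp [Prod.ext_iff, Fin.ext_iff]

theorem finRank_trunc (N : ℕ) :
    finRank (truncFn N) (truncVec N) = cut fun j => -(N : ℤ) ≤ j ∧ j < 0 :=
  loopOp_ext fun f ⟨j, a⟩ => by
    rw [finRank_apply, LoopSpace.sum_apply, cut_apply]
    simp only [LoopSpace.smul_apply, truncFn, truncVec, coordFn_apply, basisVec_apply]
    split_ifs with h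
    · obtain ⟨s, hs⟩ : ∃ s : Fin N, j = -1 - s :=
        ⟨⟨(-1 - j).toNat, by omega⟩, by simp; omega⟩
      rw [Finset.sum_eq_single (s, a)]
      · simp [hs]
      · rintro ⟨t, b⟩ - hne
        rw [if_neg, mul_zero]
        rintro ⟨h1, h2⟩
        refine hne (Prod.ext (Fin.ext ?_) h2.symm)
        simp only at h1 ⊢
        omega
      · simp
    · refine Finset.sum_eq_zero fun i _ => ?_
      rw [if_neg, mul_zero]
      rintro ⟨h1, -⟩
      have := i.1.2
      omega

theorem hankelOp_sub_trunc (N : ℕ) (z : Fin d → ℂ) :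
    hankelOp d B C z - finRank (truncFn N) (truncVec N) * hankelOp d B C z =
      (cut fun j => j < -(N : ℤ)) * flow d B C (-z) * projPos * flow d B C z := by
  have : projNeg - finRank (truncFn N) (truncVec N) * projNeg = cut fun j => j < -(N : ℤ) := by
    rw [finRank_trunc]
    refine loopOp_ext fun f i => ?_
    simp only [_root_.sub_apply, LoopSpace.sub_apply, mul_apply_eq_comp, cut_apply, projNeg_apply]
    split_ifs <;> first | omega | simp
  rw [← this, hankelOp]
  noncomm_ring

variable (d B C) in
/-- The order of the truncation used on the ball of radius `R`. -/
noncomputable def truncOrder (R : ℝ) : ℕ := d * ⌈4 * (flowBound d B C * R) + 1⌉₊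

theorem norm_hankelOp_sub_trunc_le {z : Fin d → ℂ} {R : ℝ} (hz : ‖z‖ ≤ R) :
    ‖hankelOp d B C z - finRank (truncFn (truncOrder d B C R)) (truncVec (truncOrder d B C R)) *
      hankelOp d B C z‖ ≤ 1 / 2 := by
  rw [hankelOp_sub_trunc]
  set ρ := flowBound d B C * R
  have hρ : 0 ≤ ρ := mul_nonneg flowBound_nonneg ((norm_nonneg z).trans hz)
  set k₀ := ⌈4 * ρ + 1⌉₊
  have hk₀ : 4 * ρ + 1 ≤ k₀ := Nat.le_ceil _
  have hN : truncOrder d B C R = d * k₀ := rfl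
  rw [hN]
  have h1 : ‖(cut fun j => j < -((d * k₀ : ℕ) : ℤ)) * flow d B C (-z) * projPos‖ ≤
      Real.exp (Real.exp 1 * ρ - k₀) := by
    refine norm_mul_exp_mul_le (norm_cut_le _) norm_projPos_le
      (norm_flowSum_le (by simpa using hz)) fun k hk => loopOp_ext fun f ⟨j, a⟩ => ?_
    simp only [mul_apply_eq_comp, cut_apply, _root_.zero_apply]
    split_ifs with hj
    · refine (LowersBy.flowSum (B := B) (C := C) (-z)).pow k 0 _
        (fun j hj a => by simp [not_le.2 hj]) j ?_ a
      have : (k : ℤ) * d ≤ d * k₀ := by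
        rw [mul_comm]; gcongr
      push_cast at hj
      omega
    · rfl
  have h2 := norm_flow_le (B := B) (C := C) hz
  calc _ ≤ Real.exp (Real.exp 1 * ρ - k₀) * Real.exp ρ :=
        (norm_mul_le _ _).trans (by gcongr)
    _ = Real.exp (Real.exp 1 * ρ - k₀ + ρ) := (Real.exp_add _ _).symm
    _ ≤ Real.exp (-1) := by
        apply Real.exp_le_exp.2
        have : Real.exp 1 * ρ ≤ 3 * ρ := by
          gcongr
          exact Real.exp_one_lt_three.le
        linarith
    _ ≤ 1 / 2 := by
        rw [Real.exp_neg, one_div]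
        gcongr
        linarith [Real.add_one_le_exp (1 : ℝ)]

end Lemniscate

namespace Lemniscate

open Matrix Filter Topology

section Algebra

variable {A : Type*} [Ring A] {p q : A}

theorem corner_leftInverse (hpq : p + q = 1) (hqq : q * q = q) {a a' b b' : A}
    (ha : a' * a = 1) (hb : b * b' = 1) (hpa : p * a * q = 0) (hbp : q * b * p = 0) :
    q * a' * q * b * q * (q * (b' * a) * q) = q := by
  have h1 : q * a * q = a * q := by
    have : (p + q) * a * q = a * q := by rw [hpq, one_mul]
    rw [← this, add_mul, add_mul, hpa, zero_add]
  have h2 : q * b * q = q * b := by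
    have : q * b * (p + q) = q * b := by rw [hpq, mul_one]
    rwa [mul_add, hbp, zero_add] at this
  calc q * a' * q * b * q * (q * (b' * a) * q)
      = q * a' * (q * b * (q * q)) * b' * (a * q) := by simp only [mul_assoc]
    _ = q * a' * q * (b * b') * (a * q) := by rw [hqq, h2]; noncomm_ring
    _ = q * a' * (q * a * q) := by rw [hb]; noncomm_ring
    _ = q * (a' * a) * q := by rw [h1]; noncomm_ring
    _ = q := by rw [ha, mul_one, hqq]

theorem one_sub_corner (hpq : p + q = 1) {m m' : A} (hm : m' * m = 1) :
    1 - q * m' * p * m = p + q * m' * q * m := by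
  have hq : q = q * m' * (p + q) * m := by rw [hpq, mul_one, mul_assoc, hm, mul_one]
  rw [← hpq]
  nth_rewrite 1 [hq]
  noncomm_ring

theorem leftInverse_of_corner (hpq : p + q = 1) (hpp : p * p = p)
    (hp0 : p * q = 0) (hq0 : q * p = 0) {m m' v w : A} (hm : m' * m = 1)
    (hv : v * q * (q * m' * q) = q) (hw : w * (q * m * q) = q) :
    (p + w * (v * q - q * m * p)) * (1 - q * m' * p * m) = 1 := by
  rw [one_sub_corner hpq hm]
  calc (p + w * (v * q - q * m * p)) * (p + q * m' * q * m)
      = p * p + (p * q) * m' * q * m + w * v * (q * p) - w * q * m * (p * p) +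
        w * (v * q * (q * m' * q)) * m - w * q * m * (p * q) * m' * q * m := by noncomm_ring
    _ = p + w * (q * m * (p + q) - q * m * p) := by
        rw [hpp, hp0, hq0, hv, hpq]; noncomm_ring
    _ = p + w * (q * m * q) := by rw [mul_add, add_sub_cancel_left]
    _ = 1 := by rw [hw, hpq]

end Algebra

variable {d : ℕ} {B C : Matrix (Fin 2) (Fin 2) ℂ}

variable (d B C) in
/-- A triangular factorization of the flow at time `z`: `g` is a lower triangular unipotent
commuting operator with inverse `g'` such that `flow z * g` is invertible upper triangular. -/
structure Factorization (z : Fin d → ℂ) (g g' : LoopOp) : Prop where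
  commutant : IsLoopCommutant d B C g
  commutant_inv : IsLoopCommutant d B C g'
  mul_inv : g * g' = 1
  inv_mul : g' * g = 1
  lower : projPos * g * projNeg = 0
  lower_inv : projPos * g' * projNeg = 0
  normalized : ∀ a, projPos (g (basisVec 0 a)) = basisVec 0 a
  upper : projNeg * (flow d B C z * g) * projPos = 0
  upper_inv : projNeg * (g' * flow d B C (-z)) * projPos = 0

theorem projPos_basisVec (a : Fin 2) : projPos (basisVec 0 a) = basisVec 0 a := by
  ext ⟨j, b⟩
  rw [projPos_apply, basisVec_apply]
  split_ifs with h1 h2 h2 <;> first | rfl | (exfalso; simp_all)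

theorem mul_corner_zero {S T : LoopOp} (hS : projPos * S * projNeg = 0)
    (hT : projPos * T * projNeg = 0) : projPos * (S * T) * projNeg = 0 := by
  calc projPos * (S * T) * projNeg
      = projPos * S * (projPos + projNeg) * T * projNeg := by
        rw [projPos_add_projNeg]; noncomm_ring
    _ = projPos * S * (projPos * T * projNeg) + (projPos * S * projNeg) * T * projNeg := by
        noncomm_ring
    _ = 0 := by rw [hS, hT]; simp

theorem mul_corner_zero' {S T : LoopOp} (hS : projNeg * S * projPos = 0)
    (hT : projNeg * T * projPos = 0) : projNeg * (S * T) * projPos = 0 := by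
  calc projNeg * (S * T) * projPos
      = projNeg * S * (projPos + projNeg) * T * projPos := by
        rw [projPos_add_projNeg]; noncomm_ring
    _ = (projNeg * S * projPos) * T * projPos + projNeg * S * (projNeg * T * projPos) := by
        noncomm_ring
    _ = 0 := by rw [hS, hT]; simp

theorem eq_projPos_add_projNeg (x : LoopSpace) : x = projPos x + projNeg x := by
  have := DFunLike.congr_fun projPos_add_projNeg x
  simpa using this.symm

theorem Factorization.zero : Factorization d B C 0 1 1 where
  commutant := by simpa [shift_zero] using isLoopCommutant_shift (d := d) (B := B) (C := C) 0
  commutant_inv := by simpa [shift_zero] using isLoopCommutant_shift (d := d) (B := B) (C := C) 0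
  mul_inv := one_mul 1
  inv_mul := one_mul 1
  lower := by rw [mul_one, projPos_mul_projNeg]
  lower_inv := by rw [mul_one, projPos_mul_projNeg]
  normalized := projPos_basisVec
  upper := by rw [flow_zero, mul_one, mul_one, projNeg_mul_projPos]
  upper_inv := by rw [neg_zero, flow_zero, mul_one, mul_one, projNeg_mul_projPos]

theorem Factorization.add {z w : Fin d → ℂ} {g g' h h' : LoopOp}
    (hg : Factorization d B C z g g') (hh : Factorization d B C w h h') :
    Factorization d B C (z + w) (g * h) (h' * g') where
  commutant := hg.commutant.mul hh.commutant
  commutant_inv := hh.commutant_inv.mul hg.commutant_inv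
  mul_inv := by rw [mul_assoc, ← mul_assoc h, hh.mul_inv, one_mul, hg.mul_inv]
  inv_mul := by rw [mul_assoc, ← mul_assoc g', hg.inv_mul, one_mul, hh.inv_mul]
  lower := mul_corner_zero hg.lower hh.lower
  lower_inv := mul_corner_zero hh.lower_inv hg.lower_inv
  normalized a := by
    have h1 : h (basisVec 0 a) = basisVec 0 a + projNeg (h (basisVec 0 a)) := by
      conv_lhs => rw [eq_projPos_add_projNeg (h (basisVec 0 a)), hh.normalized]
    have h2 := DFunLike.congr_fun hg.lower (h (basisVec 0 a))
    simp only [mul_apply_eq_comp, _root_.zero_apply] at h2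
    rw [mul_apply_eq_comp, h1, map_add, map_add, hg.normalized, h2, add_zero]
  upper := by
    have : flow d B C (z + w) * (g * h) = (flow d B C z * g) * (flow d B C w * h) := by
      rw [flow_add, mul_assoc, ← mul_assoc (flow d B C w), (hg.commutant.commute_flow w).eq]
      noncomm_ring
    rw [this]
    exact mul_corner_zero' hg.upper hh.upper
  upper_inv := by
    have : h' * g' * flow d B C (-(z + w)) = (h' * flow d B C (-w)) * (g' * flow d B C (-z)) := by
      rw [neg_add_rev, flow_add, mul_assoc, ← mul_assoc g',
        ← (hg.commutant_inv.commute_flow (-w)).eq]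
      noncomm_ring
    rw [this]
    exact mul_corner_zero' hh.upper_inv hg.upper_inv

theorem Factorization.exists_gridPoint {e : Fin d → Fin d → ℂ}
    (he : ∀ j, ∃ g g', Factorization d B C (e j) g g') (m : Fin d → ℕ) :
    ∃ g g', Factorization d B C (gridPoint e m) g g' := by
  have hn : ∀ (j : Fin d) (n : ℕ), ∃ g g', Factorization d B C ((n : ℂ) • e j) g g' := by
    intro j n
    induction n with
    | zero => exact ⟨1, 1, by simpa using Factorization.zero⟩
    | succ n ih =>
      obtain ⟨g, g', hg⟩ := ih
      obtain ⟨h, h', hh⟩ := he j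
      refine ⟨g * h, h' * g', ?_⟩
      have := hg.add hh
      simpa [add_smul] using this
  have hs : ∀ I : Finset (Fin d), ∃ g g',
      Factorization d B C (∑ j ∈ I, (m j : ℂ) • e j) g g' := by
    intro I
    induction I using Finset.induction_on with
    | empty => exact ⟨1, 1, by simpa using Factorization.zero⟩
    | insert j I hj ih =>
      obtain ⟨g, g', hg⟩ := hn j (m j)
      obtain ⟨h, h', hh⟩ := ih
      exact ⟨g * h, h' * g', by rw [Finset.sum_insert hj]; exact hg.add hh⟩
  exact hs Finset.univ

section

variable {z : Fin d → ℂ} {g g' : LoopOp}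

theorem Factorization.corner_neg (h : Factorization d B C z g g') :
    projNeg * g' * projNeg * (flow d B C z * g) * projNeg *
      (projNeg * flow d B C (-z) * projNeg) = projNeg := by
  have key := corner_leftInverse (b' := g' * flow d B C (-z)) projPos_add_projNeg
    projNeg_mul_self h.inv_mul (by
      rw [mul_assoc, ← mul_assoc g, h.mul_inv, one_mul, flow_mul_flow_neg]) h.lower h.upper
  have h1 : g' * flow d B C (-z) * g = flow d B C (-z) := by
    rw [mul_assoc, (h.commutant.commute_flow (-z)).eq, ← mul_assoc, h.inv_mul, one_mul]
  rwa [h1] at key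

theorem Factorization.corner_pos (h : Factorization d B C z g g') :
    projNeg * g * projNeg * (g' * flow d B C (-z)) * projNeg *
      (projNeg * flow d B C z * projNeg) = projNeg := by
  have key := corner_leftInverse (b' := flow d B C z * g) projPos_add_projNeg
    projNeg_mul_self h.mul_inv (by
      rw [mul_assoc, ← mul_assoc (flow d B C (-z)), flow_neg_mul_flow, one_mul, h.inv_mul])
      h.lower_inv h.upper_inv
  rwa [mul_assoc (flow d B C z), h.mul_inv, mul_one] at key

theorem Factorization.exists_leftInverse (h : Factorization d B C z g g') :
    ∃ T : LoopOp, T * (1 - hankelOp d B C z) = 1 := by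
  have h1 := h.corner_neg
  have h2 := h.corner_pos
  exact ⟨_, leftInverse_of_corner projPos_add_projNeg projPos_mul_self projPos_mul_projNeg
    projNeg_mul_projPos (flow_neg_mul_flow z) h1 (w := projNeg * g * projNeg *
      (g' * flow d B C (-z)) * projNeg) h2⟩

/-- The factorization problem for the flow at time `z` has at most one solution. -/
def IsRegularTime (d : ℕ) (B C : Matrix (Fin 2) (Fin 2) ℂ) (z : Fin d → ℂ) : Prop :=
  ∀ x : LoopSpace, projPos x = 0 →
    (projNeg (flow d B C (-z) x) = 0 → x = 0) ∧ (projNeg (flow d B C z x) = 0 → x = 0)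

theorem eventually_corner_injective {F : (Fin d → ℂ) → LoopOp} {z : Fin d → ℂ}
    (hF : ContinuousAt F z) {V : LoopOp} (hV : V * projNeg * (projNeg * F z * projNeg) = projNeg) :
    ∀ᶠ w in 𝓝 z, ∀ x : LoopSpace, projPos x = 0 → projNeg (F w x) = 0 → x = 0 := by
  have h1 : ContinuousAt (fun w => projPos + V * projNeg * (projNeg * F w * projNeg)) z := by
    fun_prop
  have h2 : IsUnit (projPos + V * projNeg * (projNeg * F z * projNeg)) := by
    rw [hV, projPos_add_projNeg]; exact isUnit_one
  filter_upwards [h1.eventually_mem (Units.isOpen.mem_nhds h2)] with w hw x hx hx2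
  obtain ⟨u, hu⟩ := hw
  have hx' : projNeg x = x := by
    conv_rhs => rw [eq_projPos_add_projNeg x, hx, zero_add]
  have h3 : (u : LoopOp) x = 0 := by
    rw [hu]
    simp [hx, hx', hx2]
  have h4 : (↑u⁻¹ * (u : LoopOp)) x = x := by rw [Units.inv_mul]; rfl
  rw [← h4, mul_apply_eq_comp, h3, map_zero]

theorem Factorization.eventually_isRegularTime (h : Factorization d B C z g g') :
    ∀ᶠ w in 𝓝 z, IsRegularTime d B C w := by
  have c1 : ContinuousAt (fun w => flow d B C (-w)) z :=
    ((analyticAt_flow (-z)).comp (f := fun w : Fin d → ℂ => -w) analyticAt_id.neg).continuousAt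
  have e1 := eventually_corner_injective c1 (V := projNeg * g' * projNeg * (flow d B C z * g))
    h.corner_neg
  have e2 := eventually_corner_injective (analyticAt_flow z).continuousAt
    (V := projNeg * g * projNeg * (g' * flow d B C (-z))) h.corner_pos
  filter_upwards [e1, e2] with w h1 h2 x hx
  exact ⟨h1 x hx, h2 x hx⟩

theorem one_sub_hankelOp (z : Fin d → ℂ) : 1 - hankelOp d B C z =
    projPos + projNeg * flow d B C (-z) * projNeg * flow d B C z :=
  one_sub_corner projPos_add_projNeg (flow_neg_mul_flow z)

theorem IsRegularTime.of_one_sub_hankelOp (h : IsRegularTime d B C z) {x c : LoopSpace}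
    (hc : projPos c = c) (hx : (1 - hankelOp d B C z) x = c) :
    projPos x = c ∧ projNeg (flow d B C z x) = 0 := by
  have hpp (y : LoopSpace) : projPos (projPos y) = projPos y :=
    DFunLike.congr_fun projPos_mul_self y
  have hqq (y : LoopSpace) : projNeg (projNeg y) = projNeg y :=
    DFunLike.congr_fun projNeg_mul_self y
  have hpq (y : LoopSpace) : projPos (projNeg y) = 0 :=
    DFunLike.congr_fun projPos_mul_projNeg y
  have hqp (y : LoopSpace) : projNeg (projPos y) = 0 :=
    DFunLike.congr_fun projNeg_mul_projPos y
  rw [one_sub_hankelOp] at hx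
  simp only [_root_.add_apply, mul_apply_eq_comp] at hx
  have h1 := congrArg projPos hx
  have h2 := congrArg projNeg hx
  rw [map_add, hpp, hpq, add_zero, hc] at h1
  rw [map_add, hqp, hqq, zero_add, ← hc, hqp] at h2
  exact ⟨h1, (h _ (hpq _)).1 h2⟩

end

end Lemniscate

namespace Lemniscate

open Matrix Filter Topology

/-- Right multiplication of a pair of vectors by a matrix. -/
noncomputable def comb {V : Type*} [AddCommMonoid V] [Module ℂ V] (F : Fin 2 → V)
    (A : Matrix (Fin 2) (Fin 2) ℂ) (a : Fin 2) : V := ∑ b, A b a • F b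

section Comb

variable {V : Type*} [AddCommGroup V] [Module ℂ V]

theorem comb_comb (F : Fin 2 → V) (A A' : Matrix (Fin 2) (Fin 2) ℂ) :
    comb (comb F A) A' = comb F (A * A') := by
  ext a
  simp only [comb, Fin.sum_univ_two, mul_apply]
  module

theorem comb_sub (F : Fin 2 → V) (A A' : Matrix (Fin 2) (Fin 2) ℂ) (a : Fin 2) :
    comb F (A - A') a = comb F A a - comb F A' a := by
  simp only [comb, Fin.sum_univ_two, Matrix.sub_apply]
  module

theorem comb_zero (F : Fin 2 → V) (a : Fin 2) : comb F 0 a = 0 := by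
  simp [comb]

theorem comb_sum {ι : Type*} (I : Finset ι) (F : Fin 2 → V) (A : ι → Matrix (Fin 2) (Fin 2) ℂ)
    (a : Fin 2) : comb F (∑ i ∈ I, A i) a = ∑ i ∈ I, comb F (A i) a := by
  simp only [comb, Matrix.sum_apply, Finset.sum_smul]
  exact Finset.sum_comm

theorem comb_neg_left (F : Fin 2 → V) (A : Matrix (Fin 2) (Fin 2) ℂ) (a : Fin 2) :
    comb (-F) A a = -comb F A a := by
  simp [comb, Finset.sum_neg_distrib]

theorem comb_sum_left {ι : Type*} (I : Finset ι) (F : ι → Fin 2 → V)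
    (A : Matrix (Fin 2) (Fin 2) ℂ) (a : Fin 2) :
    comb (∑ i ∈ I, F i) A a = ∑ i ∈ I, comb (F i) A a := by
  simp only [comb, Finset.sum_apply, Finset.smul_sum]
  exact Finset.sum_comm

end Comb

theorem map_comb (T : LoopOp) (F : Fin 2 → LoopSpace) (A : Matrix (Fin 2) (Fin 2) ℂ) (a : Fin 2) :
    T (comb F A a) = comb (fun b => T (F b)) A a := by
  simp [comb]

theorem comb_apply (F : Fin 2 → LoopSpace) (A : Matrix (Fin 2) (Fin 2) ℂ) (a : Fin 2)
    (i : ℤ × Fin 2) : comb F A a i = ∑ b, A b a * F b i := by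
  rw [comb, LoopSpace.sum_apply]
  rfl

/-- The pair `F` is normalized: its nonnegative part is the standard basis. -/
def IsNormalizedPair (F : Fin 2 → LoopSpace) : Prop := ∀ a, projPos (F a) = basisVec 0 a

/-- The matrix of coefficients of index `-s` of a pair. -/
noncomputable def tailCoef (F : Fin 2 → LoopSpace) (s : ℤ) : Matrix (Fin 2) (Fin 2) ℂ :=
  Matrix.of fun c a => F a (-s, c)

theorem tailCoef_apply (F : Fin 2 → LoopSpace) (s : ℤ) (c a : Fin 2) :
    tailCoef F s c a = F a (-s, c) := rfl

theorem IsNormalizedPair.apply_of_nonneg {F : Fin 2 → LoopSpace} (hF : IsNormalizedPair F)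
    {j : ℤ} (hj : 0 ≤ j) (a c : Fin 2) : F a (j, c) = if j = 0 ∧ c = a then 1 else 0 := by
  have h := congrArg (fun f : LoopSpace => f (j, c)) (hF a)
  simpa [projPos_apply, hj, basisVec_apply] using h

theorem IsNormalizedPair.tailCoef_zero {F : Fin 2 → LoopSpace} (hF : IsNormalizedPair F) :
    tailCoef F 0 = 1 := by
  ext c a
  rw [tailCoef_apply, neg_zero, hF.apply_of_nonneg le_rfl, one_apply]
  simp

theorem IsNormalizedPair.tailCoef_neg {F : Fin 2 → LoopSpace} (hF : IsNormalizedPair F) {s : ℤ}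
    (hs : s < 0) : tailCoef F s = 0 := by
  ext c a
  rw [tailCoef_apply, hF.apply_of_nonneg (by omega), if_neg (by omega)]
  rfl

theorem shift_comb_apply (F : Fin 2 → LoopSpace) (A : Matrix (Fin 2) (Fin 2) ℂ) (k j : ℤ)
    (a c : Fin 2) : shift k (comb F A a) (j, c) = (tailCoef F (k - j) * A) c a := by
  rw [shift_apply, comb_apply, mul_apply]
  refine Finset.sum_congr rfl fun b _ => ?_
  rw [tailCoef_apply, neg_sub, mul_comm]

theorem IsNormalizedPair.eq_zero_of_sum {F : Fin 2 → LoopSpace} (hF : IsNormalizedPair F) (N : ℕ)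
    {Z : ℕ → Matrix (Fin 2) (Fin 2) ℂ}
    (h : ∀ a, ∑ k ∈ Finset.range N, shift k (comb F (Z k) a) = 0) : ∀ k < N, Z k = 0 := by
  induction N with
  | zero => intro k hk; omega
  | succ N ih =>
    have h1 : Z N = 0 := by
      ext c a
      have h2 := congrArg (fun f : LoopSpace => f ((N : ℤ), c)) (h a)
      simp only [LoopSpace.sum_apply, shift_comb_apply] at h2
      rw [Finset.sum_range_succ, Finset.sum_eq_zero, sub_self, hF.tailCoef_zero, one_mul,
        zero_add] at h2
      · exact h2
      · intro k hk
        rw [hF.tailCoef_neg (by have := Finset.mem_range.1 hk; omega), zero_mul]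
        rfl
    intro k hk
    rcases Nat.lt_succ_iff_lt_or_eq.1 hk with hk | rfl
    · refine ih (fun a => ?_) k hk
      have := h a
      rwa [Finset.sum_range_succ, h1, comb_zero, map_zero, add_zero] at this
    · exact h1

/-- The coefficients of the polynomial matrix obtained by conjugating `u ^ n B + C` with the series
`∑ u ^ (-s) G s`, listed from the top degree. -/
noncomputable def laxCoef (n : ℕ) (B C : Matrix (Fin 2) (Fin 2) ℂ)
    (G : ℕ → Matrix (Fin 2) (Fin 2) ℂ) (q : ℕ) : Matrix (Fin 2) (Fin 2) ℂ :=
  B * G q + (if q = n then C else 0) - ∑ s : Fin q, G (q - s) * laxCoef n B C G s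
termination_by q
decreasing_by exact s.2

theorem laxCoef_eq (n : ℕ) (B C : Matrix (Fin 2) (Fin 2) ℂ)
    (G : ℕ → Matrix (Fin 2) (Fin 2) ℂ) (q : ℕ) : laxCoef n B C G q =
      B * G q + (if q = n then C else 0) -
        ∑ s ∈ Finset.range q, G (q - s) * laxCoef n B C G s := by
  rw [laxCoef, Finset.sum_range]

theorem laxCoef_smul (n : ℕ) (B C : Matrix (Fin 2) (Fin 2) ℂ)
    (G : ℕ → Matrix (Fin 2) (Fin 2) ℂ) (θ : ℂ) (q : ℕ) :
    laxCoef n B (θ ^ n • C) (fun q => θ ^ q • G q) q = θ ^ q • laxCoef n B C G q := by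
  induction q using Nat.strong_induction_on with
  | _ q ih =>
    rw [laxCoef_eq, laxCoef_eq n B C, smul_sub, smul_add, mul_smul_comm, Finset.smul_sum]
    congr 1
    · congr 1
      split_ifs with h
      · rw [h]
      · rw [smul_zero]
    · refine Finset.sum_congr rfl fun s hs => ?_
      have hs := Finset.mem_range.1 hs
      rw [ih s hs, smul_mul_smul_comm, ← pow_add, Nat.sub_add_cancel hs.le]

variable {d : ℕ} {B C : Matrix (Fin 2) (Fin 2) ℂ}

/-- A normalized pair generating the subspace of vectors mapped by `flow z` to nonnegative
loops. -/
structure IsBakerPair (d : ℕ) (B C : Matrix (Fin 2) (Fin 2) ℂ) (z : Fin d → ℂ)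
    (F : Fin 2 → LoopSpace) : Prop where
  normalized : IsNormalizedPair F
  mem : ∀ a, projNeg (flow d B C z (F a)) = 0

theorem projNeg_flow_apply_eq_zero {z : Fin d → ℂ} {T : LoopOp} (hT : IsLoopCommutant d B C T)
    (hT' : LowersBy 0 T) {h : LoopSpace} (hh : projNeg (flow d B C z h) = 0) :
    projNeg (flow d B C z (T h)) = 0 := by
  have h1 : flow d B C z (T h) = T (flow d B C z h) := DFunLike.congr_fun (hT.commute_flow z).eq h
  have h2 : flow d B C z h = projPos (flow d B C z h) := by
    conv_lhs => rw [eq_projPos_add_projNeg (flow d B C z h), hh, add_zero]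
  rw [h1, h2]
  exact DFunLike.congr_fun hT'.projNeg_mul_mul_projPos _

theorem projNeg_flow_shift {z : Fin d → ℂ} {h : LoopSpace}
    (hh : projNeg (flow d B C z h) = 0) (k : ℕ) :
    projNeg (flow d B C z (shift k h)) = 0 :=
  projNeg_flow_apply_eq_zero (isLoopCommutant_shift k) ((LowersBy.shift k).mono (by omega)) hh

theorem projNeg_flow_laxOp {z : Fin d → ℂ} {h : LoopSpace}
    (hh : projNeg (flow d B C z h) = 0) :
    projNeg (flow d B C z (laxOp d B C h)) = 0 :=
  projNeg_flow_apply_eq_zero isLoopCommutant_laxOp LowersBy.laxOp hh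

theorem IsBakerPair.comb_mem {z : Fin d → ℂ} {F : Fin 2 → LoopSpace} (hF : IsBakerPair d B C z F)
    (A : Matrix (Fin 2) (Fin 2) ℂ) (a : Fin 2) : projNeg (flow d B C z (comb F A a)) = 0 := by
  rw [map_comb, map_comb]
  simp [comb, hF.mem]

theorem IsBakerPair.eq {z : Fin d → ℂ} (hz : IsRegularTime d B C z) {F F' : Fin 2 → LoopSpace}
    (hF : IsBakerPair d B C z F) (hF' : IsBakerPair d B C z F') : F = F' := by
  ext1 a
  rw [← sub_eq_zero]
  refine (hz _ ?_).2 ?_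
  · rw [map_sub, hF.normalized, hF'.normalized, sub_self]
  · rw [map_sub, map_sub, hF.mem, hF'.mem, sub_self]

theorem laxOp_apply (f : LoopSpace) (j : ℤ) (c : Fin 2) : laxOp d B C f (j, c) =
    ∑ b, B c b * f (j - (d + 1), b) + ∑ b, C c b * f (j, b) := by
  rw [laxOp, _root_.add_apply, mul_apply_eq_comp, LoopSpace.add_apply, shift_apply, matOp_apply,
    matOp_apply]

theorem IsNormalizedPair.sum_tailCoef_mul_laxCoef {F : Fin 2 → LoopSpace}
    (hF : IsNormalizedPair F) (n : ℕ) {p : ℤ} (hp : p ≤ n) :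
    B * tailCoef F p + C * tailCoef F (p - n) = ∑ q ∈ Finset.range (n + 1),
      tailCoef F (p - q) * laxCoef n B C (fun s => tailCoef F s) q := by
  rcases lt_or_ge p 0 with h0 | h0
  · rw [hF.tailCoef_neg h0, hF.tailCoef_neg (by omega), Finset.sum_eq_zero, mul_zero, mul_zero,
      add_zero]
    intro q _
    rw [hF.tailCoef_neg (by omega), zero_mul]
  · lift p to ℕ using h0
    have hp' : p ≤ n := by exact_mod_cast hp
    rw [← Finset.sum_subset (Finset.range_mono (Nat.succ_le_succ hp')), Finset.sum_range_succ,
      sub_self, hF.tailCoef_zero, one_mul, laxCoef_eq]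
    · have h1 : C * tailCoef F (p - n) = if p = n then C else 0 := by
        split_ifs with h
        · rw [h, sub_self, hF.tailCoef_zero, mul_one]
        · rw [hF.tailCoef_neg (by omega), mul_zero]
      have h2 : ∑ q ∈ Finset.range p, tailCoef F ((p - q : ℕ) : ℤ) *
          laxCoef n B C (fun s => tailCoef F s) q = ∑ q ∈ Finset.range p, tailCoef F (p - q) *
          laxCoef n B C (fun s => tailCoef F s) q := by
        refine Finset.sum_congr rfl fun q hq => ?_
        rw [Nat.cast_sub (Finset.mem_range.1 hq).le]
      rw [h1, h2]
      abel
    · intro q _ hq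
      have : p < q := by simpa using hq
      rw [hF.tailCoef_neg (by omega), zero_mul]

/-- The polynomial matrix representing `laxOp` on a Baker pair. -/
theorem IsBakerPair.laxOp_eq {z : Fin d → ℂ} (hz : IsRegularTime d B C z)
    {F : Fin 2 → LoopSpace} (hF : IsBakerPair d B C z F) (a : Fin 2) :
    laxOp d B C (F a) = ∑ r ∈ Finset.range (d + 2),
      shift r (comb F (laxCoef (d + 1) B C (fun s => tailCoef F s) (d + 1 - r)) a) := by
  rw [← sub_eq_zero]
  refine (hz _ ?_).2 ?_
  · ext ⟨j, c⟩
    rw [projPos_apply]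
    split_ifs with hj
    · have h1 := congrFun (congrFun (hF.normalized.sum_tailCoef_mul_laxCoef (B := B) (C := C)
        (d + 1) (p := d + 1 - j) (by push_cast; omega)) c) a
      rw [LoopSpace.sub_apply, LoopSpace.sum_apply, laxOp_apply]
      simp only [Matrix.add_apply, Matrix.sum_apply, mul_apply (M := B), mul_apply (M := C),
        tailCoef_apply, neg_sub] at h1
      rw [← Finset.sum_range_reflect] at h1
      have h2 : ∀ r ∈ Finset.range (d + 2), shift r (comb F (laxCoef (d + 1) B C
          (fun s => tailCoef F s) (d + 1 - r)) a) (j, c) = (tailCoef F ((d : ℤ) + 1 - j -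
            ((d + 1 + 1 - 1 - r : ℕ) : ℤ)) * laxCoef (d + 1) B C
              (fun s => tailCoef F s) (d + 1 + 1 - 1 - r)) c a := by
        intro r hr
        have hr := Finset.mem_range.1 hr
        rw [shift_comb_apply]
        push_cast [show r ≤ d + 1 by omega]
        ring_nf
      rw [Finset.sum_congr rfl h2, ← h1]
      refine sub_eq_zero.2 ?_
      congr 1
      refine Finset.sum_congr rfl fun b _ => ?_
      push_cast
      ring_nf
    · rfl
  · rw [map_sub, map_sub, projNeg_flow_laxOp (hF.mem a), map_sum, map_sum, Finset.sum_eq_zero,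
      sub_zero]
    exact fun r _ => projNeg_flow_shift (hF.comb_mem _ a) r

theorem flow_smul_single (l : Fin d) (t : ℂ) :
    flow d B C (t • Pi.single l 1) = NormedSpace.exp (t • flowGen d B C l) := by
  rw [flow, flowSum, Finset.sum_eq_single l]
  · simp
  · intro i _ hi
    simp [Pi.single_eq_of_ne hi]
  · simp

theorem hasDerivAt_flow (z : Fin d → ℂ) (l : Fin d) :
    HasDerivAt (fun t : ℂ => flow d B C (z + t • Pi.single l 1)) (flow d B C z * flowGen d B C l)
      0 := by
  have h := (hasDerivAt_exp_smul_const (𝕂 := ℂ) (flowGen d B C l) 0).const_mul (flow d B C z)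
  simp only [zero_smul, NormedSpace.exp_zero, one_mul] at h
  refine h.congr_of_eventuallyEq (Eventually.of_forall fun t => ?_)
  simp only [flow_add, flow_smul_single]

section Curve

variable {z : Fin d → ℂ} {l : Fin d} {φ : ℂ → Fin 2 → LoopSpace} {φ' : Fin 2 → LoopSpace}

/-- The derivative of a Baker pair along a flow. -/
theorem IsBakerPair.deriv_eq (hz : IsRegularTime d B C z) (hφ' : ∀ a, HasDerivAt (φ · a) (φ' a) 0)
    (hφ : ∀ᶠ t in 𝓝 (0 : ℂ), IsBakerPair d B C (z + t • Pi.single l 1) (φ t)) (a : Fin 2) :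
    φ' a = -∑ r ∈ Finset.range (l + 1), shift (r - (l + 1))
      (comb (φ 0) (laxCoef (d + 1) B C (fun s => tailCoef (φ 0) s) (d + 1 - r)) a) := by
  have h0 : IsBakerPair d B C z (φ 0) := by simpa using hφ.self_of_nhds
  set A : ℕ → Matrix (Fin 2) (Fin 2) ℂ :=
    fun r => laxCoef (d + 1) B C (fun s => tailCoef (φ 0) s) (d + 1 - r) with hA
  have hL : flowGen d B C l (φ 0 a) = ∑ r ∈ Finset.range (d + 2),
      shift (r - (l + 1)) (comb (φ 0) (A r) a) := by
    rw [flowGen, mul_apply_eq_comp, h0.laxOp_eq hz, map_sum]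
    refine Finset.sum_congr rfl fun r _ => ?_
    rw [← mul_apply_eq_comp, shift_mul_shift]
    congr 2
  have hsplit : flowGen d B C l (φ 0 a) = ∑ r ∈ Finset.range (l + 1),
      shift (r - (l + 1)) (comb (φ 0) (A r) a) + ∑ r ∈ Finset.range (d + 1 - l),
      shift r (comb (φ 0) (A (l + 1 + r)) a) := by
    rw [hL, show d + 2 = (l + 1) + (d + 1 - l) by omega, Finset.sum_range_add]
    congr 1
    refine Finset.sum_congr rfl fun r _ => ?_
    congr 2
    push_cast
    ring_nf
  have h1 : projPos (φ' a) = 0 := by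
    have e1 := (projPos.hasFDerivAt (x := φ 0 a)).comp_hasDerivAt (0 : ℂ) (hφ' a)
    refine e1.unique ((hasDerivAt_const (0 : ℂ) (basisVec 0 a)).congr_of_eventuallyEq ?_)
    filter_upwards [hφ] with t ht using ht.normalized a
  have h2 : projNeg (flow d B C z (flowGen d B C l (φ 0 a) + φ' a)) = 0 := by
    have e1 : HasDerivAt (fun t : ℂ => flow d B C (z + t • Pi.single l 1) (φ t a))
        ((flow d B C z * flowGen d B C l) (φ 0 a) + flow d B C z (φ' a)) 0 := by
      simpa using (hasDerivAt_flow z l).clm_apply (hφ' a)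
    have e2 := projNeg.hasFDerivAt.comp_hasDerivAt (0 : ℂ) e1
    rw [map_add]
    refine e2.unique ((hasDerivAt_const (0 : ℂ) (0 : LoopSpace)).congr_of_eventuallyEq ?_)
    filter_upwards [hφ] with t ht using ht.mem a
  rw [← sub_eq_zero, sub_neg_eq_add]
  refine (hz _ ?_).2 ?_
  · rw [map_add, h1, zero_add]
    ext ⟨j, c⟩
    rw [projPos_apply]
    split_ifs with hj
    · rw [LoopSpace.sum_apply]
      refine Finset.sum_eq_zero fun r hr => ?_
      have hr := Finset.mem_range.1 hr
      rw [shift_comb_apply, h0.normalized.tailCoef_neg, zero_mul]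
      · rfl
      · dsimp only at hj
        omega
    · rfl
  · have e3 : φ' a + ∑ r ∈ Finset.range (l + 1), shift (r - (l + 1)) (comb (φ 0) (A r) a) =
        (flowGen d B C l (φ 0 a) + φ' a) - ∑ r ∈ Finset.range (d + 1 - l),
      shift r (comb (φ 0) (A (l + 1 + r)) a) := by
      rw [hsplit]
      abel
    rw [e3, map_sub, map_sub, h2, zero_sub, neg_eq_zero, map_sum, map_sum]
    exact Finset.sum_eq_zero fun r _ => projNeg_flow_shift (h0.comb_mem _ a) r

theorem sum_shift_comb_eq {ι : Type*} (I : Finset ι) (F : Fin 2 → LoopSpace) (f : ι → ℕ)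
    (Y : ι → Matrix (Fin 2) (Fin 2) ℂ) {N : ℕ} (hN : ∀ i ∈ I, f i < N) (a : Fin 2) :
    ∑ i ∈ I, shift (f i) (comb F (Y i) a) = ∑ k ∈ Finset.range N,
      shift k (comb F (∑ i ∈ I, if f i = k then Y i else 0) a) := by
  simp only [comb_sum, map_sum]
  rw [Finset.sum_comm]
  refine Finset.sum_congr rfl fun i hi => ?_
  rw [Finset.sum_eq_single (f i)]
  · rw [if_pos rfl]
  · intro k _ hk
    rw [if_neg (Ne.symm hk), comb_zero, map_zero]
  · intro h
    exact absurd (Finset.mem_range.2 (hN i hi)) h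

theorem HasDerivAt.comb_pair {A : ℂ → Matrix (Fin 2) (Fin 2) ℂ} {A' : Matrix (Fin 2) (Fin 2) ℂ}
    (hφ' : ∀ a, HasDerivAt (φ · a) (φ' a) 0) (hA' : ∀ b a, HasDerivAt (fun t => A t b a) (A' b a) 0)
    (a : Fin 2) :
    HasDerivAt (fun t => comb (φ t) (A t) a) (comb φ' (A 0) a + comb (φ 0) A' a) 0 := by
  have h : HasDerivAt (fun t => ∑ b, A t b a • φ t b)
      (∑ b, (A 0 b a • φ' b + A' b a • φ 0 b)) 0 :=
    HasDerivAt.fun_sum fun b _ => (hA' b a).smul (hφ' b)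
  rwa [Finset.sum_add_distrib] at h

/-- The Lax equation. -/
theorem IsBakerPair.lax_deriv_eq (hz : ∀ᶠ w in 𝓝 z, IsRegularTime d B C w)
    (hφ' : ∀ a, HasDerivAt (φ · a) (φ' a) 0)
    (hφ : ∀ᶠ t in 𝓝 (0 : ℂ), IsBakerPair d B C (z + t • Pi.single l 1) (φ t))
    {A : ℂ → ℕ → Matrix (Fin 2) (Fin 2) ℂ} {A' : ℕ → Matrix (Fin 2) (Fin 2) ℂ}
    (hA : ∀ t r, A t r = laxCoef (d + 1) B C (fun s => tailCoef (φ t) s) (d + 1 - r))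
    (hA' : ∀ r < d + 2, ∀ b a, HasDerivAt (fun t => A t r b a) (A' r b a) 0) {q : ℕ} (hq : q < d + 2) :
    A' q = ∑ s ∈ Finset.range (l + 1), if q + l + 1 - s < d + 2 then
      A 0 s * A 0 (q + l + 1 - s) - A 0 (q + l + 1 - s) * A 0 s else 0 := by
  have h0 : IsBakerPair d B C z (φ 0) := by simpa using hφ.self_of_nhds
  have hL0 : ∀ a, laxOp d B C (φ 0 a) =
      ∑ r ∈ Finset.range (d + 2), shift r (comb (φ 0) (A 0 r) a) := fun a => by
    simpa only [hA] using h0.laxOp_eq hz.self_of_nhds a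
  have hφ0 : ∀ a, φ' a = -∑ s ∈ Finset.range (l + 1),
      shift (s - (l + 1)) (comb (φ 0) (A 0 s) a) := fun a => by
    simpa only [hA] using IsBakerPair.deriv_eq hz.self_of_nhds hφ' hφ a
  have hc : ContinuousAt (fun t : ℂ => z + t • (Pi.single l 1 : Fin d → ℂ)) 0 := by fun_prop
  have hz' : ∀ᶠ t in 𝓝 (0 : ℂ), IsRegularTime d B C (z + t • Pi.single l 1) :=
    hc.eventually (by simpa using hz)
  have hLφ : ∀ a, laxOp d B C (φ' a) = ∑ r ∈ Finset.range (d + 2),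
      shift r (comb φ' (A 0 r) a + comb (φ 0) (A' r) a) := by
    intro a
    have e1 := (laxOp d B C).hasFDerivAt.comp_hasDerivAt (0 : ℂ) (hφ' a)
    have e2 : HasDerivAt (fun t => ∑ r ∈ Finset.range (d + 2), shift r (comb (φ t) (A t r) a))
        (∑ r ∈ Finset.range (d + 2), shift r (comb φ' (A 0 r) a + comb (φ 0) (A' r) a)) 0 :=
      HasDerivAt.fun_sum fun r hr => (shift r).hasFDerivAt.comp_hasDerivAt (0 : ℂ)
        (HasDerivAt.comb_pair hφ' (hA' r (Finset.mem_range.1 hr)) a)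
    refine e1.unique (e2.congr_of_eventuallyEq ?_)
    filter_upwards [hφ, hz'] with t ht hzt
    exact (ht.laxOp_eq hzt a).trans (by simp only [hA])
  have hs : ∀ a, shift (l + 1) (φ' a) =
      -∑ s ∈ Finset.range (l + 1), shift s (comb (φ 0) (A 0 s) a) := by
    intro a
    rw [hφ0, map_neg, map_sum]
    congr 1
    refine Finset.sum_congr rfl fun s _ => ?_
    rw [← mul_apply_eq_comp, shift_mul_shift]
    congr 2
    ring
  have hsl : ∀ a, shift (l + 1) (laxOp d B C (φ' a)) = -∑ s ∈ Finset.range (l + 1),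
      ∑ r ∈ Finset.range (d + 2), shift ((s + r : ℕ) : ℤ) (comb (φ 0) (A 0 r * A 0 s) a) := by
    intro a
    rw [← mul_apply_eq_comp, (commute_shift_laxOp _).eq, mul_apply_eq_comp, hs, map_neg, map_sum]
    congr 1
    refine Finset.sum_congr rfl fun s _ => ?_
    rw [← mul_apply_eq_comp, ← (commute_shift_laxOp _).eq, mul_apply_eq_comp, map_comb]
    simp only [hL0]
    have : (fun b => ∑ r ∈ Finset.range (d + 2), shift r (comb (φ 0) (A 0 r) b)) =
        ∑ r ∈ Finset.range (d + 2), comb (fun b => shift r (φ 0 b)) (A 0 r) := by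
      ext1 b
      simp only [Finset.sum_apply, map_comb]
    rw [this, comb_sum_left, map_sum]
    refine Finset.sum_congr rfl fun r _ => ?_
    rw [comb_comb, ← map_comb, ← mul_apply_eq_comp, shift_mul_shift, Nat.cast_add]
  have hsr : ∀ a, shift (l + 1) (laxOp d B C (φ' a)) = -(∑ r ∈ Finset.range (d + 2),
      ∑ s ∈ Finset.range (l + 1), shift ((s + r : ℕ) : ℤ) (comb (φ 0) (A 0 s * A 0 r) a)) +
      ∑ r ∈ Finset.range (d + 2), shift ((r + (l + 1) : ℕ) : ℤ) (comb (φ 0) (A' r) a) := by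
    intro a
    rw [hLφ, map_sum, ← Finset.sum_neg_distrib, ← Finset.sum_add_distrib]
    refine Finset.sum_congr rfl fun r _ => ?_
    rw [← mul_apply_eq_comp, (commute_shift_shift _ _).eq, mul_apply_eq_comp, map_add, map_add,
      map_comb]
    simp only [hs]
    congr 1
    · have : (fun b => -∑ s ∈ Finset.range (l + 1), shift s (comb (φ 0) (A 0 s) b)) =
        -∑ s ∈ Finset.range (l + 1), comb (fun b => shift s (φ 0 b)) (A 0 s) := by
        ext1 b
        simp only [Pi.neg_apply, Finset.sum_apply, map_comb]
      rw [this, comb_neg_left, comb_sum_left, map_neg, map_sum]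
      congr 1
      refine Finset.sum_congr rfl fun s _ => ?_
      rw [comb_comb, ← map_comb, ← mul_apply_eq_comp, shift_mul_shift, Nat.cast_add, add_comm]
    · rw [← mul_apply_eq_comp, shift_mul_shift]
      push_cast
      rfl
  have key := h0.normalized.eq_zero_of_sum (d + 2 + (l + 1)) (Z := fun k =>
      (∑ r ∈ Finset.range (d + 2), if r + (l + 1) = k then A' r else 0) -
      ∑ i ∈ Finset.range (l + 1) ×ˢ Finset.range (d + 2), if i.1 + i.2 = k then
        A 0 i.1 * A 0 i.2 - A 0 i.2 * A 0 i.1 else 0) (fun a => by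
    simp only [comb_sub, map_sub, Finset.sum_sub_distrib]
    rw [← sum_shift_comb_eq _ _ (fun r => r + (l + 1)), ← sum_shift_comb_eq _ _
      (fun i : ℕ × ℕ => i.1 + i.2), Finset.sum_product]
    · have h1 := (hsl a).symm.trans (hsr a)
      rw [Finset.sum_comm (s := Finset.range (d + 2))] at h1
      simp only [comb_sub, map_sub, Finset.sum_sub_distrib]
      rw [eq_neg_add_iff_add_eq] at h1
      rw [← h1]
      abel
    · intro i hi
      have := Finset.mem_product.1 hi
      have h1 := Finset.mem_range.1 this.1
      have h2 := Finset.mem_range.1 this.2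
      omega
    · intro i hi
      have h1 := Finset.mem_range.1 hi
      omega) (q + (l + 1)) (by omega)
  rw [sub_eq_zero, Finset.sum_product, Finset.sum_eq_single q] at key
  · rw [if_pos rfl] at key
    rw [key]
    refine Finset.sum_congr rfl fun s hs => ?_
    have hs := Finset.mem_range.1 hs
    split_ifs with h
    · rw [Finset.sum_eq_single (q + l + 1 - s)]
      · rw [if_pos (by omega)]
      · intro r _ hr
        rw [if_neg (by omega)]
      · intro h'
        exact absurd (Finset.mem_range.2 h) h'
    · refine Finset.sum_eq_zero fun r hr => ?_
      have hr := Finset.mem_range.1 hr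
      rw [if_neg (by omega)]
  · intro r _ hr
    rw [if_neg (by omega)]
  · intro h
    exact absurd (Finset.mem_range.2 hq) h

end Curve

end Lemniscate

namespace Lemniscate

open Matrix Filter Topology MvPolynomial

section LaxSystem

variable {d : ℕ}

/-- The generic coefficient matrices of a polynomial matrix of degree `d + 1`. -/
noncomputable def genericCoef (d r : ℕ) :
    Matrix (Fin 2) (Fin 2) (MvPolynomial (Fin (d + 2) × Fin 2 × Fin 2) ℤ) :=
  if h : r < d + 2 then Matrix.of fun a b => X (⟨r, h⟩, a, b) else 0

/-- The Lax equations of the commuting flows. -/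
noncomputable def laxSystem (d : ℕ) (l : Fin d) (i : Fin (d + 2) × Fin 2 × Fin 2) :
    MvPolynomial (Fin (d + 2) × Fin 2 × Fin 2) ℤ :=
  (∑ s ∈ Finset.range (l + 1), (genericCoef d s * genericCoef d (i.1 + l + 1 - s) -
    genericCoef d (i.1 + l + 1 - s) * genericCoef d s)) i.2.1 i.2.2

/-- The coefficients of `u ^ (d + 1) B + C`. -/
noncomputable def laxInit (d : ℕ) (B C : Matrix (Fin 2) (Fin 2) ℂ)
    (i : Fin (d + 2) × Fin 2 × Fin 2) : ℂ :=
  if (i.1 : ℕ) = d + 1 then B i.2.1 i.2.2 else if (i.1 : ℕ) = 0 then C i.2.1 i.2.2 else 0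

theorem aeval_laxSystem {y : Fin (d + 2) × Fin 2 × Fin 2 → ℂ} {A : ℕ → Matrix (Fin 2) (Fin 2) ℂ}
    (hy : ∀ i, y i = A i.1 i.2.1 i.2.2) (l : Fin d) (i : Fin (d + 2) × Fin 2 × Fin 2) :
    aeval y (laxSystem d l i) = (∑ s ∈ Finset.range (l + 1), if (i.1 : ℕ) + l + 1 - s < d + 2 then
      A s * A (i.1 + l + 1 - s) - A (i.1 + l + 1 - s) * A s else 0) i.2.1 i.2.2 := by
  have h1 : ∀ r < d + 2, ∀ a b, aeval y (genericCoef d r a b) = A r a b := by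
    intro r hr a b
    rw [genericCoef, dif_pos hr, of_apply, aeval_X, hy]
  simp only [laxSystem, Matrix.sum_apply, map_sum]
  refine Finset.sum_congr rfl fun s hs => ?_
  have hs := Finset.mem_range.1 hs
  have hs2 : s < d + 2 := by have := l.2; omega
  split_ifs with h
  · simp only [Matrix.sub_apply, mul_apply, map_sub, map_sum, map_mul, h1 _ h, h1 _ hs2]
  · simp [genericCoef, dif_neg h]

end LaxSystem

section Growth

theorem analyticAt_laxCoef {V : Type*} [NormedAddCommGroup V] [NormedSpace ℂ V] {n : ℕ}
    {B : Matrix (Fin 2) (Fin 2) ℂ} {C : V → Matrix (Fin 2) (Fin 2) ℂ}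
    {G : V → ℕ → Matrix (Fin 2) (Fin 2) ℂ} {z : V} (hC : ∀ a b, AnalyticAt ℂ (fun w => C w a b) z)
    (hG : ∀ s a b, AnalyticAt ℂ (fun w => G w s a b) z) (q : ℕ) :
    ∀ a b, AnalyticAt ℂ (fun w => laxCoef n B (C w) (G w) q a b) z := by
  induction q using Nat.strong_induction_on with
  | _ q ih =>
    intro a b
    have h1 : ∀ s ∈ Finset.range q,
        AnalyticAt ℂ (fun w => (G w (q - s) * laxCoef n B (C w) (G w) s) a b) z := by
      intro s hs
      simp only [mul_apply]
      exact Finset.analyticAt_fun_sum _ fun c _ =>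
        (hG _ a c).mul (ih s (Finset.mem_range.1 hs) c b)
    have h2 : AnalyticAt ℂ (fun w => (B * G w q) a b) z := by
      simp only [mul_apply]
      exact Finset.analyticAt_fun_sum _ fun c _ => analyticAt_const.mul (hG q c b)
    have h3 : AnalyticAt ℂ (fun w => (if q = n then C w else 0) a b) z := by
      split_ifs
      · exact hC a b
      · exact analyticAt_const
    have := (h2.add h3).sub (Finset.analyticAt_fun_sum _ h1)
    refine this.congr (Eventually.of_forall fun w => ?_)
    simp only [laxCoef_eq n B (C w) (G w) q, Matrix.sub_apply, Matrix.add_apply,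
      Matrix.sum_apply, Pi.sub_apply, Pi.add_apply]

theorem norm_mul_entry_le {A A' : Matrix (Fin 2) (Fin 2) ℂ} {x y : ℝ} (hA : ∀ a b, ‖A a b‖ ≤ x)
    (hA' : ∀ a b, ‖A' a b‖ ≤ y) (a b : Fin 2) : ‖(A * A') a b‖ ≤ 2 * (x * y) := by
  have hx : 0 ≤ x := (norm_nonneg _).trans (hA 0 0)
  rw [mul_apply, Fin.sum_univ_two]
  refine (norm_add_le _ _).trans ?_
  rw [norm_mul, norm_mul, two_mul]
  gcongr <;> first | exact hA _ _ | exact hA' _ _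

theorem norm_laxCoef_le (n q : ℕ) : ∃ k : ℕ, ∀ (Λ : ℝ) (B C : Matrix (Fin 2) (Fin 2) ℂ)
    (G : ℕ → Matrix (Fin 2) (Fin 2) ℂ), 2 ≤ Λ → (∀ a b, ‖B a b‖ ≤ Λ) → (∀ a b, ‖C a b‖ ≤ Λ) →
    (∀ s ≤ q, ∀ a b, ‖G s a b‖ ≤ Λ) → ∀ a b, ‖laxCoef n B C G q a b‖ ≤ Λ ^ k := by
  induction q using Nat.strong_induction_on with
  | _ q ih =>
    choose! k hk using ih
    set K := ∑ s ∈ Finset.range q, k s with hK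
    refine ⟨q + K + 5, fun Λ B C G hΛ hB hC hG a b => ?_⟩
    have h1 : 1 ≤ Λ := by linarith
    have e1 : ‖(B * G q) a b‖ ≤ Λ ^ 3 := by
      refine (norm_mul_entry_le hB (hG q le_rfl) a b).trans ?_
      calc 2 * (Λ * Λ) ≤ Λ * (Λ * Λ) := by gcongr
        _ = Λ ^ 3 := by ring
    have e2 : ‖(if q = n then C else 0) a b‖ ≤ Λ := by
      split_ifs
      · exact hC a b
      · simpa using by linarith
    have e3 : ‖(∑ s ∈ Finset.range q, G (q - s) * laxCoef n B C G s) a b‖ ≤ q * Λ ^ (K + 2) := by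
      rw [Matrix.sum_apply]
      refine (norm_sum_le _ _).trans ?_
      refine (Finset.sum_le_card_nsmul _ _ (Λ ^ (K + 2)) fun s hs => ?_).trans (by simp)
      have hs' := Finset.mem_range.1 hs
      refine (norm_mul_entry_le (hG (q - s) (by omega)) (hk s hs' Λ B C G hΛ hB hC
        fun t ht => hG t (by omega)) a b).trans ?_
      have : k s ≤ K := Finset.single_le_sum (f := k) (fun _ _ => Nat.zero_le _) hs
      calc 2 * (Λ * Λ ^ k s) ≤ Λ * (Λ * Λ ^ K) := by gcongr
        _ = Λ ^ (K + 2) := by ring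
    have e4 : (q : ℝ) ≤ Λ ^ q := by
      have : (q : ℝ) ≤ 2 ^ q := by exact_mod_cast (Nat.lt_two_pow_self).le
      exact this.trans (by gcongr)
    rw [laxCoef_eq, Matrix.sub_apply, Matrix.add_apply]
    refine (norm_sub_le _ _).trans ((add_le_add ((norm_add_le _ _).trans (add_le_add e1 e2))
      e3).trans ?_)
    have f1 : Λ ^ 3 ≤ Λ ^ (q + K + 3) := pow_le_pow_right₀ h1 (by omega)
    have f2 : Λ ≤ Λ ^ (q + K + 3) := by
      simpa using pow_le_pow_right₀ h1 (show 1 ≤ q + K + 3 by omega)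
    have f3 : q * Λ ^ (K + 2) ≤ Λ ^ (q + K + 3) := by
      calc q * Λ ^ (K + 2) ≤ Λ ^ q * Λ ^ (K + 2) := by gcongr
        _ = Λ ^ (q + K + 2) := by ring
        _ ≤ _ := pow_le_pow_right₀ h1 (by omega)
    have f4 : 0 ≤ Λ ^ (q + K + 3) := by positivity
    calc Λ ^ 3 + Λ + q * Λ ^ (K + 2) ≤ (2 * 2) * Λ ^ (q + K + 3) := by linarith
      _ ≤ (Λ * Λ) * Λ ^ (q + K + 3) := by gcongr
      _ = Λ ^ (q + K + 5) := by ring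

theorem factorial_mul_pow_le {p : ℕ} {ℓ x c R : ℝ} (hR : 1 ≤ R) (hc : 0 ≤ c) (hx : 0 ≤ x)
    (hp : (p : ℝ) ≤ c * R) (hℓ0 : 0 ≤ ℓ) (hℓ : ℓ ≤ Real.exp (x * R)) :
    p.factorial * ℓ ^ p ≤ Real.exp ((c ^ 2 + c * x) * R ^ 2) := by
  have h1 : (p.factorial : ℝ) ≤ Real.exp p ^ p := by
    calc (p.factorial : ℝ) ≤ (p : ℝ) ^ p := by exact_mod_cast Nat.factorial_le_pow p
      _ ≤ Real.exp p ^ p := by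
        gcongr
        linarith [Real.add_one_le_exp (p : ℝ)]
  calc p.factorial * ℓ ^ p ≤ Real.exp p ^ p * Real.exp (x * R) ^ p := by gcongr
    _ = Real.exp (p * (p + x * R)) := by
      rw [← Real.exp_nat_mul, ← Real.exp_nat_mul, ← Real.exp_add]
      ring_nf
    _ ≤ Real.exp ((c * R) * (c * R + x * R)) := by gcongr
    _ = _ := by ring_nf

end Growth

section Numerators

variable (d : ℕ) (B C : Matrix (Fin 2) (Fin 2) ℂ) (R : ℝ) (z : Fin d → ℂ)

/-- The denominator of the Baker pair on the ball of radius `R`. -/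
noncomputable def bakerDen : ℂ :=
  fredholmDet (truncFn (truncOrder d B C R)) (truncVec (truncOrder d B C R)) (hankelOp d B C z)

/-- The numerator of the Baker pair on the ball of radius `R`. -/
noncomputable def bakerNum (a : Fin 2) : LoopSpace :=
  fredholmNum (truncFn (truncOrder d B C R)) (truncVec (truncOrder d B C R)) (hankelOp d B C z)
    (basisVec 0 a)

/-- The coefficients of the numerator, made homogeneous. -/
noncomputable def bakerCoef (s : ℕ) : Matrix (Fin 2) (Fin 2) ℂ :=
  if s = 0 then 1 else bakerDen d B C R z ^ (s - 1) • tailCoef (bakerNum d B C R z) s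

/-- The common denominator of the coefficients of the Lax matrix. -/
noncomputable def laxDen : ℂ := bakerDen d B C R z ^ (d + 1)

/-- The numerators of the coefficients of the Lax matrix. -/
noncomputable def laxNum (i : Fin (d + 2) × Fin 2 × Fin 2) : ℂ :=
  bakerDen d B C R z ^ (i.1 : ℕ) * laxCoef (d + 1) B (bakerDen d B C R z ^ (d + 1) • C)
    (bakerCoef d B C R z) (d + 1 - i.1) i.2.1 i.2.2

variable {d B C R z}

theorem norm_truncFn_le (N : ℕ) (i : Fin N × Fin 2) : ‖truncFn N i‖ ≤ 1 := norm_coordFn_le _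

theorem norm_truncVec_le (N : ℕ) (i : Fin N × Fin 2) : ‖truncVec N i‖ ≤ 1 := (norm_basisVec _ _).le

theorem analyticAt_bakerDen (hz : ‖z‖ ≤ R) : AnalyticAt ℂ (bakerDen d B C R) z :=
  analyticAt_fredholmDet (analyticAt_hankelOp z) (norm_hankelOp_sub_trunc_le hz)

theorem analyticAt_bakerNum (hz : ‖z‖ ≤ R) (a : Fin 2) :
    AnalyticAt ℂ (fun w => bakerNum d B C R w a) z :=
  analyticAt_fredholmNum (analyticAt_hankelOp z) (norm_hankelOp_sub_trunc_le hz) _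

theorem analyticAt_bakerCoef (hz : ‖z‖ ≤ R) (s : ℕ) (a b : Fin 2) :
    AnalyticAt ℂ (fun w => bakerCoef d B C R w s a b) z := by
  by_cases hs : s = 0
  · simp only [bakerCoef, if_pos hs]
    exact analyticAt_const
  · simp only [bakerCoef, if_neg hs, Matrix.smul_apply, smul_eq_mul]
    exact ((analyticAt_bakerDen hz).pow _).mul
      (((coordFn (-s, a)).analyticAt _).comp (analyticAt_bakerNum hz b))

theorem analyticAt_laxDen (hz : ‖z‖ ≤ R) : AnalyticAt ℂ (laxDen d B C R) z :=
  (analyticAt_bakerDen hz).pow _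

theorem analyticAt_laxNum (hz : ‖z‖ ≤ R) (i : Fin (d + 2) × Fin 2 × Fin 2) :
    AnalyticAt ℂ (fun w => laxNum d B C R w i) z :=
  ((analyticAt_bakerDen hz).pow _).mul (analyticAt_laxCoef
    (fun _ _ => ((analyticAt_bakerDen hz).pow _).mul analyticAt_const)
    (analyticAt_bakerCoef hz) _ _ _)

theorem bakerDen_smul_isBakerPair (hR : ‖z‖ ≤ R) (hz : IsRegularTime d B C z)
    (h0 : bakerDen d B C R z ≠ 0) :
    IsBakerPair d B C z fun a => (bakerDen d B C R z)⁻¹ • bakerNum d B C R z a := by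
  have h (a : Fin 2) := hz.of_one_sub_hankelOp (projPos_basisVec a)
    (x := (bakerDen d B C R z)⁻¹ • bakerNum d B C R z a) (by
      rw [map_smul, bakerNum, one_sub_fredholmNum (norm_hankelOp_sub_trunc_le hR)]
      exact inv_smul_smul₀ h0 _)
  exact ⟨fun a => (h a).1, fun a => (h a).2⟩

theorem laxNum_div_laxDen {F : Fin 2 → LoopSpace} (hF : IsNormalizedPair F)
    (h : F = fun a => (bakerDen d B C R z)⁻¹ • bakerNum d B C R z a)
    (h0 : bakerDen d B C R z ≠ 0) (i : Fin (d + 2) × Fin 2 × Fin 2) :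
    laxNum d B C R z i / laxDen d B C R z =
      laxCoef (d + 1) B C (fun s => tailCoef F s) (d + 1 - i.1) i.2.1 i.2.2 := by
  have h1 : bakerCoef d B C R z = fun s : ℕ => bakerDen d B C R z ^ s • tailCoef F s := by
    ext s a b
    rcases s with _ | s
    · simp [bakerCoef, hF.tailCoef_zero]
    · rw [bakerCoef, if_neg (Nat.succ_ne_zero s), Matrix.smul_apply, Matrix.smul_apply,
        tailCoef_apply, tailCoef_apply, h, LoopSpace.smul_apply, Nat.add_sub_cancel, smul_eq_mul,
        smul_eq_mul, pow_succ]
      field_simp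
  have hi : (i.1 : ℕ) + (d + 1 - i.1) = d + 1 := by have := i.1.2; omega
  rw [laxNum, laxDen, h1, laxCoef_smul, Matrix.smul_apply, smul_eq_mul, ← mul_assoc, ← pow_add, hi,
    mul_div_cancel_left₀ _ (pow_ne_zero _ h0)]

theorem truncOrder_le (hR : 1 ≤ R) :
    (truncOrder d B C R : ℝ) ≤ d * (4 * flowBound d B C + 2) * R := by
  have hb := flowBound_nonneg (d := d) (B := B) (C := C)
  rw [truncOrder, Nat.cast_mul, mul_assoc]
  gcongr
  refine (Nat.ceil_lt_add_one (by positivity)).le.trans ?_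
  nlinarith

variable (d B C) in
theorem exists_norm_baker_le : ∃ c : ℝ, 0 ≤ c ∧ ∀ R, 1 ≤ R → ∀ z : Fin d → ℂ, ‖z‖ ≤ R →
    ‖bakerDen d B C R z‖ ≤ Real.exp (c * R ^ 2) ∧
      ∀ a, ‖bakerNum d B C R z a‖ ≤ Real.exp (c * R ^ 2) := by
  set b := flowBound d B C with hb
  have hb0 : 0 ≤ b := flowBound_nonneg
  set c₁ : ℝ := 2 * (d * (4 * b + 2)) with hc₁
  have hc₁0 : 0 ≤ c₁ := by positivity
  set c₂ : ℝ := c₁ ^ 2 + c₁ * (2 + 2 * b)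
  have hc₂0 : 0 ≤ c₂ := by positivity
  refine ⟨2 + 2 * b + 2 * c₁ + c₂, by positivity, fun R hR z hz => ?_⟩
  have hκ := norm_hankelOp_le (B := B) (C := C) hz
  have hK := norm_hankelOp_sub_trunc_le (B := B) (C := C) hz
  rw [← hb] at hκ
  have h1 : 1 ≤ Real.exp (2 * (b * R)) := Real.one_le_exp (by positivity)
  have hRR : R ≤ R ^ 2 := by nlinarith
  set N := truncOrder d B C R with hN
  set p := Fintype.card (Fin N × Fin 2) with hp
  have hpR : (p : ℝ) ≤ c₁ * R := by
    have e1 := truncOrder_le (d := d) (B := B) (C := C) hR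
    have e2 : p = N * 2 := by simp [hp]
    rw [e2]
    push_cast
    rw [hc₁]
    linarith
  have hΔ : p.factorial * (3 * Real.exp (2 * (b * R))) ^ p ≤ Real.exp (c₂ * R ^ 2) := by
    refine factorial_mul_pow_le hR hc₁0 (by positivity) hpR (by positivity) ?_
    have : 3 ≤ Real.exp (2 * R) := by linarith [Real.add_one_le_exp (2 * R)]
    calc 3 * Real.exp (2 * (b * R)) ≤ Real.exp (2 * R) * Real.exp (2 * (b * R)) := by gcongr
      _ = _ := by rw [← Real.exp_add]; ring_nf
  refine ⟨(norm_fredholmDet_le (norm_truncFn_le N) (norm_truncVec_le N) h1 hκ hK).trans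
    (hΔ.trans ?_), fun a => (norm_fredholmNum_le (norm_truncFn_le N) (norm_truncVec_le N) h1 hκ hK
    (norm_basisVec 0 a).le).trans ?_⟩
  · gcongr
    linarith [mul_nonneg zero_le_two hb0, mul_nonneg zero_le_two hc₁0]
  · have e1 : (4 : ℝ) ≤ Real.exp (2 * R) := by
      have := Real.add_one_le_exp R
      rw [two_mul, Real.exp_add]
      nlinarith
    have e2 : (p : ℝ) ^ 2 + 1 ≤ Real.exp (2 * (c₁ * R)) := by
      have h2 := Real.add_one_le_exp (p : ℝ)
      have h3 : (0 : ℝ) ≤ p := Nat.cast_nonneg p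
      calc (p : ℝ) ^ 2 + 1 ≤ Real.exp p * Real.exp p := by nlinarith
        _ = Real.exp (2 * p) := by rw [← Real.exp_add, two_mul]
        _ ≤ _ := by gcongr
    calc 4 * Real.exp (2 * (b * R)) * ((p : ℝ) ^ 2 + 1) *
          (p.factorial * (3 * Real.exp (2 * (b * R))) ^ p)
        ≤ Real.exp (2 * R) * Real.exp (2 * (b * R)) * Real.exp (2 * (c₁ * R)) *
          Real.exp (c₂ * R ^ 2) := by gcongr
      _ = Real.exp ((2 + 2 * b + 2 * c₁) * R + c₂ * R ^ 2) := by
        rw [← Real.exp_add, ← Real.exp_add, ← Real.exp_add]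
        ring_nf
      _ ≤ Real.exp ((2 + 2 * b + 2 * c₁) * R ^ 2 + c₂ * R ^ 2) := by gcongr
      _ = _ := by ring_nf

variable (d B C) in
theorem exists_norm_laxNum_le : ∃ c : ℝ, 0 ≤ c ∧ ∀ R, 1 ≤ R → ∀ z : Fin d → ℂ, ‖z‖ ≤ R →
    ‖laxDen d B C R z‖ ≤ Real.exp (c * R ^ 2) ∧
      ∀ i, ‖laxNum d B C R z i‖ ≤ Real.exp (c * R ^ 2) := by
  obtain ⟨c, hc, h⟩ := exists_norm_baker_le d B C
  choose k hk using norm_laxCoef_le (d + 1)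
  set β : ℝ := ∑ a, ∑ b, (‖B a b‖ + ‖C a b‖) with hβ
  have hβ0 : 0 ≤ β := by positivity
  have hβ' : ∀ a b, ‖B a b‖ + ‖C a b‖ ≤ β := fun a b =>
    (Finset.single_le_sum (f := fun b => ‖B a b‖ + ‖C a b‖) (fun _ _ => by positivity)
      (Finset.mem_univ b)).trans (Finset.single_le_sum
        (f := fun a => ∑ b, (‖B a b‖ + ‖C a b‖)) (fun _ _ => by positivity) (Finset.mem_univ a))
  set c₃ : ℝ := 1 + β + c * (d + 1) with hc₃
  have hcd : 0 ≤ c * (d + 1) := by positivity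
  set K : ℕ := ∑ q ∈ Finset.range (d + 2), k q
  refine ⟨c₃ * (1 + K), by positivity, fun R hR z hz => ?_⟩
  obtain ⟨hθ, hN⟩ := h R hR z hz
  have hR2 : 1 ≤ R ^ 2 := one_le_pow₀ hR
  set Λ := Real.exp (c₃ * R ^ 2) with hΛ
  have hp : ∀ s ≤ d + 1, Real.exp (c * R ^ 2) ^ s ≤ Real.exp (c * (d + 1) * R ^ 2) := by
    intro s hs
    rw [← Real.exp_nat_mul]
    have : (s : ℝ) ≤ d + 1 := by exact_mod_cast hs
    apply Real.exp_le_exp.2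
    calc s * (c * R ^ 2) ≤ (d + 1) * (c * R ^ 2) := by gcongr
      _ = _ := by ring
  have hΛ1 : Real.exp (c * (d + 1) * R ^ 2) ≤ Λ := by
    rw [hΛ]
    gcongr
    linarith
  have hΛβ : β + 1 ≤ Real.exp (β * R ^ 2) :=
    (Real.add_one_le_exp β).trans (Real.exp_le_exp.2 (le_mul_of_one_le_right hβ0 hR2))
  have hΛ2 : 2 ≤ Λ := by
    have e1 : 1 ≤ c₃ * R ^ 2 := by nlinarith
    linarith [Real.add_one_le_exp (c₃ * R ^ 2)]
  have hΛ0 : 1 ≤ Λ := by linarith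
  have hΛp : Λ ^ (1 + K) = Real.exp (c₃ * (1 + K) * R ^ 2) := by
    rw [hΛ, ← Real.exp_nat_mul]
    push_cast
    ring_nf
  rw [← hΛp]
  constructor
  · rw [laxDen, norm_pow]
    calc ‖bakerDen d B C R z‖ ^ (d + 1) ≤ Real.exp (c * R ^ 2) ^ (d + 1) := by gcongr
      _ ≤ Λ := (hp _ le_rfl).trans hΛ1
      _ ≤ Λ ^ (1 + K) := by simpa using pow_le_pow_right₀ hΛ0 (show 1 ≤ 1 + K by omega)
  · intro i
    have hi : (i.1 : ℕ) ≤ d + 1 := by have := i.1.2; omega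
    have e1 : ‖laxCoef (d + 1) B (bakerDen d B C R z ^ (d + 1) • C) (bakerCoef d B C R z)
        (d + 1 - i.1) i.2.1 i.2.2‖ ≤ Λ ^ k (d + 1 - i.1) := by
      refine hk _ Λ B _ _ hΛ2 (fun a b => ?_) (fun a b => ?_) (fun s hs a b => ?_) _ _
      · have e2 : β + 1 ≤ Λ := hΛβ.trans (Real.exp_le_exp.2 (by gcongr; linarith))
        linarith [hβ' a b, norm_nonneg (C a b)]
      · rw [Matrix.smul_apply, norm_smul, norm_pow]
        calc ‖bakerDen d B C R z‖ ^ (d + 1) * ‖C a b‖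
            ≤ Real.exp (c * R ^ 2) ^ (d + 1) * Real.exp (β * R ^ 2) := by
              gcongr
              linarith [hβ' a b, norm_nonneg (B a b)]
          _ ≤ Real.exp (c * (d + 1) * R ^ 2) * Real.exp (β * R ^ 2) := by
              gcongr
              exact hp _ le_rfl
          _ = Real.exp ((c * (d + 1) + β) * R ^ 2) := by rw [← Real.exp_add]; ring_nf
          _ ≤ Λ := Real.exp_le_exp.2 (by gcongr; linarith)
      · rw [bakerCoef]
        split_ifs with hs0
        · rw [one_apply]
          split_ifs
          · simpa using hΛ0
          · simpa using zero_le_one.trans hΛ0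
        · rw [Matrix.smul_apply, norm_smul, norm_pow, tailCoef_apply]
          have e2 : ‖bakerNum d B C R z b (-s, a)‖ ≤ Real.exp (c * R ^ 2) :=
            (lp.norm_apply_le_norm one_ne_zero _ _).trans (hN b)
          calc ‖bakerDen d B C R z‖ ^ (s - 1) * ‖bakerNum d B C R z b (-s, a)‖
              ≤ Real.exp (c * R ^ 2) ^ (s - 1) * Real.exp (c * R ^ 2) := by gcongr
            _ = Real.exp (c * R ^ 2) ^ s := by
              rw [← pow_succ, Nat.sub_add_cancel (Nat.one_le_iff_ne_zero.2 hs0)]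
            _ ≤ Λ := (hp s (by omega)).trans hΛ1
    have e3 : k (d + 1 - i.1) ≤ K := Finset.single_le_sum (f := k) (fun _ _ => Nat.zero_le _)
      (Finset.mem_range.2 (by omega))
    rw [laxNum, norm_mul, norm_pow, show Λ ^ (1 + K) = Λ * Λ ^ K by ring]
    calc ‖bakerDen d B C R z‖ ^ (i.1 : ℕ) * _ ≤ Real.exp (c * R ^ 2) ^ (i.1 : ℕ) *
          Λ ^ k (d + 1 - i.1) := by
            gcongr
      _ ≤ Λ * Λ ^ K := by
        gcongr
        exact (hp _ hi).trans hΛ1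

theorem exists_le_norm_laxDen {T : LoopOp} (hT : T * (1 - hankelOp d B C z) = 1) :
    ∃ c : ℝ, 0 ≤ c ∧ ∀ R, 1 ≤ R → ‖z‖ ≤ R → Real.exp (-(c * R ^ 2)) ≤ ‖laxDen d B C R z‖ := by
  set ℓ := max 1 ‖T‖ with hℓ
  have hℓ1 : 1 ≤ ℓ := le_max_left _ _
  set x := Real.log (2 * ℓ) with hx
  have hx0 : 0 ≤ x := Real.log_nonneg (by linarith)
  set c₁ : ℝ := 2 * (d * (4 * flowBound d B C + 2)) with hc₁
  have hc₁0 : 0 ≤ c₁ := by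
    have := flowBound_nonneg (d := d) (B := B) (C := C)
    positivity
  refine ⟨(c₁ ^ 2 + c₁ * x) * (d + 1), by positivity, fun R hR hz => ?_⟩
  have hK := norm_hankelOp_sub_trunc_le (B := B) (C := C) hz
  set N := truncOrder d B C R with hN
  have h1 := one_le_of_leftInverse (norm_truncFn_le N) (norm_truncVec_le N) (truncFn_truncVec N) hK
    hT (le_max_right 1 ‖T‖)
  have hpR : (Fintype.card (Fin N × Fin 2) : ℝ) ≤ c₁ * R := by
    have e1 := truncOrder_le (d := d) (B := B) (C := C) hR
    rw [Fintype.card_prod, Fintype.card_fin, Fintype.card_fin, hc₁]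
    push_cast
    linarith
  have h2 := factorial_mul_pow_le (ℓ := 2 * ℓ) hR hc₁0 hx0 hpR (by positivity) (by
    rw [← Real.exp_log (show 0 < 2 * ℓ by positivity)]
    exact Real.exp_le_exp.2 (le_mul_of_one_le_right hx0 hR))
  have h3 : Real.exp (-((c₁ ^ 2 + c₁ * x) * R ^ 2)) ≤ ‖bakerDen d B C R z‖ := by
    rw [Real.exp_neg, inv_le_iff_one_le_mul₀ (Real.exp_pos _), mul_comm]
    exact h1.trans (by gcongr; exact le_rfl)
  rw [laxDen, norm_pow]
  calc Real.exp (-((c₁ ^ 2 + c₁ * x) * (d + 1) * R ^ 2))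
      = Real.exp (-((c₁ ^ 2 + c₁ * x) * R ^ 2)) ^ (d + 1) := by
        rw [← Real.exp_nat_mul]
        push_cast
        ring_nf
    _ ≤ _ := by gcongr

end Numerators

variable {d : ℕ} {B C : Matrix (Fin 2) (Fin 2) ℂ}

theorem Factorization.isBakerPair {z : Fin d → ℂ} {g g' : LoopOp}
    (h : Factorization d B C z g g') : IsBakerPair d B C z fun a => g (basisVec 0 a) := by
  refine ⟨h.normalized, fun a => ?_⟩
  have := DFunLike.congr_fun h.upper (basisVec 0 a)
  simpa only [mul_apply_eq_comp, projPos_basisVec, _root_.zero_apply] using this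

theorem laxOp_basisVec (a : Fin 2) : laxOp d B C (basisVec 0 a) =
    shift (d + 1) (comb (basisVec 0) B a) + comb (basisVec 0) C a := by
  ext ⟨j, c⟩
  rw [LoopSpace.add_apply, laxOp_apply, shift_apply, comb_apply, comb_apply]
  simp only [basisVec_apply, Fin.sum_univ_two]
  fin_cases c <;> fin_cases a <;> simp

/-- At a time where the factorization problem is solved by a commuting operator, the Lax matrix
returns to its initial value. -/
theorem Factorization.laxCoef_eq_laxInit {z : Fin d → ℂ} {g g' : LoopOp}
    (h : Factorization d B C z g g') (hz : IsRegularTime d B C z) {F : Fin 2 → LoopSpace}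
    (hF : IsBakerPair d B C z F) (i : Fin (d + 2) × Fin 2 × Fin 2) :
    laxCoef (d + 1) B C (fun s => tailCoef F s) (d + 1 - i.1) i.2.1 i.2.2 = laxInit d B C i := by
  have hFg := hF.eq hz h.isBakerPair
  have h1 : ∀ a, laxOp d B C (F a) = ∑ r ∈ Finset.range (d + 2), shift r
      (comb F (if r = d + 1 then B else if r = 0 then C else 0) a) := by
    intro a
    rw [Finset.sum_range_succ, if_pos rfl, Finset.sum_eq_single_of_mem 0 (by simp), if_neg (by simp),
      if_pos rfl, hFg, ← mul_apply_eq_comp, h.commutant.2.eq, mul_apply_eq_comp, laxOp_basisVec,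
      map_add, ← mul_apply_eq_comp, ← (h.commutant.1 _).eq, mul_apply_eq_comp, map_comb, map_comb,
      add_comm, Nat.cast_zero, shift_zero, Nat.cast_add, Nat.cast_one, map_comb,
      one_apply_eq_self, map_comb]
    · intro r hr hr0
      rw [if_neg (by have := Finset.mem_range.1 hr; omega), if_neg hr0, comb_zero, map_zero]
  have h2 := hF.normalized.eq_zero_of_sum (d + 2) (Z := fun r =>
    laxCoef (d + 1) B C (fun s => tailCoef F s) (d + 1 - r) -
      (if r = d + 1 then B else if r = 0 then C else 0)) (fun a => by
    simp only [comb_sub, map_sub, Finset.sum_sub_distrib]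
    rw [← h1, ← hF.laxOp_eq hz, sub_self]) i.1 i.1.2
  rw [sub_eq_zero.1 h2, laxInit]
  split_ifs <;> rfl

theorem fderiv_laxNum_div_laxDen {z : Fin d → ℂ} {R : ℝ}
    (hR : ∀ᶠ w in 𝓝 z, ‖w‖ ≤ R) (hz : ∀ᶠ w in 𝓝 z, IsRegularTime d B C w)
    (h0 : bakerDen d B C R z ≠ 0) (l : Fin d) (i : Fin (d + 2) × Fin 2 × Fin 2) :
    fderiv ℂ (fun w => laxNum d B C R w i / laxDen d B C R w) z (Pi.single l 1) =
      aeval (fun i => laxNum d B C R z i / laxDen d B C R z) (laxSystem d l i) := by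
  have hRz := hR.self_of_nhds
  set γ : ℂ → Fin d → ℂ := fun t => z + t • Pi.single l 1 with hγ
  have hγ0 : γ 0 = z := by simp [hγ]
  have hγ' : HasDerivAt γ (Pi.single l 1) 0 := by
    have := ((hasDerivAt_id (0 : ℂ)).smul_const (Pi.single l (1 : ℂ))).const_add z
    rwa [one_smul] at this
  have hγc : Tendsto γ (𝓝 0) (𝓝 z) := by simpa [hγ0] using hγ'.continuousAt.tendsto
  have hlift : ∀ {V : Type} [NormedAddCommGroup V] [NormedSpace ℂ V] {f : (Fin d → ℂ) → V},
      AnalyticAt ℂ f z → HasDerivAt (fun t => f (γ t)) (fderiv ℂ f z (Pi.single l 1)) 0 := by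
    intro V _ _ f hf
    have hf' : HasFDerivAt f (fderiv ℂ f z) (γ 0) := by
      rw [hγ0]
      exact hf.differentiableAt.hasFDerivAt
    exact hf'.comp_hasDerivAt (0 : ℂ) hγ'
  have hne : ∀ᶠ w in 𝓝 z, bakerDen d B C R w ≠ 0 :=
    (analyticAt_bakerDen hRz).continuousAt.eventually_ne h0
  set Φ : (Fin d → ℂ) → Fin 2 → LoopSpace :=
    fun w a => (bakerDen d B C R w)⁻¹ • bakerNum d B C R w a with hΦ
  have hΦB : ∀ᶠ w in 𝓝 z, IsBakerPair d B C w (Φ w) := by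
    filter_upwards [hR, hz, hne] with w h1 h2 h3 using bakerDen_smul_isBakerPair h1 h2 h3
  set y : Fin (d + 2) × Fin 2 × Fin 2 → (Fin d → ℂ) → ℂ :=
    fun i w => laxNum d B C R w i / laxDen d B C R w with hy
  have hyΦ : ∀ᶠ w in 𝓝 z, ∀ i, y i w =
      laxCoef (d + 1) B C (fun s => tailCoef (Φ w) s) (d + 1 - i.1) i.2.1 i.2.2 := by
    filter_upwards [hΦB, hne] with w h1 h2 i using laxNum_div_laxDen h1.normalized rfl h2 i
  have hya : ∀ i, AnalyticAt ℂ (y i) z := fun i =>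
    (analyticAt_laxNum hRz i).div (analyticAt_laxDen hRz) (pow_ne_zero _ h0)
  have key := IsBakerPair.lax_deriv_eq (l := l) (φ := fun t => Φ (γ t))
    (φ' := fun a => fderiv ℂ (fun w => Φ w a) z (Pi.single l 1)) hz
    (fun a => hlift (((analyticAt_bakerDen hRz).inv h0).smul (analyticAt_bakerNum hRz a)))
    (hγc.eventually hΦB)
    (A := fun t r => laxCoef (d + 1) B C (fun s => tailCoef (Φ (γ t)) s) (d + 1 - r))
    (A' := fun r => Matrix.of fun a b => if h : r < d + 2 then
      fderiv ℂ (y (⟨r, h⟩, a, b)) z (Pi.single l 1) else 0) (fun _ _ => rfl)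
    (fun r hr b a => by
      rw [of_apply, dif_pos hr]
      refine (hlift (hya (⟨r, hr⟩, b, a))).congr_of_eventuallyEq ?_
      filter_upwards [hγc.eventually hyΦ] with t ht
      exact (ht (⟨r, hr⟩, b, a)).symm) i.1.2
  have key2 := congrFun (congrFun key i.2.1) i.2.2
  rw [of_apply, dif_pos i.1.2] at key2
  rw [aeval_laxSystem (A := fun r => laxCoef (d + 1) B C (fun s => tailCoef (Φ (γ 0)) s)
    (d + 1 - r)), ← key2]
  intro i
  rw [hγ0]
  exact hyΦ.self_of_nhds i

theorem exists_uniformization {e : Fin d → Fin d → ℂ}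
    (he : ∀ j, ∃ g g', Factorization d B C (e j) g g') (M : ℕ) :
    ∃ C₁ R₀ : ℝ, 0 ≤ C₁ ∧ ∀ R, R₀ ≤ R → ∃ Θ X,
      Uniformization (laxSystem d) (laxInit d B C) e M C₁ R Θ X := by
  obtain ⟨c, hc, hcb⟩ := exists_norm_laxNum_le d B C
  have hlow : ∀ m : Fin d → Fin M, ∃ c : ℝ, 0 ≤ c ∧ ∀ R, 1 ≤ R →
      ‖gridPoint e fun j => (m j : ℕ)‖ ≤ R →
      Real.exp (-(c * R ^ 2)) ≤ ‖laxDen d B C R (gridPoint e fun j => (m j : ℕ))‖ := by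
    intro m
    obtain ⟨g, g', h⟩ := Factorization.exists_gridPoint he fun j => (m j : ℕ)
    obtain ⟨T, hT⟩ := h.exists_leftInverse
    exact exists_le_norm_laxDen hT
  choose b hb hbl using hlow
  refine ⟨c + ∑ m, b m, 1 + ∑ m : Fin d → Fin M, ‖gridPoint e fun j => (m j : ℕ)‖,
    add_nonneg hc (Finset.sum_nonneg fun m _ => hb m), fun R hR =>
    ⟨laxDen d B C R, fun i z => laxNum d B C R z i, ?_⟩⟩
  have hR1 : 1 ≤ R := le_trans (le_add_of_nonneg_right (by positivity)) hR
  have hS : 0 ≤ ∑ m, b m := Finset.sum_nonneg fun m _ => hb m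
  have hball : ∀ z ∈ Metric.ball (0 : Fin d → ℂ) R, ‖z‖ ≤ R := fun z hz =>
    (mem_ball_zero_iff.1 hz).le
  have hgrid : ∀ m : Fin d → ℕ, (∀ j, m j < M) → ‖gridPoint e m‖ < R := by
    intro m hm
    have := Finset.single_le_sum (f := fun m : Fin d → Fin M =>
      ‖gridPoint e fun j => (m j : ℕ)‖) (fun _ _ => norm_nonneg _)
      (Finset.mem_univ fun j => (⟨m j, hm j⟩ : Fin M))
    dsimp only at this
    linarith
  have hlow : ∀ m : Fin d → ℕ, (∀ j, m j < M) →
      Real.exp (-((c + ∑ m, b m) * R ^ 2)) ≤ ‖laxDen d B C R (gridPoint e m)‖ := by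
    intro m hm
    refine le_trans (Real.exp_le_exp.2 (neg_le_neg ?_)) (hbl (fun j => ⟨m j, hm j⟩) R hR1
      (hgrid m hm).le)
    gcongr
    exact (Finset.single_le_sum (f := b) (fun m _ => hb m) (Finset.mem_univ _)).trans
      (le_add_of_nonneg_left hc)
  have hne : ∀ m : Fin d → ℕ, (∀ j, m j < M) → bakerDen d B C R (gridPoint e m) ≠ 0 := by
    intro m hm h0
    have h1 := (Real.exp_pos _).trans_le (hlow m hm)
    rw [laxDen, h0, zero_pow (Nat.succ_ne_zero d), norm_zero] at h1
    exact lt_irrefl _ h1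
  have hup : Real.exp (c * R ^ 2) ≤ Real.exp ((c + ∑ m, b m) * R ^ 2) := by
    gcongr
    linarith
  refine ⟨fun z hz => analyticAt_laxDen (hball z hz),
    fun i z hz => analyticAt_laxNum (hball z hz) i,
    fun z hz => (hcb R hR1 z (hball z hz)).1.trans hup,
    fun i z hz => ((hcb R hR1 z (hball z hz)).2 i).trans hup, hlow, fun m hm i => ?_,
    fun m hm => ?_⟩
  · obtain ⟨g, g', h⟩ := Factorization.exists_gridPoint he m
    have hreg := h.eventually_isRegularTime.self_of_nhds
    have hB := bakerDen_smul_isBakerPair (hgrid m hm).le hreg (hne m hm)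
    have h1 := laxNum_div_laxDen hB.normalized rfl (hne m hm) i
    rw [h.laxCoef_eq_laxInit hreg hB, div_eq_iff (show laxDen d B C R (gridPoint e m) ≠ 0 from
      pow_ne_zero _ (hne m hm))] at h1
    rw [h1, mul_comm]
  · obtain ⟨g, g', h⟩ := Factorization.exists_gridPoint he m
    have hR' : ∀ᶠ w in 𝓝 (gridPoint e m), ‖w‖ ≤ R := by
      filter_upwards [continuous_norm.continuousAt.eventually_lt continuousAt_const (hgrid m hm)]
        with w hw using hw.le
    filter_upwards [hR'.eventually_nhds, h.eventually_isRegularTime.eventually_nhds,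
      (analyticAt_bakerDen (hgrid m hm).le).continuousAt.eventually_ne (hne m hm)]
      with w h1 h2 h3 l i using fderiv_laxNum_div_laxDen h1 h2 h3 l i

end Lemniscate

namespace Lemniscate

open Matrix

/-- The operator of multiplication by `∑ a i u ^ (-i - 1)`. -/
noncomputable def seriesOp (a : ℕ → ℂ) : LoopOp := ∑' i : ℕ, a i • shift (-(i + 1))

theorem hasSum_seriesOp {a : ℕ → ℂ} (ha : Summable fun i => ‖a i‖) :
    HasSum (fun i : ℕ => a i • shift (-(i + 1))) (seriesOp a) := by
  refine Summable.hasSum (Summable.of_norm (ha.of_nonneg_of_le (fun _ => norm_nonneg _) fun i => ?_))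
  rw [norm_smul]
  exact mul_le_of_le_one_right (norm_nonneg _) (norm_shift_le _)

section Factorization

variable {d : ℕ} {B C : Matrix (Fin 2) (Fin 2) ℂ} {a b : ℕ → ℂ}

theorem isLoopCommutant_seriesOp (ha : Summable fun i => ‖a i‖) :
    IsLoopCommutant d B C (seriesOp a) := by
  have h : ∀ {T : LoopOp}, (∀ k, Commute T (shift k)) → Commute T (seriesOp a) := by
    intro T hT
    refine ((hasSum_seriesOp ha).mul_left T).unique ?_
    have := (hasSum_seriesOp ha).mul_right T
    refine this.congr_fun ?_
    intro i
    exact ((hT _).smul_right _).eq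
  exact ⟨fun k => h fun l => commute_shift_shift k l, h fun l => (commute_shift_laxOp l).symm⟩

theorem seriesOp_sub (ha : Summable fun i => ‖a i‖) (hb : Summable fun i => ‖b i‖) :
    seriesOp (fun i => b i - a i) = seriesOp b - seriesOp a := by
  refine HasSum.tsum_eq ?_
  simpa only [sub_smul] using (hasSum_seriesOp hb).sub (hasSum_seriesOp ha)

theorem RaisesBy.laxOp : RaisesBy (d + 1) (laxOp d B C) :=
  (((RaisesBy.shift _).mul (RaisesBy.matOp B)).mono (by omega)).add
    ((RaisesBy.matOp C).mono (by omega))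

/-- Two series agreeing in frequency `-(d + 1)` whose flows preserve nonnegative frequencies give
a triangular factorization at the time given by the difference of their leading coefficients. -/
theorem exists_factorization (ha : Summable fun i => ‖a i‖) (hb : Summable fun i => ‖b i‖)
    (hab : b d = a d)
    (ha₁ : projNeg * NormedSpace.exp (seriesOp a * laxOp d B C) * projPos = 0)
    (ha₂ : projNeg * NormedSpace.exp (-(seriesOp a * laxOp d B C)) * projPos = 0)
    (hb₁ : projNeg * NormedSpace.exp (seriesOp b * laxOp d B C) * projPos = 0)
    (hb₂ : projNeg * NormedSpace.exp (-(seriesOp b * laxOp d B C)) * projPos = 0) :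
    ∃ g g', Factorization d B C (fun l => b l - a l) g g' := by
  let _ : NormedAlgebra ℚ LoopOp := NormedAlgebra.restrictScalars ℚ ℂ LoopOp
  set z : Fin d → ℂ := fun l => b l - a l with hz
  set t : ℕ → ℂ := fun i => if i ≤ d then 0 else b i - a i with ht
  have hts : Summable fun i => ‖t i‖ := by
    refine (hb.add ha).of_nonneg_of_le (fun _ => norm_nonneg _) fun i => ?_
    simp only [ht]
    split_ifs
    · simpa using add_nonneg (norm_nonneg _) (norm_nonneg _)
    · exact norm_sub_le _ _
  set Y := seriesOp t * laxOp d B C with hY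
  set H := seriesOp a * laxOp d B C with hH
  set K := seriesOp b * laxOp d B C with hK
  have hYc : IsLoopCommutant d B C Y := (isLoopCommutant_seriesOp hts).mul isLoopCommutant_laxOp
  have hKc : IsLoopCommutant d B C K := (isLoopCommutant_seriesOp hb).mul isLoopCommutant_laxOp
  have hHc : IsLoopCommutant d B C H := (isLoopCommutant_seriesOp ha).mul isLoopCommutant_laxOp
  have hnc : IsLoopCommutant d B C (-Y) := by simpa using hYc.smul (-1)
  have hHK : Commute H K := by
    refine Commute.mul_left ?_ hKc.2
    refine ((hasSum_seriesOp ha).mul_right K).unique ?_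
    refine ((hasSum_seriesOp ha).mul_left K).congr_fun fun i => ?_
    exact (((hKc.1 _).smul_left _).eq)
  have hsum : flowSum d B C z + Y = K - H := by
    rw [hK, hH, ← sub_mul, ← seriesOp_sub ha hb, hY, flowSum]
    have h1 : seriesOp (fun i => b i - a i) = ∑ l : Fin d, z l • shift (-(l + 1)) + seriesOp t := by
      refine HasSum.tsum_eq ?_
      have h2 : HasSum (fun i : ℕ => if i < d then (b i - a i) • shift (-(i + 1)) else 0)
          (∑ l : Fin d, z l • shift (-(l + 1))) := by
        have h3 := hasSum_sum_of_ne_finset_zero (L := .unconditional ℕ)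
          (s := Finset.range d)
          (f := fun i : ℕ => if i < d then (b i - a i) • shift (-(i + 1)) else 0)
          (fun i hi => if_neg (by simpa using hi))
        rw [Finset.sum_range] at h3
        simpa using h3
      refine (h2.add (hasSum_seriesOp hts)).congr_fun fun i => ?_
      simp only [ht]
      rcases lt_trichotomy i d with h | h | h
      · simp [h, h.le]
      · simp [h, hab]
      · simp [not_lt.2 h.le, not_le.2 h]
    rw [h1, add_mul, Finset.sum_mul]
    simp only [flowGen, smul_mul_assoc]
  have hup : flow d B C z * NormedSpace.exp Y = NormedSpace.exp K * NormedSpace.exp (-H) := by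
    rw [flow, ← NormedSpace.exp_add_of_commute (hYc.commute_flowSum z), hsum, sub_eq_add_neg,
      NormedSpace.exp_add_of_commute hHK.symm.neg_right]
  have hup' : NormedSpace.exp (-Y) * flow d B C (-z) = NormedSpace.exp H * NormedSpace.exp (-K) := by
    rw [flow, ← NormedSpace.exp_add_of_commute (hnc.commute_flowSum _).symm, flowSum_neg,
      ← neg_add_rev, hsum, neg_sub, sub_eq_add_neg, NormedSpace.exp_add_of_commute hHK.neg_right]
  have hYr : RaisesBy (-1) Y := by
    rw [hY]
    refine RaisesBy.hasSum ((hasSum_seriesOp hts).mul_right (laxOp d B C)) fun i => ?_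
    rw [smul_mul_assoc]
    by_cases hi : i ≤ d
    · simpa [ht, hi] using RaisesBy.zero
    · exact RaisesBy.smul _ (((RaisesBy.shift _).mul RaisesBy.laxOp).mono (by omega))
  have hYr' : RaisesBy (-1) (-Y) := by simpa using hYr.smul (-1)
  have hlow : ∀ {T : LoopOp}, RaisesBy (-1) T →
      projPos * NormedSpace.exp T * projNeg = 0 := fun hT => by
    refine RaisesBy.projPos_mul_mul_projNeg ?_
    simpa using (hT.exp_sub_one.mono (by omega)).add RaisesBy.one
  refine ⟨NormedSpace.exp Y, NormedSpace.exp (-Y), hYc.exp, hnc.exp, ?_, ?_, hlow hYr, hlow hYr',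
    fun a => ?_, ?_, ?_⟩
  · rw [← NormedSpace.exp_add_of_commute (Commute.refl Y).neg_right, add_neg_cancel,
      NormedSpace.exp_zero]
  · rw [← NormedSpace.exp_add_of_commute (Commute.refl Y).neg_left, neg_add_cancel,
      NormedSpace.exp_zero]
  · have h1 : NormedSpace.exp Y (basisVec 0 a) =
        (NormedSpace.exp Y - 1) (basisVec 0 a) + basisVec 0 a := by simp
    have h2 : projPos ((NormedSpace.exp Y - 1) (basisVec 0 a)) = 0 := by
      ext ⟨j, b⟩
      rw [projPos_apply]
      split_ifs with hj
      · refine hYr.exp_sub_one 1 _ (fun j hj b => ?_) j (by simpa using hj) b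
        rw [basisVec_apply, if_neg (by omega)]
      · rfl
    rw [h1, map_add, h2, projPos_basisVec, zero_add]
  · rw [hup]
    exact mul_corner_zero' hb₁ ha₂
  · rw [hup']
    exact mul_corner_zero' ha₁ hb₂

end Factorization

theorem exists_rootOfUnity_combination {d : ℕ} {α : ℕ → ℂ} (hα : ∀ l < d, α l ≠ 0) {ζ : ℂ}
    (hζ : IsPrimitiveRoot ζ (d + 1)) (v : Fin d → ℂ) : ∃ c : Fin d → ℂ,
      v = ∑ j : Fin d, c j • fun l : Fin d => (ζ ^ (j + 1 : ℕ)) ^ (l + 1 : ℕ) * α l - α l := by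
  have hdet : IsUnit (vandermonde fun i : Fin (d + 1) => ζ ^ (i : ℕ)).det :=
    (det_vandermonde_ne_zero_iff.2 fun i j h =>
      Fin.ext (hζ.pow_inj i.2 j.2 h)).isUnit
  set w : Fin (d + 1) → ℂ := Fin.cons 0 fun l => v l / α l with hw
  set c := w ᵥ* (vandermonde fun i : Fin (d + 1) => ζ ^ (i : ℕ))⁻¹ with hc
  have hcV : c ᵥ* (vandermonde fun i : Fin (d + 1) => ζ ^ (i : ℕ)) = w := by
    rw [hc, vecMul_vecMul, nonsing_inv_mul _ hdet, vecMul_one]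
  have hcoord : ∀ j : Fin (d + 1), ∑ i, c i * (ζ ^ (i : ℕ)) ^ (j : ℕ) = w j :=
    fun j => congrFun hcV j
  refine ⟨fun j => c j.succ, funext fun l => ?_⟩
  have h0 := hcoord 0
  have h1 := hcoord l.succ
  rw [Fin.sum_univ_succ] at h0 h1
  have hw0 : w 0 = 0 := rfl
  have hw1 : w l.succ = v l / α l := rfl
  simp only [Fin.val_zero, pow_zero, mul_one, Fin.val_succ, one_pow, hw0, hw1] at h0 h1
  have h2 : ∑ j : Fin d, c j.succ * ((ζ ^ (j + 1 : ℕ)) ^ (l + 1 : ℕ) - 1) = v l / α l := by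
    simp only [mul_sub, mul_one, Finset.sum_sub_distrib]
    linear_combination h1 - h0
  rw [eq_div_iff (hα l l.2), Finset.sum_mul] at h2
  rw [← h2, Finset.sum_apply]
  refine Finset.sum_congr rfl fun j _ => ?_
  simp only [Pi.smul_apply, smul_eq_mul]
  ring

/-- The period criterion: if the flow of the series `∑ α i u ^ (-i - 1)` and all its rotations
preserve nonnegative frequencies, then `α i` is transcendental for `i < d`. -/
theorem transcendental_of_preserves {d : ℕ} {B C : Matrix (Fin 2) (Fin 2) ℂ}
    (hB : ∀ i j, IsAlgebraic ℚ (B i j)) (hC : ∀ i j, IsAlgebraic ℚ (C i j))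
    (hBC : (C * B - B * C) 0 0 ≠ 0) {α : ℕ → ℂ} (hα : Summable fun i => ‖α i‖)
    (hα0 : ∀ l < d, α l ≠ 0)
    (hpos : ∀ ω : ℂ, ω ^ (d + 1) = 1 → projNeg * NormedSpace.exp
      (seriesOp (fun i => ω ^ (i + 1) * α i) * laxOp d B C) * projPos = 0)
    (hneg : ∀ ω : ℂ, ω ^ (d + 1) = 1 → projNeg * NormedSpace.exp
      (-(seriesOp (fun i => ω ^ (i + 1) * α i) * laxOp d B C)) * projPos = 0)
    {i₀ : ℕ} (hi₀ : i₀ < d) : Transcendental ℚ (α i₀) := by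
  intro halg
  set ζ : ℂ := Complex.exp (2 * Real.pi * Complex.I / (d + 1 : ℕ)) with hζd
  have hζ : IsPrimitiveRoot ζ (d + 1) := Complex.isPrimitiveRoot_exp _ (Nat.succ_ne_zero d)
  have hrot : ∀ j : ℕ, (ζ ^ j) ^ (d + 1) = 1 := fun j => by
    rw [← pow_mul, mul_comm, pow_mul, hζ.pow_eq_one, one_pow]
  have hsum : ∀ ω : ℂ, ω ^ (d + 1) = 1 → Summable fun i => ‖ω ^ (i + 1) * α i‖ := by
    intro ω hω
    simpa only [norm_mul, norm_pow, Complex.norm_eq_one_of_pow_eq_one hω (Nat.succ_ne_zero d),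
      one_pow, one_mul] using hα
  have hfac : ∀ j : Fin d, ∃ g g', Factorization d B C
      (fun l : Fin d => (ζ ^ (j + 1 : ℕ)) ^ (l + 1 : ℕ) * α l - α l) g g' := by
    intro j
    have h1 := hpos 1 (one_pow _)
    have h2 := hneg 1 (one_pow _)
    simp only [one_pow, one_mul] at h1 h2
    exact exists_factorization (b := fun i => (ζ ^ (j + 1 : ℕ)) ^ (i + 1) * α i) hα
      (hsum _ (hrot _)) (by rw [hrot, one_mul]) h1 h2 (hpos _ (hrot _)) (hneg _ (hrot _))
  have hζalg : IsAlgebraic ℚ ζ :=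
    (IsIntegral.of_pow (Nat.succ_pos d) (hζ.pow_eq_one ▸ isIntegral_one)).isAlgebraic
  refine periodic_schneider_lang (by omega) (laxSystem d) (laxInit d B C) (fun i => ?_)
    (fun j l => (ζ ^ (j + 1 : ℕ)) ^ (l + 1 : ℕ) * α l - α l)
    (exists_rootOfUnity_combination hα0 hζ) ⟨i₀, hi₀⟩
    (fun j => (((hζalg.pow _).pow _).mul halg).sub halg)
    (fun j => (⟨d - j, by omega⟩, 0, 0)) ?_ (exists_uniformization hfac)
  · rw [laxInit]
    split_ifs
    · exact hB _ _
    · exact hC _ _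
    · exact isAlgebraic_zero
  · set A : ℕ → Matrix (Fin 2) (Fin 2) ℂ := fun r =>
      if r = d + 1 then B else if r = 0 then C else 0 with hA
    have hy : ∀ i, laxInit d B C i = A i.1 i.2.1 i.2.2 := fun i => by
      rw [laxInit, hA]
      dsimp only
      split_ifs <;> rfl
    have hM : (Matrix.of fun l j : Fin d => MvPolynomial.aeval (laxInit d B C)
        (laxSystem d l (⟨d - j, by omega⟩, 0, 0))) = diagonal fun _ => (C * B - B * C) 0 0 := by
      ext l j
      rw [of_apply, aeval_laxSystem hy, Finset.sum_range_succ', Finset.sum_eq_zero, zero_add]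
      · have hl := l.2
        have hj := j.2
        rw [diagonal_apply]
        simp only [hA, Nat.sub_zero, if_true, if_neg (Nat.succ_ne_zero d).symm]
        rcases lt_trichotomy (l : ℕ) j with h | h | h
        · rw [if_neg (fun h' => h.ne (congrArg Fin.val h')), if_pos (by omega),
            if_neg (show ¬d - (j : ℕ) + l + 1 = d + 1 by omega), if_neg (by omega)]
          simp
        · rw [if_pos (Fin.ext h), if_pos (by omega),
            if_pos (show d - (j : ℕ) + l + 1 = d + 1 by omega), Matrix.sub_apply]
        · rw [if_neg (fun h' => h.ne' (congrArg Fin.val h')), if_neg (by omega)]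
          rfl
      · intro s hs
        have hs := Finset.mem_range.1 hs
        have hl := l.2
        have : A (s + 1) = 0 := by
          rw [hA]
          dsimp only
          rw [if_neg (by omega), if_neg (by omega)]
        rw [this]
        simp
    rw [hM, det_diagonal]
    exact Finset.prod_ne_zero_iff.2 fun _ _ => hBC

end Lemniscate

namespace Lemniscate

open Metric

theorem hasSum_circleIntegral {ι : Type*} [Countable ι] {F : ι → ℂ → ℂ} {f : ℂ → ℂ} {b : ι → ℝ}
    {c : ℂ} {R : ℝ} (hF : ∀ i, ContinuousOn (F i) (sphere c |R|))
    (hb : ∀ i, ∀ z ∈ sphere c |R|, ‖F i z‖ ≤ b i) (hs : Summable b)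
    (h : ∀ z ∈ sphere c |R|, HasSum (fun i => F i z) (f z)) :
    HasSum (fun i => ∮ z in C(c, R), F i z) (∮ z in C(c, R), f z) := by
  have hmem : ∀ θ, circleMap c R θ ∈ sphere c |R| := circleMap_mem_sphere' c R
  refine intervalIntegral.hasSum_integral_of_dominated_convergence (fun i _ => |R| * b i)
    (fun i => ?_) (fun i => ?_) ?_ ?_ ?_
  · refine Continuous.aestronglyMeasurable ?_
    simp only [deriv_circleMap]
    exact ((continuous_circleMap 0 R).mul continuous_const).smul
      ((hF i).comp_continuous (continuous_circleMap c R) hmem)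
  · refine Filter.Eventually.of_forall fun θ _ => ?_
    rw [norm_smul, deriv_circleMap, norm_mul, Complex.norm_I, mul_one, norm_circleMap_zero]
    exact mul_le_mul_of_nonneg_left (hb i _ (hmem θ)) (abs_nonneg R)
  · exact Filter.Eventually.of_forall fun θ _ => hs.mul_left _
  · exact intervalIntegrable_const
  · exact Filter.Eventually.of_forall fun θ _ => (h _ (hmem θ)).const_smul _

theorem LoopSpace.summable_norm_apply (f : LoopSpace) (a : Fin 2) :
    Summable fun j : ℤ => ‖f (j, a)‖ :=
  f.summable_norm.comp_injective (Prod.mk_left_injective a)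

theorem norm_zpow_mul {u : ℂ} (hu : ‖u‖ = 1) (j : ℤ) (x : ℂ) : ‖u ^ j * x‖ = ‖x‖ := by
  rw [norm_mul, norm_zpow, hu, one_zpow, one_mul]

theorem summable_zpow_mul {u : ℂ} (hu : ‖u‖ = 1) (f : LoopSpace) (a : Fin 2) :
    Summable fun j : ℤ => u ^ j * f (j, a) :=
  Summable.of_norm (by simpa only [norm_zpow_mul hu] using f.summable_norm_apply a)

/-- Evaluation of a component of a loop at a point of the unit circle. -/
noncomputable def evalFn {u : ℂ} (hu : ‖u‖ = 1) (a : Fin 2) : LoopSpace →L[ℂ] ℂ :=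
  LinearMap.mkContinuous
    { toFun := fun f => ∑' j : ℤ, u ^ j * f (j, a)
      map_add' := fun f g => by
        rw [← (summable_zpow_mul hu f a).tsum_add (summable_zpow_mul hu g a)]
        simp only [LoopSpace.add_apply, mul_add]
      map_smul' := fun c f => by
        rw [RingHom.id_apply, smul_eq_mul, ← tsum_mul_left]
        simp only [LoopSpace.smul_apply, mul_left_comm] }
    1 fun f => by
      have h1 : ‖∑' j : ℤ, u ^ j * f (j, a)‖ ≤ ∑' j : ℤ, ‖f (j, a)‖ := by
        refine (norm_tsum_le_tsum_norm ?_).trans_eq ?_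
        · simpa only [norm_zpow_mul hu] using f.summable_norm_apply a
        · simp only [norm_zpow_mul hu]
      rw [one_mul, f.norm_eq]
      exact h1.trans (tsum_comp_le_tsum_of_inj f.summable_norm (fun _ => norm_nonneg _)
        (Prod.mk_left_injective a))

theorem hasSum_evalFn {u : ℂ} (hu : ‖u‖ = 1) (f : LoopSpace) (a : Fin 2) :
    HasSum (fun j : ℤ => u ^ j * f (j, a)) (evalFn hu a f) := (summable_zpow_mul hu f a).hasSum

section EvalFn

variable {u : ℂ} (hu : ‖u‖ = 1)

theorem evalFn_shift (k : ℤ) (f : LoopSpace) (a : Fin 2) :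
    evalFn hu a (shift k f) = u ^ k * evalFn hu a f := by
  have hu0 : u ≠ 0 := fun h => by simp [h] at hu
  have h1 := (hasSum_evalFn hu f a).mul_left (u ^ k)
  refine (hasSum_evalFn hu (shift k f) a).unique ?_
  rw [← (Equiv.addRight k).hasSum_iff]
  refine h1.congr_fun fun j => ?_
  simp only [Function.comp_apply, Equiv.coe_addRight, shift_apply, add_sub_cancel_right]
  rw [zpow_add₀ hu0]
  ring

theorem evalFn_matOp (A : Matrix (Fin 2) (Fin 2) ℂ) (f : LoopSpace) (a : Fin 2) :
    evalFn hu a (matOp A f) = ∑ b, A a b * evalFn hu b f := by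
  refine (hasSum_evalFn hu _ a).unique ?_
  have := hasSum_sum fun b (_ : b ∈ Finset.univ) => (hasSum_evalFn hu f b).mul_left (A a b)
  refine this.congr_fun fun j => ?_
  rw [matOp_apply, Finset.mul_sum]
  exact Finset.sum_congr rfl fun b _ => mul_left_comm _ _ _

theorem evalFn_laxOp (d : ℕ) (B C : Matrix (Fin 2) (Fin 2) ℂ) (f : LoopSpace) (a : Fin 2) :
    evalFn hu a (laxOp d B C f) = ∑ b, (u ^ (d + 1) * B a b + C a b) * evalFn hu b f := by
  rw [laxOp, _root_.add_apply, map_add, mul_apply_eq_comp, evalFn_shift, evalFn_matOp,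
    evalFn_matOp, Finset.mul_sum, ← Finset.sum_add_distrib]
  refine Finset.sum_congr rfl fun b _ => ?_
  rw [show (d : ℤ) + 1 = ((d + 1 : ℕ) : ℤ) by simp, zpow_natCast]
  ring

theorem evalFn_seriesOp {α : ℕ → ℂ} (hα : Summable fun i => ‖α i‖) {h : ℂ}
    (hh : HasSum (fun i : ℕ => α i * u ^ (-(i + 1) : ℤ)) h) (f : LoopSpace) (a : Fin 2) :
    evalFn hu a (seriesOp α f) = h * evalFn hu a f := by
  have h1 := (hasSum_seriesOp hα).mapL
    ((evalFn hu a).comp (ContinuousLinearMap.apply ℂ LoopSpace f))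
  refine h1.unique ((hh.mul_right (evalFn hu a f)).congr_fun fun i => ?_)
  simp [evalFn_shift, mul_assoc]

end EvalFn

theorem map_exp_apply_of_eigen {φ : LoopSpace →L[ℂ] ℂ} {T : LoopOp} {μ : ℂ}
    (h : ∀ f, φ (T f) = μ * φ f) (f : LoopSpace) :
    φ (NormedSpace.exp T f) = Complex.exp μ * φ f := by
  have hk : ∀ k : ℕ, φ ((T ^ k) f) = μ ^ k * φ f := by
    intro k
    induction k with
    | zero => simp
    | succ k ih => rw [pow_succ', mul_apply_eq_comp, h, ih, pow_succ']; ring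
  have h1 := (NormedSpace.exp_series_hasSum_exp' (𝕂 := ℂ) T).mapL
    (φ.comp (ContinuousLinearMap.apply ℂ LoopSpace f))
  have h2 := (NormedSpace.exp_series_hasSum_exp' (𝕂 := ℂ) μ).mul_right (φ f)
  rw [← Complex.exp_eq_exp_ℂ] at h2
  refine h1.unique (h2.congr_fun fun k => ?_)
  rw [smul_eq_mul, mul_assoc, ← hk, ← smul_eq_mul, ← map_smul]
  rfl

/-- A loop which extends holomorphically to the disc has no negative frequencies. -/
theorem eq_zero_of_evalFn_eq {f : LoopSpace} {a : Fin 2} {g : ℂ → ℂ} (hg : Differentiable ℂ g)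
    (h : ∀ {u : ℂ} (hu : ‖u‖ = 1), evalFn hu a f = g u) {j : ℤ} (hj : j < 0) : f (j, a) = 0 := by
  obtain ⟨k, rfl⟩ : ∃ k : ℕ, j = -(k + 1) := ⟨(-j - 1).toNat, by omega⟩
  have hnorm : ∀ z ∈ sphere (0 : ℂ) |1|, ‖z‖ = 1 := fun z hz => by simpa using hz
  have h1 : HasSum (fun i : ℤ => ∮ z in C(0, 1), f (i, a) * z ^ (k + i))
      (∮ z in C(0, 1), z ^ (k : ℤ) * g z) := by
    refine hasSum_circleIntegral (b := fun i => ‖f (i, a)‖) (fun i => ?_) (fun i z hz => ?_)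
      (f.summable_norm_apply a) fun z hz => ?_
    · refine continuousOn_const.mul (continuousOn_id.zpow₀ _ fun z hz => Or.inl fun h0 => ?_)
      have := hnorm z hz
      simp [show z = 0 from h0] at this
    · rw [mul_comm, norm_zpow_mul (hnorm z hz)]
    · have hz0 : z ≠ 0 := fun h0 => by simpa [h0] using hnorm z hz
      rw [← h (hnorm z hz)]
      refine ((hasSum_evalFn (hnorm z hz) f a).mul_left (z ^ (k : ℤ))).congr_fun fun i => ?_
      rw [zpow_add₀ hz0]
      ring
  have h2 : (∮ z in C(0, 1), z ^ (k : ℤ) * g z) = 0 := by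
    refine Complex.circleIntegral_eq_zero_of_differentiable_on_off_countable zero_le_one
      Set.countable_empty ?_ fun z _ => ?_
    · simp only [zpow_natCast]
      exact ((continuous_pow k).mul hg.continuous).continuousOn
    · simp only [zpow_natCast]
      exact (differentiableAt_pow k).mul (hg z)
  have h3 : ∀ i : ℤ, (∮ z in C(0, 1), f (i, a) * z ^ (k + i)) =
      if i = -(k + 1) then 2 * Real.pi * Complex.I * f (i, a) else 0 := by
    intro i
    rw [circleIntegral.integral_const_mul]
    split_ifs with hi
    · have : (fun z : ℂ => z ^ ((k : ℤ) + i)) = fun z => (z - 0)⁻¹ := by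
        funext z
        rw [hi, show (k : ℤ) + -(k + 1) = -1 by ring, zpow_neg_one, sub_zero]
      rw [this, circleIntegral.integral_sub_center_inv 0 one_ne_zero, mul_comm]
    · have := circleIntegral.integral_sub_zpow_of_ne (n := k + i) (by omega) 0 0 1
      simp only [sub_zero] at this
      rw [this, mul_zero]
  rw [h2] at h1
  simp only [h3] at h1
  have h4 := h1.unique (hasSum_single (-(k + 1) : ℤ) fun i hi => if_neg hi)
  rw [if_pos rfl] at h4
  exact (mul_eq_zero.1 h4.symm).resolve_left Complex.two_pi_I_ne_zero

theorem projNeg_mul_mul_projPos_eq_zero {T : LoopOp}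
    (h : ∀ j : ℤ, 0 ≤ j → ∀ b, ∀ i < 0, ∀ a, T (basisVec j b) (i, a) = 0) :
    projNeg * T * projPos = 0 := by
  refine ContinuousLinearMap.ext fun f => ?_
  have h1 := (lp.hasSum_single (p := 1) ENNReal.one_ne_top f).mapL (projNeg * T * projPos)
  refine h1.unique (hasSum_zero.congr_fun fun ⟨j, b⟩ => ?_)
  have h2 : (lp.single 1 (j, b) (f (j, b)) : LoopSpace) = f (j, b) • basisVec j b := by
    ext i
    rw [basisVec, LoopSpace.smul_apply]
    by_cases hi : i = (j, b)
    · subst hi; simp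
    · simp [hi]
  rw [h2, map_smul]
  have h3 : (projNeg * T * projPos) (basisVec j b) = 0 := by
    ext ⟨i, a⟩
    rw [mul_apply_eq_comp, mul_apply_eq_comp, projNeg_apply]
    split_ifs with hi
    · by_cases hj : 0 ≤ j
      · rw [show projPos (basisVec j b) = basisVec j b from ?_]
        · exact h j hj b i hi a
        · ext ⟨l, c⟩
          rw [projPos_apply, basisVec_apply]
          split_ifs with h1 h2 h2 <;> first | rfl | (exfalso; simp_all)
      · rw [show projPos (basisVec j b) = 0 from ?_, map_zero]
        ext ⟨l, c⟩
        rw [projPos_apply, basisVec_apply]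
        split_ifs with h1 h2 <;> first | rfl | omega
    · rfl
  rw [h3, smul_zero]

end Lemniscate

namespace Lemniscate

theorem evalFn_basisVec {u : ℂ} (hu : ‖u‖ = 1) (m : ℕ) (a b : Fin 2) :
    evalFn hu a (basisVec m b) = if a = b then u ^ m else 0 := by
  refine (hasSum_evalFn hu _ a).unique ?_
  have := hasSum_single (f := fun j : ℤ => u ^ j * basisVec m b (j, a)) (m : ℤ) fun j hj => by
    rw [basisVec_apply, if_neg (fun h => hj h.1), mul_zero]
  convert this using 1
  rw [basisVec_apply]
  simp

/-- If `exp (h(u) A(u)) = P(u) + Q(u) A(u)` on the unit circle with entire `P` and `Q`, the flow of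
`h` preserves nonnegative frequencies. -/
theorem projNeg_mul_exp_mul_projPos_eq_zero {d : ℕ} {c e : ℂ} {α : ℕ → ℂ}
    (hα : Summable fun i => ‖α i‖) {h P Q : ℂ → ℂ} (hP : Differentiable ℂ P)
    (hQ : Differentiable ℂ Q)
    (hh : ∀ u : ℂ, ‖u‖ = 1 → HasSum (fun i : ℕ => α i * u ^ (-(i + 1) : ℤ)) (h u))
    (hPQ : ∀ u : ℂ, ‖u‖ = 1 → ∃ y ≠ 0, y ^ 2 = (c - u ^ (d + 1)) * (u ^ (d + 1) - e) ∧
      P u = Complex.cosh (h u * y) ∧ y * Q u = Complex.sinh (h u * y)) :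
    projNeg * NormedSpace.exp (seriesOp α * laxOp d !![0, -1; 1, 0] !![0, c; -e, 0]) * projPos =
      0 := by
  set T := seriesOp α * laxOp d !![0, -1; 1, 0] !![0, c; -e, 0] with hT
  refine projNeg_mul_mul_projPos_eq_zero fun j hj b i hi a => ?_
  lift j to ℕ using hj
  have key : ∀ {u : ℂ} (hu : ‖u‖ = 1) (f : LoopSpace),
      evalFn hu 0 (NormedSpace.exp T f) = P u * evalFn hu 0 f +
        Q u * (c - u ^ (d + 1)) * evalFn hu 1 f ∧
      evalFn hu 1 (NormedSpace.exp T f) = Q u * (u ^ (d + 1) - e) * evalFn hu 0 f +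
        P u * evalFn hu 1 f := by
    intro u hu f
    obtain ⟨y, hy, hy2, hPu, hQu⟩ := hPQ u hu
    set p := c - u ^ (d + 1) with hp
    set q := u ^ (d + 1) - e with hq
    have hq0 : q ≠ 0 := fun h0 => pow_ne_zero 2 hy (by rw [hy2, h0, mul_zero])
    have h0 : ∀ f, evalFn hu 0 (T f) = h u * (p * evalFn hu 1 f) := fun f => by
      rw [hT, mul_apply_eq_comp, evalFn_seriesOp hu hα (hh u hu), evalFn_laxOp,
        Fin.sum_univ_two]
      change h u * ((u ^ (d + 1) * 0 + 0) * _ + (u ^ (d + 1) * -1 + c) * _) = _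
      ring
    have h1 : ∀ f, evalFn hu 1 (T f) = h u * (q * evalFn hu 0 f) := fun f => by
      rw [hT, mul_apply_eq_comp, evalFn_seriesOp hu hα (hh u hu), evalFn_laxOp,
        Fin.sum_univ_two]
      change h u * ((u ^ (d + 1) * 1 + -e) * _ + (u ^ (d + 1) * 0 + 0) * _) = _
      ring
    have hφ : ∀ y : ℂ, y ^ 2 = p * q → ∀ f,
        q * evalFn hu 0 (NormedSpace.exp T f) + y * evalFn hu 1 (NormedSpace.exp T f) =
          Complex.exp (h u * y) * (q * evalFn hu 0 f + y * evalFn hu 1 f) := by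
      intro y hy f
      exact map_exp_apply_of_eigen (φ := q • evalFn hu 0 + y • evalFn hu 1) (T := T) (μ := h u * y)
        (fun f => by
          simp only [_root_.add_apply, _root_.smul_apply, smul_eq_mul, h0, h1]
          linear_combination -(h u * evalFn hu 1 f) * hy) f
    have e1 := hφ y hy2 f
    have e2 := hφ (-y) (by rw [neg_sq, hy2]) f
    rw [Complex.cosh] at hPu
    rw [Complex.sinh] at hQu
    rw [mul_neg] at e2
    constructor
    · refine mul_left_cancel₀ hq0 ?_
      linear_combination (e1 + e2) / 2 - q * evalFn hu 0 f * hPu - y * evalFn hu 1 f * hQu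
        + Q u * evalFn hu 1 f * hy2
    · refine mul_left_cancel₀ hy ?_
      linear_combination (e1 - e2) / 2 - y * evalFn hu 1 f * hPu - q * evalFn hu 0 f * hQu
  have hpow : Differentiable ℂ fun u : ℂ => u ^ (d + 1) := differentiable_pow _
  have hm : Differentiable ℂ fun u : ℂ => u ^ j := differentiable_pow _
  have hp : Differentiable ℂ fun u : ℂ => c - u ^ (d + 1) := hpow.const_sub c
  have hq : Differentiable ℂ fun u : ℂ => u ^ (d + 1) - e := hpow.sub_const e
  have hδ : ∀ a b : Fin 2, Differentiable ℂ fun u : ℂ => if a = b then u ^ j else 0 := by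
    intro a b
    split_ifs
    · exact hm
    · exact differentiable_const 0
  obtain rfl | rfl : a = 0 ∨ a = 1 := by fin_cases a <;> simp
  · refine eq_zero_of_evalFn_eq (((hP.mul (hδ 0 b))).add ((hQ.mul hp).mul (hδ 1 b)))
      (fun hu => ?_) hi
    rw [(key hu _).1, evalFn_basisVec, evalFn_basisVec]
    rfl
  · refine eq_zero_of_evalFn_eq ((((hQ.mul hq).mul (hδ 0 b))).add (hP.mul (hδ 1 b)))
      (fun hu => ?_) hi
    rw [(key hu _).2, evalFn_basisVec, evalFn_basisVec]
    rfl

/-- The period criterion in terms of entire extensions. -/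
theorem transcendental_of_entire_extension {d : ℕ} {c e : ℂ} (hc : IsAlgebraic ℚ c)
    (he : IsAlgebraic ℚ e) (hce : c ≠ e) {α : ℕ → ℂ} (hα : Summable fun i => ‖α i‖)
    (hα0 : ∀ l < d, α l ≠ 0) {h P Q : ℂ → ℂ} (hP : Differentiable ℂ P) (hQ : Differentiable ℂ Q)
    (hh : ∀ u : ℂ, ‖u‖ = 1 → HasSum (fun i : ℕ => α i * u ^ (-(i + 1) : ℤ)) (h u))
    (hPQ : ∀ u : ℂ, ‖u‖ = 1 → ∃ y ≠ 0, y ^ 2 = (c - u ^ (d + 1)) * (u ^ (d + 1) - e) ∧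
      P u = Complex.cosh (h u * y) ∧ y * Q u = Complex.sinh (h u * y))
    {i₀ : ℕ} (hi₀ : i₀ < d) : Transcendental ℚ (α i₀) := by
  have hrot : ∀ ω : ℂ, ω ^ (d + 1) = 1 → ∀ ε : ℂ, ε = 1 ∨ ε = -1 → projNeg * NormedSpace.exp
      (seriesOp (fun i => ε * (ω ^ (i + 1) * α i)) * laxOp d !![0, -1; 1, 0] !![0, c; -e, 0]) *
        projPos = 0 := by
    intro ω hω ε hε
    have hω1 := Complex.norm_eq_one_of_pow_eq_one hω (Nat.succ_ne_zero d)
    have hω0 : ω ≠ 0 := fun h0 => by simp [h0] at hω1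
    have hε1 : ‖ε‖ = 1 := by rcases hε with rfl | rfl <;> simp
    have hdiv : Differentiable ℂ fun u : ℂ => u / ω := differentiable_id.div_const ω
    refine projNeg_mul_exp_mul_projPos_eq_zero (h := fun u => ε * h (u / ω))
      (P := fun u => P (u / ω)) (Q := fun u => ε * Q (u / ω)) ?_ (hP.comp hdiv)
      ((hQ.comp hdiv).const_mul ε) (fun u hu => ?_) fun u hu => ?_
    · simpa only [norm_mul, norm_pow, hω1, hε1, one_pow, one_mul] using hα
    · have hu0 : u ≠ 0 := fun h0 => by simp [h0] at hu
      refine ((hh (u / ω) (by rw [norm_div, hu, hω1, div_one])).mul_left ε).congr_fun fun i => ?_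
      rw [div_zpow, zpow_neg, zpow_neg, show (i : ℤ) + 1 = ((i + 1 : ℕ) : ℤ) by simp, zpow_natCast,
        zpow_natCast]
      field_simp
    · obtain ⟨y, hy, hy2, h1, h2⟩ := hPQ (u / ω) (by rw [norm_div, hu, hω1, div_one])
      refine ⟨y, hy, ?_, ?_, ?_⟩
      · rw [hy2, div_pow, hω, div_one]
      · rw [h1]
        rcases hε with rfl | rfl
        · rw [one_mul]
        · rw [neg_one_mul, neg_mul, Complex.cosh_neg]
      · rw [mul_left_comm, h2]
        rcases hε with rfl | rfl
        · rw [one_mul, one_mul]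
        · rw [neg_one_mul, neg_one_mul, neg_mul, Complex.sinh_neg]
  refine transcendental_of_preserves (B := !![0, -1; 1, 0]) (C := !![0, c; -e, 0])
    (fun i j => ?_) (fun i j => ?_) ?_ hα hα0 (fun ω hω => ?_) (fun ω hω => ?_) hi₀
  · fin_cases i <;> fin_cases j <;>
      simp [isAlgebraic_zero, isAlgebraic_one, isAlgebraic_one.neg]
  · fin_cases i <;> fin_cases j <;> simp [isAlgebraic_zero, hc, he.neg]
  · simpa [Matrix.mul_apply, Fin.sum_univ_two] using sub_ne_zero.2 hce
  · simpa only [one_mul] using hrot ω hω 1 (Or.inl rfl)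
  · have h1 := hrot ω hω (-1) (Or.inr rfl)
    have h2 : seriesOp (fun i => -1 * (ω ^ (i + 1) * α i)) =
        -seriesOp (fun i => ω ^ (i + 1) * α i) := by
      rw [seriesOp, seriesOp, ← tsum_neg]
      simp only [neg_one_mul, neg_smul]
    rwa [h2, neg_mul] at h1

end Lemniscate

namespace Lemniscate

open Metric Filter Topology

theorem differentiableAt_circleIntegral_mul_inv_sub {g x : ℂ → ℂ} {r : ℝ} (hr : 0 ≤ r)
    (hg : ContinuousOn g (sphere 0 r)) (hx : ContinuousOn x (sphere 0 r)) {u₀ : ℂ}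
    (hu₀ : u₀ ∉ x '' sphere 0 r) :
    DifferentiableAt ℂ (fun u => ∮ ξ in C(0, r), g ξ * (u - x ξ)⁻¹) u₀ := by
  have hK : IsCompact (x '' sphere 0 r) := (isCompact_sphere 0 r).image_of_continuousOn hx
  obtain ⟨ε, hε, hball⟩ := Metric.isOpen_iff.1 hK.isClosed.isOpen_compl u₀ hu₀
  have hcirc : ∀ θ, circleMap 0 r θ ∈ sphere (0 : ℂ) r := circleMap_mem_sphere 0 hr
  have hsep : ∀ u ∈ ball u₀ (ε / 2), ∀ ξ ∈ sphere (0 : ℂ) r, ε / 2 ≤ ‖u - x ξ‖ := by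
    intro u hu ξ hξ
    by_contra! h
    rw [mem_ball, dist_eq_norm, norm_sub_rev] at hu
    refine (hball ?_ : x ξ ∈ (x '' sphere 0 r)ᶜ) ⟨ξ, hξ, rfl⟩
    rw [mem_ball, dist_eq_norm, norm_sub_rev]
    calc ‖u₀ - x ξ‖ = ‖(u₀ - u) + (u - x ξ)‖ := by congr 1; ring
      _ ≤ ‖u₀ - u‖ + ‖u - x ξ‖ := norm_add_le _ _
      _ < ε := by linarith
  have hne : ∀ u ∈ ball u₀ (ε / 2), ∀ ξ ∈ sphere (0 : ℂ) r, u - x ξ ≠ 0 := fun u hu ξ hξ h => by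
    have := hsep u hu ξ hξ
    rw [h, norm_zero] at this
    linarith
  obtain ⟨B, hB⟩ := (isCompact_sphere (0 : ℂ) r).exists_bound_of_continuousOn hg
  have hgc : Continuous fun θ => g (circleMap 0 r θ) :=
    hg.comp_continuous (continuous_circleMap 0 r) hcirc
  have hxc : Continuous fun θ => x (circleMap 0 r θ) :=
    hx.comp_continuous (continuous_circleMap 0 r) hcirc
  have hdc : Continuous fun θ => deriv (circleMap 0 r) θ := by
    simp only [deriv_circleMap]
    exact (continuous_circleMap 0 r).mul continuous_const
  have hFc : ∀ u ∈ ball u₀ (ε / 2), Continuous fun θ =>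
      deriv (circleMap 0 r) θ • (g (circleMap 0 r θ) * (u - x (circleMap 0 r θ))⁻¹) :=
    fun u hu => hdc.smul (hgc.mul ((continuous_const.sub hxc).inv₀ fun θ => hne u hu _ (hcirc θ)))
  have hmem : u₀ ∈ ball u₀ (ε / 2) := mem_ball_self (half_pos hε)
  have hnhds : ball u₀ (ε / 2) ∈ 𝓝 u₀ := ball_mem_nhds u₀ (half_pos hε)
  refine (intervalIntegral.hasDerivAt_integral_of_dominated_loc_of_deriv_le
    (F := fun u θ => deriv (circleMap 0 r) θ • (g (circleMap 0 r θ) *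
      (u - x (circleMap 0 r θ))⁻¹))
    (F' := fun u θ => deriv (circleMap 0 r) θ • (g (circleMap 0 r θ) *
      (-1 / (u - x (circleMap 0 r θ)) ^ 2)))
    (bound := fun _ => r * (B * (1 / (ε / 2) ^ 2))) hnhds ?_ ?_ ?_ ?_ ?_ ?_).2.differentiableAt
  · filter_upwards [hnhds] with u hu
    exact (hFc u hu).aestronglyMeasurable
  · exact (hFc u₀ hmem).intervalIntegrable _ _
  · exact (hdc.smul (hgc.mul (continuous_const.div ((continuous_const.sub hxc).pow 2)
      fun θ => pow_ne_zero 2 (hne u₀ hmem _ (hcirc θ))))).aestronglyMeasurable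
  · refine Eventually.of_forall fun θ _ u hu => ?_
    have h1 : ‖deriv (circleMap 0 r) θ‖ = r := by
      rw [deriv_circleMap, norm_mul, Complex.norm_I, mul_one, norm_circleMap_zero, abs_of_nonneg hr]
    rw [norm_smul, h1, norm_mul, norm_div, norm_neg, norm_one, norm_pow]
    have h2 := hsep u hu _ (hcirc θ)
    have h3 := hB _ (hcirc θ)
    have hB0 : 0 ≤ B := (norm_nonneg _).trans h3
    gcongr
  · exact intervalIntegrable_const
  · refine Eventually.of_forall fun θ _ u hu => ?_
    exact (((((hasDerivAt_id u).sub_const _).fun_inv (hne u hu _ (hcirc θ))).const_mul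
      (g (circleMap 0 r θ))).fun_const_smul (deriv (circleMap 0 r) θ))

/-- The jump of a Cauchy-type integral across a simple zero `ξ₀` of `u - x`. -/
theorem circleIntegral_mul_inv_sub_sub {g x : ℂ → ℂ} {r : ℝ} (hr : 0 < r) {ξ₀ : ℂ}
    {A : Set ℂ} (hA : IsOpen A) (hsub : closedBall 0 1 \ ball 0 r ⊆ A)
    (hg : DifferentiableOn ℂ g A) (hx : DifferentiableOn ℂ x A) (h1 : r < ‖ξ₀‖) (h2 : ‖ξ₀‖ < 1)
    (hinj : ∀ ξ ∈ closedBall 0 1 \ ball 0 r, x ξ = x ξ₀ → ξ = ξ₀) (hd : deriv x ξ₀ ≠ 0) :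
    (∮ ξ in C(0, 1), g ξ * (x ξ₀ - x ξ)⁻¹) - (∮ ξ in C(0, r), g ξ * (x ξ₀ - x ξ)⁻¹) =
      -(2 * Real.pi * Complex.I) * (g ξ₀ / deriv x ξ₀) := by
  have hr1 : r < 1 := h1.trans h2
  have hξ₀ : ξ₀ ∈ A := hsub ⟨by simpa using h2.le, by simpa using h1.le⟩
  have hAn : A ∈ 𝓝 ξ₀ := hA.mem_nhds hξ₀
  have hD : DifferentiableOn ℂ (dslope x ξ₀) A := (Complex.differentiableOn_dslope hAn).2 hx
  set K : Set ℂ := closedBall 0 1 \ ball 0 r with hK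
  have hDne : ∀ ξ ∈ K, dslope x ξ₀ ξ ≠ 0 := by
    intro ξ hξ
    rcases eq_or_ne ξ ξ₀ with rfl | h
    · rwa [dslope_same]
    · rw [dslope_of_ne _ h, slope_def_field]
      exact div_ne_zero (sub_ne_zero.2 fun h' => h (hinj ξ hξ h')) (sub_ne_zero.2 h)
  set A' : Set ℂ := A ∩ {ξ | dslope x ξ₀ ξ ≠ 0} with hA'
  have hA'o : IsOpen A' := hD.continuousOn.isOpen_inter_preimage hA isOpen_ne
  have hKA' : K ⊆ A' := fun ξ hξ => ⟨hsub hξ, hDne ξ hξ⟩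
  set G : ℂ → ℂ := fun ξ => g ξ / dslope x ξ₀ ξ with hGdef
  have hG : DifferentiableOn ℂ G A' :=
    (hg.mono Set.inter_subset_left).div (hD.mono Set.inter_subset_left) fun ξ hξ => hξ.2
  have hξ₀' : ξ₀ ∈ A' := ⟨hξ₀, by simpa using hd⟩
  have hdG : DifferentiableOn ℂ (dslope G ξ₀) A' :=
    (Complex.differentiableOn_dslope (hA'o.mem_nhds hξ₀')).2 hG
  have hkey : ∀ ξ ∈ K, ξ ≠ ξ₀ →
      g ξ * (x ξ₀ - x ξ)⁻¹ = -dslope G ξ₀ ξ - G ξ₀ * (ξ - ξ₀)⁻¹ := by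
    intro ξ hξ h
    have h' : ξ - ξ₀ ≠ 0 := sub_ne_zero.2 h
    have hx' : x ξ - x ξ₀ ≠ 0 := sub_ne_zero.2 fun h' => h (hinj ξ hξ h')
    have e1 : G ξ = g ξ * (ξ - ξ₀) / (x ξ - x ξ₀) := by
      rw [hGdef]
      simp only
      rw [dslope_of_ne _ h, slope_def_field]
      field_simp
    rw [dslope_of_ne _ h, slope_def_field, e1, ← neg_sub (x ξ) (x ξ₀), inv_neg]
    field_simp
    ring
  have hInt : ∀ ρ, 0 < ρ → sphere (0 : ℂ) ρ ⊆ K → ρ ≠ ‖ξ₀‖ →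
      (∮ ξ in C(0, ρ), g ξ * (x ξ₀ - x ξ)⁻¹) =
        -(∮ ξ in C(0, ρ), dslope G ξ₀ ξ) - G ξ₀ * ∮ ξ in C(0, ρ), (ξ - ξ₀)⁻¹ := by
    intro ρ hρ hs hρξ
    have hne : ∀ ξ ∈ sphere (0 : ℂ) ρ, ξ ≠ ξ₀ := by
      rintro ξ hξ rfl
      exact hρξ (by simpa using (mem_sphere_zero_iff_norm.1 hξ).symm)
    have i1 : CircleIntegrable (dslope G ξ₀) 0 ρ :=
      (hdG.continuousOn.mono (hs.trans hKA')).circleIntegrable hρ.le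
    have i2 : CircleIntegrable (fun ξ => (ξ - ξ₀)⁻¹) 0 ρ :=
      ((continuousOn_id.sub continuousOn_const).inv₀
        fun ξ hξ => sub_ne_zero.2 (hne ξ hξ)).circleIntegrable hρ.le
    rw [circleIntegral.integral_congr hρ.le fun ξ hξ => hkey ξ (hs hξ) (hne ξ hξ)]
    have i3 : CircleIntegrable (fun ξ => -dslope G ξ₀ ξ) 0 ρ := i1.neg
    have i4 : CircleIntegrable (fun ξ => G ξ₀ * (ξ - ξ₀)⁻¹) 0 ρ :=
      IntervalIntegrable.const_mul i2 _
    have e : (fun ξ => -dslope G ξ₀ ξ) = fun ξ => (-1 : ℂ) * dslope G ξ₀ ξ := by simp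
    rw [circleIntegral.integral_sub i3 i4, circleIntegral.integral_const_mul, e,
      circleIntegral.integral_const_mul]
    ring
  have hs1 : sphere (0 : ℂ) 1 ⊆ K := fun ξ hξ =>
    ⟨sphere_subset_closedBall hξ, by
      rw [mem_sphere_zero_iff_norm] at hξ
      simp [hξ, hr1.le]⟩
  have hsr : sphere (0 : ℂ) r ⊆ K := fun ξ hξ => by
    rw [mem_sphere_zero_iff_norm] at hξ
    exact ⟨by simp [hξ, hr1.le], by simp [hξ]⟩
  have hannulus : (∮ ξ in C(0, 1), dslope G ξ₀ ξ) = ∮ ξ in C(0, r), dslope G ξ₀ ξ := by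
    refine Complex.circleIntegral_eq_of_differentiable_on_annulus_off_countable hr hr1.le
      Set.countable_empty (hdG.continuousOn.mono hKA') fun z hz => ?_
    refine hdG.differentiableAt (hA'o.mem_nhds (hKA' ⟨ball_subset_closedBall hz.1.1, fun h => ?_⟩))
    exact hz.1.2 (ball_subset_closedBall h)
  have hzero : (∮ ξ in C(0, r), (ξ - ξ₀)⁻¹) = 0 := by
    have hne : ∀ ξ ∈ closedBall (0 : ℂ) r, ξ - ξ₀ ≠ 0 := fun ξ hξ h => by
      rw [sub_eq_zero.1 h, mem_closedBall_zero_iff] at hξ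
      linarith
    refine Complex.circleIntegral_eq_zero_of_differentiable_on_off_countable hr.le
      Set.countable_empty ((continuousOn_id.sub continuousOn_const).inv₀ hne) fun z hz => ?_
    exact (differentiableAt_id.sub_const _).inv (hne z (ball_subset_closedBall hz.1))
  rw [hInt 1 one_pos hs1 h2.ne', hInt r hr hsr h1.ne, hannulus, hzero,
    circleIntegral.integral_sub_inv_of_mem_ball (by simpa using h2)]
  simp only [hGdef, dslope_same]
  ring

end Lemniscate

namespace Lemniscate

open Metric Filter Topology

theorem differentiable_tsum_div_factorial {m : ℕ → ℕ} (hm : ∀ j, j ≤ m j) :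
    Differentiable ℂ fun w : ℂ => ∑' j : ℕ, w ^ j / ((m j).factorial : ℂ) := by
  intro w
  have h : DifferentiableOn ℂ (fun w : ℂ => ∑' j : ℕ, w ^ j / ((m j).factorial : ℂ))
      (ball 0 (‖w‖ + 1)) := by
    refine Complex.differentiableOn_tsum_of_summable_norm
      (Real.summable_pow_div_factorial (‖w‖ + 1))
      (fun j => by fun_prop) isOpen_ball fun j z hz => ?_
    rw [norm_div, norm_pow, Complex.norm_natCast]
    have h1 := (mem_ball_zero_iff.1 hz).le
    have h2 : (j.factorial : ℝ) ≤ (m j).factorial := by exact_mod_cast Nat.factorial_le (hm j)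
    gcongr
  exact h.differentiableAt (isOpen_ball.mem_nhds (by simp))

theorem exists_entire_cosh_sinh_sqrt : ∃ C S : ℂ → ℂ, Differentiable ℂ C ∧ Differentiable ℂ S ∧
    ∀ y, C (y ^ 2) = Complex.cosh y ∧ y * S (y ^ 2) = Complex.sinh y := by
  refine ⟨_, _, differentiable_tsum_div_factorial (m := fun j => 2 * j) fun j => by omega,
    differentiable_tsum_div_factorial (m := fun j => 2 * j + 1) fun j => by omega, fun y => ⟨?_, ?_⟩⟩
  · rw [Complex.cosh_eq_tsum]
    simp only [pow_mul]
  · rw [Complex.sinh_eq_tsum, ← tsum_mul_left]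
    refine tsum_congr fun j => ?_
    rw [← pow_mul]
    ring

def annulus (t : ℝ) : Set ℂ := {ξ | t < ‖ξ‖ ∧ ‖ξ‖ < t⁻¹}

theorem isOpen_annulus (t : ℝ) : IsOpen (annulus t) :=
  (isOpen_lt continuous_const continuous_norm).inter (isOpen_lt continuous_norm continuous_const)

/-- A Joukowski-type uniformization of the curve `y ^ 2 = (c - u ^ (d + 1)) * (u ^ (d + 1) - e)`
with `c = κ * (1 - t) ^ 2`, `e = κ * (1 + t) ^ 2` near the cut joining its branch points. -/
structure IsUniformizer (d : ℕ) (t : ℝ) (κ : ℂ) (x : ℂ → ℂ) : Prop where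
  pos : 0 < t
  lt_one : t < 1
  ne_zero : κ ≠ 0
  differentiableOn : DifferentiableOn ℂ x (annulus t)
  pow_eq : ∀ ξ ∈ annulus t, x ξ ^ (d + 1) = κ * (1 + t ^ 2 + t * (ξ + ξ⁻¹))
  apply_inv : ∀ ξ ∈ annulus t, x ξ⁻¹ = x ξ

/-- The Cauchy-type integral along the circle of radius `r`. -/
noncomputable def periodFn (d : ℕ) (x : ℂ → ℂ) (r : ℝ) (u : ℂ) : ℂ :=
  (2 * (d + 1) : ℂ)⁻¹ * ∮ ξ in C(0, r), (x ξ ^ d * (Complex.I * ξ))⁻¹ * (u - x ξ)⁻¹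

namespace IsUniformizer

variable {d : ℕ} {t : ℝ} {κ : ℂ} {x : ℂ → ℂ}

theorem ne_zero_of_mem (ht : 0 < t) {ξ : ℂ} (hξ : ξ ∈ annulus t) : ξ ≠ 0 := by
  rintro rfl
  have := hξ.1
  rw [norm_zero] at this
  linarith

theorem inv_mem (ht : 0 < t) {ξ : ℂ} (hξ : ξ ∈ annulus t) : ξ⁻¹ ∈ annulus t := by
  have h0 : 0 < ‖ξ‖ := norm_pos_iff.2 (ne_zero_of_mem ht hξ)
  refine ⟨?_, ?_⟩
  · rw [norm_inv]
    exact (lt_inv_comm₀ ht h0).2 hξ.2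
  · rw [norm_inv]
    exact (inv_lt_inv₀ h0 ht).2 hξ.1

theorem apply_ne_zero (h : IsUniformizer d t κ x) {ξ : ℂ} (hξ : ξ ∈ annulus t) : x ξ ≠ 0 := by
  intro hx
  have ht := h.pos
  have h0 := ne_zero_of_mem h.pos hξ
  have h1 := h.pow_eq ξ hξ
  rw [hx, zero_pow (Nat.succ_ne_zero d)] at h1
  have h2 : (1 + t * ξ) * (1 + t * ξ⁻¹) = 0 := by
    have := (mul_eq_zero.1 h1.symm).resolve_left h.ne_zero
    rw [← this]
    field_simp
    ring
  have hn : ∀ η ∈ annulus t, 1 + (t : ℂ) * η ≠ 0 := by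
    intro η hη h3
    have h4 : ‖(t : ℂ) * η‖ = 1 := by
      rw [eq_neg_of_add_eq_zero_right h3, norm_neg, norm_one]
    rw [norm_mul, Complex.norm_real, Real.norm_eq_abs, abs_of_pos ht] at h4
    have := mul_lt_mul_of_pos_left hη.2 ht
    rw [mul_inv_cancel₀ ht.ne'] at this
    linarith
  exact (mul_eq_zero.1 h2).elim (hn ξ hξ) (hn _ (inv_mem ht hξ))

theorem eq_or_eq_inv (h : IsUniformizer d t κ x) {ξ η : ℂ} (hξ : ξ ∈ annulus t)
    (hη : η ∈ annulus t) (hx : x ξ = x η) : ξ = η ∨ ξ = η⁻¹ := by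
  have hξ0 := ne_zero_of_mem h.pos hξ
  have hη0 := ne_zero_of_mem h.pos hη
  have ht : (t : ℂ) ≠ 0 := by exact_mod_cast h.pos.ne'
  have h1 := h.pow_eq ξ hξ
  rw [hx, h.pow_eq η hη] at h1
  have h2 : ξ + ξ⁻¹ = η + η⁻¹ :=
    mul_left_cancel₀ ht (add_left_cancel (mul_left_cancel₀ h.ne_zero h1)).symm
  have h3 : (ξ - η) * (ξ * η - 1) = 0 := by
    field_simp at h2
    linear_combination h2
  rcases mul_eq_zero.1 h3 with h4 | h4
  · exact Or.inl (sub_eq_zero.1 h4)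
  · exact Or.inr (eq_inv_of_mul_eq_one_left (sub_eq_zero.1 h4))

theorem deriv_eq (h : IsUniformizer d t κ x) {ξ : ℂ} (hξ : ξ ∈ annulus t) :
    (d + 1) * x ξ ^ d * deriv x ξ = κ * t * (1 - (ξ ^ 2)⁻¹) := by
  have hn := (isOpen_annulus t).mem_nhds hξ
  have h1 := ((h.differentiableOn.differentiableAt hn).hasDerivAt).fun_pow (d + 1)
  have h2 : HasDerivAt (fun ξ : ℂ => κ * (1 + t ^ 2 + t * (ξ + ξ⁻¹)))
      (κ * (t * (1 + -(ξ ^ 2)⁻¹))) ξ :=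
    ((((hasDerivAt_id ξ).add (hasDerivAt_inv (ne_zero_of_mem h.pos hξ))).const_mul
      (t : ℂ)).const_add _).const_mul κ
  have h3 := h1.congr_of_eventuallyEq (f₁ := fun ξ : ℂ => κ * (1 + t ^ 2 + t * (ξ + ξ⁻¹)))
    (by filter_upwards [hn] with η hη using (h.pow_eq η hη).symm)
  have h4 := h2.unique h3
  push_cast at h4
  linear_combination -h4

theorem mem_annulus_of_le (h : IsUniformizer d t κ x) {r : ℝ} (hr : t < r) {ξ : ℂ}
    (h1 : r ≤ ‖ξ‖) (h2 : ‖ξ‖ ≤ 1) : ξ ∈ annulus t :=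
  ⟨hr.trans_le h1, h2.trans_lt ((one_lt_inv₀ h.pos).2 h.lt_one)⟩

theorem sphere_subset (h : IsUniformizer d t κ x) {r : ℝ} (hr : t < r) (hr1 : r ≤ 1) :
    sphere 0 r ⊆ annulus t := fun ξ hξ => by
  rw [mem_sphere_zero_iff_norm] at hξ
  exact h.mem_annulus_of_le hr hξ.ge (hξ.trans_le hr1)

theorem differentiableOn_kernel (h : IsUniformizer d t κ x) :
    DifferentiableOn ℂ (fun ξ => (x ξ ^ d * (Complex.I * ξ))⁻¹) (annulus t) := by
  refine ((h.differentiableOn.pow d).mul (differentiableOn_id.const_mul Complex.I)).inv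
    fun ξ hξ => ?_
  exact mul_ne_zero (pow_ne_zero d (h.apply_ne_zero hξ))
    (mul_ne_zero Complex.I_ne_zero (ne_zero_of_mem h.pos hξ))

theorem differentiableAt_periodFn (h : IsUniformizer d t κ x) {r : ℝ} (hr : t < r) (hr1 : r ≤ 1)
    {u : ℂ} (hu : u ∉ x '' sphere 0 r) : DifferentiableAt ℂ (periodFn d x r) u := by
  have hs := h.sphere_subset hr hr1
  exact (differentiableAt_circleIntegral_mul_inv_sub (h.pos.trans hr).le
    (h.differentiableOn_kernel.continuousOn.mono hs) (h.differentiableOn.continuousOn.mono hs)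
    hu).const_mul _

theorem exists_jump (h : IsUniformizer d t κ x) {r : ℝ} (hr : t < r) {ξ : ℂ} (h1 : r < ‖ξ‖)
    (h2 : ‖ξ‖ < 1) : ∃ y ≠ 0,
      y ^ 2 = (κ * (1 - t) ^ 2 - x ξ ^ (d + 1)) * (x ξ ^ (d + 1) - κ * (1 + t) ^ 2) ∧
      periodFn d x 1 (x ξ) * y = periodFn d x r (x ξ) * y - Real.pi * Complex.I := by
  have hξ := h.mem_annulus_of_le hr h1.le h2.le
  have hξ0 := ne_zero_of_mem h.pos hξ
  have ht : (t : ℂ) ≠ 0 := by exact_mod_cast h.pos.ne'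
  have hsq : ξ ^ 2 - 1 ≠ 0 := fun h3 => by
    have : ‖ξ‖ ^ 2 = 1 := by rw [← norm_pow, sub_eq_zero.1 h3, norm_one]
    nlinarith [norm_nonneg ξ]
  have hder := h.deriv_eq hξ
  have hx0 := h.apply_ne_zero hξ
  have hd0 : (d + 1 : ℂ) ≠ 0 := by exact_mod_cast d.succ_ne_zero
  have hd : deriv x ξ ≠ 0 := fun h3 => by
    rw [h3, mul_zero] at hder
    refine mul_ne_zero (mul_ne_zero h.ne_zero ht) ?_ hder.symm
    intro h4
    apply hsq
    rw [sub_eq_zero] at h4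
    rw [← inv_inv (ξ ^ 2), ← h4, inv_one, sub_self]
  have hsub : closedBall 0 1 \ ball 0 r ⊆ annulus t := fun η hη =>
    h.mem_annulus_of_le hr (by simpa using hη.2) (by simpa using hη.1)
  have hjump := circleIntegral_mul_inv_sub_sub (h.pos.trans hr) (isOpen_annulus t) hsub
    h.differentiableOn_kernel h.differentiableOn h1 h2 (fun η hη hxη => by
      refine (h.eq_or_eq_inv (hsub hη) hξ hxη).resolve_right fun h3 => ?_
      have h4 : ‖η‖ ≤ 1 := by simpa using hη.1
      rw [h3, norm_inv] at h4
      have := (one_lt_inv₀ (norm_pos_iff.2 hξ0)).2 h2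
      linarith) hd
  refine ⟨Complex.I * κ * t * (ξ - ξ⁻¹), ?_, ?_, ?_⟩
  · refine mul_ne_zero (mul_ne_zero (mul_ne_zero Complex.I_ne_zero h.ne_zero) ht) fun h3 => hsq ?_
    rw [sub_eq_zero] at h3
    rw [sq, sub_eq_zero]
    nth_rewrite 2 [h3]
    exact mul_inv_cancel₀ hξ0
  · rw [h.pow_eq ξ hξ, mul_pow, mul_pow, mul_pow, Complex.I_sq]
    field_simp
    ring
  · have hy : Complex.I * κ * t * (ξ - ξ⁻¹) = Complex.I * ξ * ((d + 1) * x ξ ^ d * deriv x ξ) := by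
      rw [hder]
      field_simp
    have hA : (2 * (d + 1) : ℂ)⁻¹ * (Complex.I * ξ * ((d + 1) * x ξ ^ d * deriv x ξ)) *
        ((x ξ ^ d * (Complex.I * ξ))⁻¹ / deriv x ξ) = 1 / 2 := by
      have := pow_ne_zero d hx0
      have := Complex.I_ne_zero
      field_simp
    rw [hy]
    unfold periodFn
    linear_combination (2 * (d + 1) : ℂ)⁻¹ * (Complex.I * ξ * ((d + 1) * x ξ ^ d * deriv x ξ)) *
      hjump - 2 * Real.pi * Complex.I * hA

end IsUniformizer

end Lemniscate

namespace Lemniscate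

open Metric Filter Topology

namespace IsUniformizer

variable {d : ℕ} {t : ℝ} {κ : ℂ} {x : ℂ → ℂ}

theorem isCompact_image (h : IsUniformizer d t κ x) {r : ℝ} (hr : t < r) (hr1 : r ≤ 1) :
    IsCompact (x '' sphere 0 r) :=
  (isCompact_sphere 0 r).image_of_continuousOn
    (h.differentiableOn.continuousOn.mono (h.sphere_subset hr hr1))

theorem notMem_image (h : IsUniformizer d t κ x) {r : ℝ} (hr : t < r) (hr1 : r < 1) {ξ : ℂ}
    (hξ : ‖ξ‖ = 1) : x ξ ∉ x '' sphere 0 r := by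
  rintro ⟨η, hη, hηξ⟩
  have h1 := h.sphere_subset hr hr1.le hη
  rw [mem_sphere_zero_iff_norm] at hη
  rcases h.eq_or_eq_inv h1 (h.mem_annulus_of_le hr (hξ ▸ hr1.le) hξ.le) hηξ with h2 | h2
  · rw [h2] at hη
    linarith
  · rw [h2, norm_inv, hξ, inv_one] at hη
    linarith

/-- Near a point of the cut, every point off the cut is the image of a point inside the unit
circle. -/
theorem eventually_mem_image (h : IsUniformizer d t κ x) {r : ℝ} (hr : t < r) (hr1 : r < 1) {ξ : ℂ}
    (hξ : ‖ξ‖ = 1) :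
    ∀ᶠ u in 𝓝 (x ξ), u ∈ x '' sphere 0 1 ∨ ∃ η, r < ‖η‖ ∧ ‖η‖ < 1 ∧ x η = u := by
  have hr0 : 0 < r := h.pos.trans hr
  have hmem : ξ ∈ annulus t := h.mem_annulus_of_le hr (hξ ▸ hr1.le) hξ.le
  have han : AnalyticAt ℂ x ξ := h.differentiableOn.analyticAt ((isOpen_annulus t).mem_nhds hmem)
  have hV : annulus r ∈ 𝓝 ξ := (isOpen_annulus r).mem_nhds
    ⟨by rwa [hξ], by rw [hξ]; exact (one_lt_inv₀ hr0).2 hr1⟩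
  have hsub : annulus r ⊆ annulus t := fun η hη =>
    ⟨hr.trans hη.1, hη.2.trans ((inv_lt_inv₀ hr0 h.pos).2 hr)⟩
  rcases han.eventually_constant_or_nhds_le_map_nhds with hc | hc
  · exfalso
    have : ∀ᶠ η in 𝓝 ξ, η ∈ ({ξ, ξ⁻¹} : Set ℂ) := by
      filter_upwards [hc, (isOpen_annulus t).mem_nhds hmem] with η h1 h2
      exact h.eq_or_eq_inv h2 hmem h1
    exact infinite_of_mem_nhds ξ this (Set.toFinite ({ξ, ξ⁻¹} : Set ℂ))
  · filter_upwards [hc (image_mem_map hV)] with u hu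
    obtain ⟨η, hη, rfl⟩ := hu
    rcases lt_trichotomy ‖η‖ 1 with h1 | h1 | h1
    · exact Or.inr ⟨η, hη.1, h1, rfl⟩
    · exact Or.inl ⟨η, by simpa using h1, rfl⟩
    · refine Or.inr ⟨η⁻¹, (inv_mem hr0 hη).1, ?_, h.apply_inv η (hsub hη)⟩
      rw [norm_inv]
      exact inv_lt_one_of_one_lt₀ h1

theorem exists_extension (h : IsUniformizer d t κ x) :
    ∃ P Q : ℂ → ℂ, Differentiable ℂ P ∧ Differentiable ℂ Q ∧ ∀ u ∉ x '' sphere 0 1, ∀ y,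
      y ^ 2 = (κ * (1 - t) ^ 2 - u ^ (d + 1)) * (u ^ (d + 1) - κ * (1 + t) ^ 2) →
        P u = Complex.cosh (periodFn d x 1 u * y) ∧
        y * Q u = Complex.sinh (periodFn d x 1 u * y) := by
  classical
  obtain ⟨C, S, hC, hS, hCS⟩ := exists_entire_cosh_sinh_sqrt
  obtain ⟨r, hr, hr1⟩ := exists_between h.lt_one
  set f : ℂ → ℂ := fun u =>
    (κ * (1 - t) ^ 2 - u ^ (d + 1)) * (u ^ (d + 1) - κ * (1 + t) ^ 2) with hf
  have hfd : Differentiable ℂ f := by fun_prop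
  set H : ℝ → ℂ → ℂ := fun r => periodFn d x r with hH
  set K := x '' sphere 0 1 with hK
  have hKc : IsCompact K := h.isCompact_image h.lt_one le_rfl
  have hdC : ∀ ρ, t < ρ → ρ ≤ 1 → ∀ u ∉ x '' sphere 0 ρ,
      DifferentiableAt ℂ (fun u => C (H ρ u ^ 2 * f u)) u ∧
      DifferentiableAt ℂ (fun u => H ρ u * S (H ρ u ^ 2 * f u)) u := by
    intro ρ h1 h2 u hu
    have hH := h.differentiableAt_periodFn h1 h2 hu
    have hw : DifferentiableAt ℂ (fun u => H ρ u ^ 2 * f u) u := (hH.pow 2).mul (hfd u)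
    exact ⟨(hC _).comp u hw, hH.mul ((hS _).comp u hw)⟩
  have hjump : ∀ ξ, r < ‖ξ‖ → ‖ξ‖ < 1 →
      C (H 1 (x ξ) ^ 2 * f (x ξ)) = -C (H r (x ξ) ^ 2 * f (x ξ)) ∧
      H 1 (x ξ) * S (H 1 (x ξ) ^ 2 * f (x ξ)) = -(H r (x ξ) * S (H r (x ξ) ^ 2 * f (x ξ))) := by
    intro ξ h1 h2
    obtain ⟨y, hy0, hyf, hy⟩ := h.exists_jump hr h1 h2
    have hsq : ∀ ρ, H ρ (x ξ) ^ 2 * f (x ξ) = (H ρ (x ξ) * y) ^ 2 := fun ρ => by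
      rw [mul_pow, hyf]
    have hc : Complex.cosh (H 1 (x ξ) * y) = -Complex.cosh (H r (x ξ) * y) := by
      rw [hH]
      simp only
      rw [hy, Complex.cosh_sub, Complex.cosh_mul_I, Complex.sinh_mul_I]
      simp
    have hs : Complex.sinh (H 1 (x ξ) * y) = -Complex.sinh (H r (x ξ) * y) := by
      rw [hH]
      simp only
      rw [hy, Complex.sinh_sub, Complex.cosh_mul_I, Complex.sinh_mul_I]
      simp
    refine ⟨?_, mul_left_cancel₀ hy0 ?_⟩
    · rw [hsq, hsq, (hCS _).1, (hCS _).1, hc]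
    · rw [hsq, hsq, mul_neg, ← mul_assoc, ← mul_assoc, mul_comm y, mul_comm y, (hCS _).2,
        (hCS _).2, hs]
  have hglue : ∀ F : ℝ → ℂ → ℂ, (∀ ρ, t < ρ → ρ ≤ 1 → ∀ u ∉ x '' sphere 0 ρ,
      DifferentiableAt ℂ (F ρ) u) → (∀ ξ, r < ‖ξ‖ → ‖ξ‖ < 1 → F 1 (x ξ) = -F r (x ξ)) →
      Differentiable ℂ fun u => if u ∈ K then -F r u else F 1 u := by
    intro F hF hFj u
    by_cases hu : u ∈ K
    · obtain ⟨ξ, hξ, rfl⟩ := hu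
      rw [mem_sphere_zero_iff_norm] at hξ
      refine ((hF r hr hr1.le _ (h.notMem_image hr hr1 hξ)).fun_neg).congr_of_eventuallyEq ?_
      filter_upwards [h.eventually_mem_image hr hr1 hξ] with v hv
      split_ifs with hvK
      · rfl
      · obtain ⟨η, h1, h2, rfl⟩ := hv.resolve_left hvK
        exact hFj η h1 h2
    · refine (hF 1 h.lt_one le_rfl u hu).congr_of_eventuallyEq ?_
      filter_upwards [hKc.isClosed.isOpen_compl.mem_nhds hu] with v hv
      exact if_neg hv
  refine ⟨_, _, hglue (fun ρ u => C (H ρ u ^ 2 * f u)) (fun ρ h1 h2 u hu => (hdC ρ h1 h2 u hu).1)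
      fun ξ h1 h2 => (hjump ξ h1 h2).1,
    hglue (fun ρ u => H ρ u * S (H ρ u ^ 2 * f u)) (fun ρ h1 h2 u hu => (hdC ρ h1 h2 u hu).2)
      fun ξ h1 h2 => (hjump ξ h1 h2).2, fun u hu y hy => ?_⟩
  have hsq : H 1 u ^ 2 * f u = (H 1 u * y) ^ 2 := by rw [mul_pow, hy]
  constructor
  · simp only [if_neg hu]
    rw [hsq, (hCS _).1]
  · simp only [if_neg hu]
    rw [hsq, ← mul_assoc, mul_comm y, (hCS _).2]

end IsUniformizer

end Lemniscate

namespace Lemniscate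

open Metric Filter Topology

/-- The coefficients of the expansion of `periodFn d x 1` at infinity. -/
noncomputable def periodCoef (d : ℕ) (x : ℂ → ℂ) (j : ℕ) : ℂ :=
  (2 * (d + 1) : ℂ)⁻¹ * ∮ ξ in C(0, 1), (x ξ ^ d * (Complex.I * ξ))⁻¹ * x ξ ^ j

namespace IsUniformizer

variable {d : ℕ} {t : ℝ} {κ : ℂ} {x : ℂ → ℂ}

theorem exists_norm_kernel_le (h : IsUniformizer d t κ x) :
    ∃ B, ∀ ξ ∈ sphere (0 : ℂ) 1, ‖(x ξ ^ d * (Complex.I * ξ))⁻¹‖ ≤ B :=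
  (isCompact_sphere (0 : ℂ) 1).exists_bound_of_continuousOn
    (h.differentiableOn_kernel.continuousOn.mono (h.sphere_subset h.lt_one le_rfl))

theorem summable_norm_periodCoef (h : IsUniformizer d t κ x)
    (hx : ∀ ξ ∈ sphere (0 : ℂ) 1, ‖x ξ‖ ≤ 1 / 2) : Summable fun j => ‖periodCoef d x j‖ := by
  obtain ⟨B, hB⟩ := h.exists_norm_kernel_le
  refine Summable.of_nonneg_of_le (fun _ => norm_nonneg _) (fun j => ?_)
    (summable_geometric_two.mul_left (‖(2 * (d + 1) : ℂ)⁻¹‖ * (2 * Real.pi * 1 * B)))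
  rw [periodCoef, norm_mul, mul_assoc ‖(2 * (d + 1) : ℂ)⁻¹‖]
  refine mul_le_mul_of_nonneg_left ?_ (norm_nonneg _)
  rw [mul_assoc (2 * Real.pi * 1)]
  refine circleIntegral.norm_integral_le_of_norm_le_const zero_le_one fun ξ hξ => ?_
  rw [norm_mul, norm_pow]
  have h1 := hx ξ hξ
  have h2 := hB ξ hξ
  have hB0 : 0 ≤ B := (norm_nonneg _).trans h2
  gcongr

theorem hasSum_periodFn (h : IsUniformizer d t κ x)
    (hx : ∀ ξ ∈ sphere (0 : ℂ) 1, ‖x ξ‖ ≤ 1 / 2) {u : ℂ} (hu : ‖u‖ = 1) :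
    HasSum (fun j : ℕ => periodCoef d x j * u ^ (-(j + 1) : ℤ)) (periodFn d x 1 u) := by
  obtain ⟨B, hB⟩ := h.exists_norm_kernel_le
  have hu0 : u ≠ 0 := norm_ne_zero_iff.1 (hu ▸ one_ne_zero)
  have hs := h.sphere_subset h.lt_one le_rfl
  have hsum : HasSum (fun j : ℕ => ∮ ξ in C(0, 1),
      u ^ (-(j + 1) : ℤ) * ((x ξ ^ d * (Complex.I * ξ))⁻¹ * x ξ ^ j))
      (∮ ξ in C(0, 1), (x ξ ^ d * (Complex.I * ξ))⁻¹ * (u - x ξ)⁻¹) := by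
    refine hasSum_circleIntegral (b := fun j => B * (1 / 2) ^ j) (fun j => ?_) (fun j ξ hξ => ?_)
      (summable_geometric_two.mul_left B) fun ξ hξ => ?_
    · rw [abs_one]
      exact continuousOn_const.mul ((h.differentiableOn_kernel.continuousOn.mono hs).mul
        ((h.differentiableOn.continuousOn.mono hs).pow j))
    · rw [abs_one] at hξ
      rw [norm_mul, norm_zpow, hu, one_zpow, one_mul, norm_mul, norm_pow]
      have h1 := hx ξ hξ
      have h2 := hB ξ hξ
      have hB0 : 0 ≤ B := (norm_nonneg _).trans h2
      gcongr
    · rw [abs_one] at hξ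
      have h1 : ‖x ξ / u‖ < 1 := by
        rw [norm_div, hu, div_one]
        exact (hx ξ hξ).trans_lt (by norm_num)
      have hne : u - x ξ ≠ 0 := fun h3 => by
        have h4 := hx ξ hξ
        rw [← sub_eq_zero.1 h3, hu] at h4
        norm_num at h4
      have h2 := (hasSum_geometric_of_norm_lt_one h1).mul_left
        ((x ξ ^ d * (Complex.I * ξ))⁻¹ * u⁻¹)
      have e : (x ξ ^ d * (Complex.I * ξ))⁻¹ * u⁻¹ * (1 - x ξ / u)⁻¹ =
          (x ξ ^ d * (Complex.I * ξ))⁻¹ * (u - x ξ)⁻¹ := by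
        rw [mul_assoc, ← mul_inv, mul_sub, mul_one, mul_div_cancel₀ _ hu0]
      rw [e] at h2
      refine h2.congr_fun fun j => ?_
      rw [zpow_neg, div_pow]
      norm_cast
      rw [pow_succ]
      field_simp
  refine (hsum.mul_left (2 * (d + 1) : ℂ)⁻¹).congr_fun fun j => ?_
  rw [circleIntegral.integral_const_mul, periodCoef]
  ring

theorem transcendental_periodCoef (h : IsUniformizer d t κ x) (hκ : IsAlgebraic ℚ κ)
    (ht : IsAlgebraic ℚ (t : ℂ)) (hx : ∀ ξ ∈ sphere (0 : ℂ) 1, ‖x ξ‖ ≤ 1 / 2)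
    (hα : ∀ l < d, periodCoef d x l ≠ 0) {i : ℕ} (hi : i < d) :
    Transcendental ℚ (periodCoef d x i) := by
  obtain ⟨P, Q, hP, hQ, hPQ⟩ := h.exists_extension
  have ht0 : (t : ℂ) ≠ 0 := by exact_mod_cast h.pos.ne'
  have h1 : IsAlgebraic ℚ (1 : ℂ) := isAlgebraic_one
  have hmem : ∀ ξ ∈ sphere (0 : ℂ) 1, ξ ∈ annulus t := h.sphere_subset h.lt_one le_rfl
  have hbranch : ∀ ξ ∈ sphere (0 : ℂ) 1, ∀ u : ℂ, ‖u‖ = 1 →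
      u ^ (d + 1) - κ * (1 + t ^ 2 + t * (ξ + ξ⁻¹)) ≠ 0 := by
    intro ξ hξ u hu h2
    rw [← h.pow_eq ξ (hmem ξ hξ)] at h2
    have h3 : ‖x ξ‖ ^ (d + 1) = 1 := by
      rw [← norm_pow, ← sub_eq_zero.1 h2, norm_pow, hu, one_pow]
    have h4 : ‖x ξ‖ ^ (d + 1) < 1 :=
      pow_lt_one₀ (norm_nonneg _) ((hx ξ hξ).trans_lt (by norm_num)) d.succ_ne_zero
    linarith
  refine transcendental_of_entire_extension (c := κ * (1 - t) ^ 2) (e := κ * (1 + t) ^ 2)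
    (hκ.mul ((h1.sub ht).pow 2)) (hκ.mul ((h1.add ht).pow 2)) ?_ (h.summable_norm_periodCoef hx) hα
    hP hQ (fun u hu => h.hasSum_periodFn hx hu) (fun u hu => ?_) hi
  · intro h2
    have h3 := mul_left_cancel₀ h.ne_zero h2
    apply ht0
    linear_combination -h3 / 4
  · have hf : (κ * (1 - t) ^ 2 - u ^ (d + 1)) * (u ^ (d + 1) - κ * (1 + t) ^ 2) ≠ 0 := by
      refine mul_ne_zero ?_ ?_
      · have := hbranch (-1) (by simp) u hu
        contrapose! this
        rw [inv_neg, inv_one]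
        linear_combination -this
      · have := hbranch 1 (by simp) u hu
        contrapose! this
        rw [inv_one]
        linear_combination this
    obtain ⟨y, hy⟩ := IsAlgClosed.exists_pow_nat_eq ((κ * (1 - t) ^ 2 - u ^ (d + 1)) * (u ^ (d + 1) - κ * (1 + t) ^ 2)) two_pos
    have huK : u ∉ x '' sphere 0 1 := by
      rintro ⟨ξ, hξ, rfl⟩
      have := hx ξ hξ
      rw [hu] at this
      norm_num at this
    exact ⟨y, fun h0 => hf (by rw [← hy, h0]; simp), hy, hPQ u huK y hy⟩

end IsUniformizer

end Lemniscate

namespace Lemniscate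

open Metric Filter Topology

/-- The uniformizing function normalized to have modulus at most `1 / 2` on the unit circle. -/
noncomputable def uniformizer (n : ℕ) (t : ℝ) (ξ : ℂ) : ℂ :=
  (((1 / 2) * (((1 + t) ^ 2)⁻¹) ^ (n⁻¹ : ℝ) : ℝ) : ℂ) *
    ((1 + t * ξ) ^ (n⁻¹ : ℂ) * (1 + t * ξ⁻¹) ^ (n⁻¹ : ℂ))

section

variable {n : ℕ} {t : ℝ}

theorem one_add_mem_slitPlane (ht : 0 < t) {ξ : ℂ} (hξ : ξ ∈ annulus t) :
    1 + (t : ℂ) * ξ ∈ Complex.slitPlane := by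
  refine Complex.mem_slitPlane_of_norm_lt_one ?_
  rw [norm_mul, Complex.norm_real, Real.norm_eq_abs, abs_of_pos ht]
  calc t * ‖ξ‖ < t * t⁻¹ := mul_lt_mul_of_pos_left hξ.2 ht
    _ = 1 := mul_inv_cancel₀ ht.ne'

theorem isUniformizer_uniformizer {d : ℕ} (ht : 0 < t) (ht1 : t < 1) :
    IsUniformizer d t ((1 / 2) ^ (d + 1) * ((1 + (t : ℂ)) ^ 2)⁻¹) (uniformizer (d + 1) t) where
  pos := ht
  lt_one := ht1
  ne_zero := by
    have : (1 + t : ℂ) ≠ 0 := by exact_mod_cast (by linarith : 1 + t ≠ 0)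
    exact mul_ne_zero (pow_ne_zero _ (by norm_num)) (inv_ne_zero (pow_ne_zero 2 this))
  differentiableOn := by
    intro ξ hξ
    have h0 := IsUniformizer.ne_zero_of_mem ht hξ
    have h1 := one_add_mem_slitPlane ht hξ
    have h2 := one_add_mem_slitPlane ht (IsUniformizer.inv_mem ht hξ)
    refine DifferentiableAt.differentiableWithinAt (DifferentiableAt.const_mul ?_ _)
    refine DifferentiableAt.mul ?_ ?_
    · exact ((differentiableAt_id.const_mul _).const_add _).cpow_const h1
    · exact (((differentiableAt_inv h0).const_mul _).const_add _).cpow_const h2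
  pow_eq := by
    intro ξ hξ
    have h0 := IsUniformizer.ne_zero_of_mem ht hξ
    have h1 : (((1 / 2) * (((1 + t) ^ 2)⁻¹) ^ (((d + 1 : ℕ) : ℝ)⁻¹) : ℝ)) ^ (d + 1) =
        (1 / 2) ^ (d + 1) * ((1 + t) ^ 2)⁻¹ := by
      rw [mul_pow, Real.rpow_inv_natCast_pow (by positivity) d.succ_ne_zero]
    rw [uniformizer, mul_pow, mul_pow, Complex.cpow_nat_inv_pow _ d.succ_ne_zero,
      Complex.cpow_nat_inv_pow _ d.succ_ne_zero, ← Complex.ofReal_pow, h1]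
    push_cast
    field_simp
    ring
  apply_inv := by
    intro ξ _
    rw [uniformizer, uniformizer, inv_inv, mul_comm ((1 + (t : ℂ) * ξ⁻¹) ^ _)]

/-- The modulus parameter of the elliptic-type integrals attached to `t`. -/
noncomputable def modulus (t : ℝ) : ℝ := 4 * t / (1 + t) ^ 2

theorem one_sub_modulus_mul_sin_sq_mem (ht : 0 < t) (ht1 : t < 1) (θ : ℝ) :
    0 < 1 - modulus t * Real.sin θ ^ 2 ∧ 1 - modulus t * Real.sin θ ^ 2 ≤ 1 := by
  have hm : 0 < modulus t := by unfold modulus; positivity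
  have hm1 : modulus t < 1 := by
    rw [modulus, div_lt_one (by positivity)]
    nlinarith [sq_pos_of_pos (sub_pos.2 ht1)]
  have h1 := Real.sin_sq_le_one θ
  have h2 := sq_nonneg (Real.sin θ)
  constructor <;> nlinarith

theorem uniformizer_circleMap (ht : 0 < t) (ht1 : t < 1) (θ : ℝ) :
    uniformizer n t (circleMap 0 1 θ) =
      (((1 / 2) * (1 - modulus t * Real.sin (θ / 2) ^ 2) ^ (n⁻¹ : ℝ) : ℝ) : ℂ) := by
  set ξ := circleMap 0 1 θ with hξ
  have hξn : ‖ξ‖ = 1 := by simp [hξ]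
  have hmem : ξ ∈ annulus t := ⟨by rwa [hξn], by rw [hξn]; exact (one_lt_inv₀ ht).2 ht1⟩
  have hinv : ξ⁻¹ = (starRingEnd ℂ) ξ := by
    rw [Complex.inv_def, Complex.normSq_eq_norm_sq, hξn]
    simp
  set z : ℂ := 1 + t * ξ with hz
  have hslit := one_add_mem_slitPlane ht hmem
  have hconj : 1 + (t : ℂ) * ξ⁻¹ = (starRingEnd ℂ) z := by
    rw [hz, hinv]
    simp
  have hre : ξ.re = Real.cos θ := by simp [hξ, circleMap, Complex.exp_ofReal_mul_I_re]
  have him : ξ.im = Real.sin θ := by simp [hξ, circleMap, Complex.exp_ofReal_mul_I_im]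
  have hcos : Real.cos θ = 1 - 2 * Real.sin (θ / 2) ^ 2 := by
    have := Real.cos_two_mul (θ / 2)
    rw [mul_div_cancel₀ _ (two_ne_zero' ℝ)] at this
    rw [this, Real.cos_sq']
    ring
  have hm := one_sub_modulus_mul_sin_sq_mem ht ht1 (θ / 2)
  have hnorm : ‖z‖ ^ 2 = (1 + t) ^ 2 * (1 - modulus t * Real.sin (θ / 2) ^ 2) := by
    rw [← Complex.normSq_eq_norm_sq, Complex.normSq_apply, hz]
    simp only [Complex.add_re, Complex.one_re, Complex.re_ofReal_mul, Complex.add_im,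
      Complex.one_im, Complex.im_ofReal_mul, hre, him, modulus]
    have h1 := Real.sin_sq_add_cos_sq θ
    have h2 : (1 + t) ^ 2 ≠ 0 := by positivity
    field_simp
    rw [hcos] at h1 ⊢
    linear_combination t ^ 2 * h1
  have hcpow : z ^ (n⁻¹ : ℂ) * ((starRingEnd ℂ) z) ^ (n⁻¹ : ℂ) =
      (((1 + t) ^ 2 * (1 - modulus t * Real.sin (θ / 2) ^ 2)) ^ (n⁻¹ : ℝ) : ℝ) := by
    have e : (n⁻¹ : ℂ) = ((n⁻¹ : ℝ) : ℂ) := by push_cast; rfl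
    rw [← hnorm, Complex.conj_cpow _ _ (Complex.mem_slitPlane_iff_arg.1 hslit).1, e,
      Complex.conj_ofReal, Complex.mul_conj, Complex.normSq_eq_norm_sq,
      Complex.norm_cpow_real, ← Real.rpow_natCast, ← Real.rpow_natCast, ← Real.rpow_mul (norm_nonneg _),
      ← Real.rpow_mul (norm_nonneg _), mul_comm]
  rw [uniformizer, hconj, hcpow, ← Complex.ofReal_mul, mul_assoc,
    ← Real.mul_rpow (by positivity) (by have := hm.1; positivity),
    inv_mul_cancel_left₀ (by positivity)]

theorem norm_uniformizer_le (ht : 0 < t) (ht1 : t < 1) {ξ : ℂ} (hξ : ξ ∈ sphere (0 : ℂ) 1) :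
    ‖uniformizer n t ξ‖ ≤ 1 / 2 := by
  obtain ⟨θ, rfl⟩ : ξ ∈ Set.range (circleMap 0 1) := by
    rw [range_circleMap, abs_one]
    exact hξ
  have hm := one_sub_modulus_mul_sin_sq_mem ht ht1 (θ / 2)
  rw [uniformizer_circleMap ht ht1, Complex.norm_real, Real.norm_of_nonneg
    (mul_nonneg (by norm_num) (Real.rpow_nonneg hm.1.le _))]
  have := Real.rpow_le_one hm.1.le hm.2 (inv_nonneg.2 (Nat.cast_nonneg n))
  linarith

/-- The restriction of the uniformizer to the unit circle, as a function of half the argument. -/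
noncomputable def radius (n : ℕ) (t φ : ℝ) : ℝ :=
  (1 / 2) * (1 - modulus t * Real.sin φ ^ 2) ^ (n⁻¹ : ℝ)

theorem radius_pos (ht : 0 < t) (ht1 : t < 1) (φ : ℝ) : 0 < radius n t φ :=
  mul_pos (by norm_num) (Real.rpow_pos_of_pos (one_sub_modulus_mul_sin_sq_mem ht ht1 φ).1 _)

theorem continuous_radius (ht : 0 < t) (ht1 : t < 1) : Continuous (radius n t) := by
  refine continuous_const.mul (Continuous.rpow_const (by fun_prop) fun φ => Or.inl ?_)
  exact (one_sub_modulus_mul_sin_sq_mem ht ht1 φ).1.ne'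

theorem integral_comp_half_eq {F : ℝ → ℝ} (hF : Continuous F)
    (hsymm : ∀ φ, F (Real.pi - φ) = F φ) :
    ∫ θ in (0 : ℝ)..2 * Real.pi, F (θ / 2) = 4 * ∫ φ in (0 : ℝ)..Real.pi / 2, F φ := by
  have h1 : ∫ φ in Real.pi / 2..Real.pi, F φ = ∫ φ in (0 : ℝ)..Real.pi / 2, F φ := by
    have := intervalIntegral.integral_comp_sub_left (a := 0) (b := Real.pi / 2) F Real.pi
    rw [sub_zero, sub_half] at this
    rw [← this]
    simp only [hsymm]
  rw [intervalIntegral.integral_comp_div F two_ne_zero, zero_div,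
    mul_div_cancel_left₀ _ (two_ne_zero' ℝ),
    ← intervalIntegral.integral_add_adjacent_intervals (b := Real.pi / 2)
      (hF.intervalIntegrable _ _) (hF.intervalIntegrable _ _), h1, smul_eq_mul]
  ring

theorem periodCoef_uniformizer {d : ℕ} (ht : 0 < t) (ht1 : t < 1) (j : ℕ) :
    periodCoef d (uniformizer (d + 1) t) j = (2 * (d + 1) : ℂ)⁻¹ *
      ((4 * ∫ φ in (0 : ℝ)..Real.pi / 2,
        radius (d + 1) t φ ^ j / radius (d + 1) t φ ^ d : ℝ) : ℂ) := by
  have hc : Continuous fun φ => radius (d + 1) t φ ^ j / radius (d + 1) t φ ^ d :=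
    ((continuous_radius ht ht1).pow j).div ((continuous_radius ht ht1).pow d)
      fun φ => pow_ne_zero d (radius_pos ht ht1 φ).ne'
  rw [← integral_comp_half_eq hc fun φ => by simp only [radius, Real.sin_pi_sub],
    periodCoef, circleIntegral, ← intervalIntegral.integral_ofReal]
  congr 1
  refine intervalIntegral.integral_congr fun θ _ => ?_
  have h0 : circleMap 0 1 θ ≠ 0 := circleMap_ne_center one_ne_zero
  have h1 := Complex.I_ne_zero
  simp only [deriv_circleMap, uniformizer_circleMap ht ht1, smul_eq_mul]
  rw [← radius]
  push_cast
  field_simp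

theorem periodCoef_uniformizer_ne_zero {d : ℕ} (ht : 0 < t) (ht1 : t < 1) (j : ℕ) :
    periodCoef d (uniformizer (d + 1) t) j ≠ 0 := by
  have hc : Continuous fun φ => radius (d + 1) t φ ^ j / radius (d + 1) t φ ^ d :=
    ((continuous_radius ht ht1).pow j).div ((continuous_radius ht ht1).pow d)
      fun φ => pow_ne_zero d (radius_pos ht ht1 φ).ne'
  rw [periodCoef_uniformizer ht ht1]
  refine mul_ne_zero (inv_ne_zero (by exact_mod_cast (by positivity : 2 * (d + 1) ≠ 0))) ?_
  refine Complex.ofReal_ne_zero.2 (mul_ne_zero four_ne_zero (ne_of_gt ?_))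
  refine intervalIntegral.intervalIntegral_pos_of_pos (hc.intervalIntegrable _ _) (fun φ => ?_)
    (by positivity)
  have := radius_pos (n := d + 1) ht ht1 φ
  positivity

end

end Lemniscate

namespace Lemniscate

open Metric Filter Topology

theorem transcendental_two_pi_mul_I : Transcendental ℚ (2 * Real.pi * Complex.I : ℂ) := by
  intro hpi
  refine periodic_schneider_lang (d := 1) (ι := Unit) le_rfl (fun _ _ => MvPolynomial.X ())
    (fun _ => 1) (fun _ => isAlgebraic_one) (fun _ _ => 2 * Real.pi * Complex.I)
    (fun v => ⟨fun _ => v 0 / (2 * Real.pi * Complex.I), ?_⟩) 0 (fun _ => hpi) (fun _ => ())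
    ?_ fun M => ⟨1, 1, zero_le_one, fun R hR => ⟨fun _ => 1, fun _ z => Complex.exp (z 0), ?_⟩⟩
  · funext i
    have : (2 * Real.pi * Complex.I : ℂ) ≠ 0 := Complex.two_pi_I_ne_zero
    rw [Subsingleton.elim i 0]
    simp only [Fin.sum_univ_one, Pi.smul_apply, smul_eq_mul]
    rw [div_mul_cancel₀ _ this]
  · simp
  · exact
      { analytic_den := fun z _ => analyticAt_const
        analytic_num := fun _ z _ => by
          exact (ContinuousLinearMap.proj (R := ℂ) (φ := fun _ : Fin 1 => ℂ) 0).analyticAt z |>.cexp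
        norm_den_le := fun z _ => by
          rw [norm_one]
          exact Real.one_le_exp (by positivity)
        norm_num_le := fun _ z hz => by
          rw [Complex.norm_exp]
          have h1 := (Complex.re_le_norm (z 0)).trans (norm_le_pi_norm z 0)
          have h2 := mem_ball_zero_iff.1 hz
          refine Real.exp_le_exp.2 ?_
          nlinarith
        le_norm_den := fun m _ => by
          rw [norm_one, Real.exp_le_one_iff]
          nlinarith [sq_nonneg R]
        num_eq := fun m _ _ => by
          simp only [gridPoint, Fin.sum_univ_one, Pi.smul_apply, smul_eq_mul, mul_one]
          exact Complex.exp_nat_mul_two_pi_mul_I _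
        ode := fun m _ => Eventually.of_forall fun z l i => by
          have h := ((ContinuousLinearMap.proj (R := ℂ) (φ := fun _ : Fin 1 => ℂ)
            0).hasFDerivAt (x := z)).cexp
          rw [Subsingleton.elim l 0]
          simp only [div_one]
          rw [show (fun z : Fin 1 → ℂ => Complex.exp (z 0)) = fun z => Complex.exp
            (ContinuousLinearMap.proj (R := ℂ) (φ := fun _ : Fin 1 => ℂ) 0 z) from rfl, h.fderiv]
          simp }

theorem transcendental_integral {k : ℕ} (hk : 2 ≤ k) {t : ℝ} (ht : 0 < t) (ht1 : t < 1)
    (htAlg : IsAlgebraic ℚ t) :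
    Transcendental ℚ (∫ φ in (0 : ℝ)..Real.pi / 2,
      (1 - modulus t * Real.sin φ ^ 2) ^ (-(((k : ℝ) - 1) / (2 * (k : ℝ))))) := by
  obtain ⟨d, rfl⟩ : ∃ d, d + 2 = k := ⟨k - 2, by omega⟩
  intro hI
  have htC : IsAlgebraic ℚ (t : ℂ) := htAlg.algebraMap (A := ℂ)
  refine (isUniformizer_uniformizer (d := 2 * d + 3) ht ht1).transcendental_periodCoef ?_ htC
    (fun ξ hξ => norm_uniformizer_le ht ht1 hξ)
    (fun l _ => periodCoef_uniformizer_ne_zero ht ht1 l) (i := d + 2) (by omega) ?_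
  · have h2 : IsAlgebraic ℚ (1 / 2 : ℂ) := by
      simpa using isAlgebraic_algebraMap (R := ℚ) (A := ℂ) (1 / 2)
    exact (h2.pow _).mul ((isAlgebraic_one.add htC).pow 2).inv
  · have hInt : ∫ φ in (0 : ℝ)..Real.pi / 2,
        radius (2 * d + 3 + 1) t φ ^ (d + 2) / radius (2 * d + 3 + 1) t φ ^ (2 * d + 3) =
        2 ^ (d + 1) * ∫ φ in (0 : ℝ)..Real.pi / 2, (1 - modulus t * Real.sin φ ^ 2) ^
          (-((((d + 2 : ℕ) : ℝ) - 1) / (2 * ((d + 2 : ℕ) : ℝ)))) := by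
      rw [← intervalIntegral.integral_const_mul]
      refine intervalIntegral.integral_congr fun φ _ => ?_
      have hm := (one_sub_modulus_mul_sin_sq_mem ht ht1 φ).1
      have hr := radius_pos (n := 2 * d + 3 + 1) ht ht1 φ
      have h1 : radius (2 * d + 3 + 1) t φ ^ (d + 2) / radius (2 * d + 3 + 1) t φ ^ (2 * d + 3) =
          (radius (2 * d + 3 + 1) t φ ^ (d + 1))⁻¹ := by
        field_simp
        ring
      rw [h1, radius, mul_pow, mul_inv, ← Real.rpow_mul_natCast hm.le, ← Real.rpow_neg hm.le]
      congr 1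
      · simp
      · congr 2
        push_cast
        field_simp
        ring
    rw [periodCoef_uniformizer ht ht1, hInt]
    have hIC := hI.algebraMap (A := ℂ)
    have hq : ∀ m : ℕ, IsAlgebraic ℚ (m : ℂ) := fun m => isAlgebraic_natCast m
    have e : (2 * ((2 * d + 3 : ℕ) + 1) : ℂ) = ((2 * (2 * d + 3 + 1) : ℕ) : ℂ) := by push_cast; ring
    rw [e]
    refine (hq _).inv.mul ?_
    rw [Complex.ofReal_mul, Complex.ofReal_mul]
    refine IsAlgebraic.mul (by simpa using hq 4) (IsAlgebraic.mul ?_ hIC)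
    simpa using (hq 2).pow (d + 1)

theorem transcendental_of_mul {x y : ℝ} (hx : IsAlgebraic ℚ x) (hx0 : x ≠ 0)
    (hy : Transcendental ℚ y) : Transcendental ℚ (x * y) := fun h => hy <| by
  have := hx.inv.mul h
  rwa [inv_mul_cancel_left₀ hx0] at this

end Lemniscate

theorem stmt_18 (k : ℕ) (hk : 1 ≤ k) (a : ℝ) (haAlg : IsAlgebraic ℚ a) (ha0 : 0 < a) (ha1 : a < 1) :
    Transcendental ℚ ((4 / (1 + a ^ k) ^ (((k : ℝ) - 1) / (k : ℝ))) *
        ∫ φ in (0:ℝ)..(Real.pi / 2), (1 - (4 * a ^ k / (1 + a ^ k) ^ 2) * Real.sin φ ^ 2) ^ (-(((k : ℝ) - 1) / (2 * (k : ℝ))))) := by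
  have h4 : IsAlgebraic ℚ (4 : ℝ) := by simpa using isAlgebraic_natCast (R := ℚ) (A := ℝ) 4
  rcases hk.eq_or_lt with rfl | hk2
  · intro h
    simp only [Nat.cast_one, sub_self, zero_div, neg_zero, Real.rpow_zero, div_one,
      intervalIntegral.integral_const, sub_zero, smul_eq_mul, mul_one] at h
    have hI : IsAlgebraic ℚ Complex.I := Complex.isIntegral_rat_I.isAlgebraic
    refine Lemniscate.transcendental_two_pi_mul_I ?_
    have e : (2 * Real.pi * Complex.I : ℂ) = ((4 * (Real.pi / 2) : ℝ) : ℂ) * Complex.I := by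
      push_cast
      ring
    rw [e]
    exact (h.algebraMap (A := ℂ)).mul hI
  · have hak : 0 < a ^ k := pow_pos ha0 k
    have hbase : 0 < 1 + a ^ k := by positivity
    refine Lemniscate.transcendental_of_mul ?_ (by positivity)
      (Lemniscate.transcendental_integral hk2 hak (pow_lt_one₀ ha0.le ha1 (by omega)) (haAlg.pow k))
    rw [div_eq_mul_inv]
    refine h4.mul (IsAlgebraic.inv (IsAlgebraic.of_pow (n := k) (by omega) ?_))
    rw [← Real.rpow_mul_natCast hbase.le, div_mul_cancel₀ _ (by positivity),
      show (k : ℝ) - 1 = (k - 1 : ℕ) by rw [Nat.cast_sub hk, Nat.cast_one], Real.rpow_natCast]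
    exact (isAlgebraic_one.add (haAlg.pow k)).pow _
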